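/- For every d ≥ 3 and ε > 0 there exist constants c, C > 0, δ ∈ (0,1) and an integer L ≥ 1, all depending only on d and ε, such that for every h ∈ (h̃(d)+3ε, h**(d)−3ε) and all radii R ≥ 2r > 0: (i) P[B_r ↔ ∂B_R in T_δ{φ^L ≥ h}] ≥ P[B_r ↔ ∂B_R in {φ ≥ h+ε}] − C·exp(−e^{c(log r)^{1/3}}); and (ii) P[B_r ↔ ∂B_R in T_δ{φ^L ≥ h}] ≤ P[B_r ↔ ∂B_R in {φ ≥ h−ε}] + C·exp(−e^{c(log r)^{1/3}}). -/

import Mathlib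

open MeasureTheory ProbabilityTheory Filter Set

namespace GFFperc

noncomputable section

/-- The lattice `ℤ^d`. -/
abbrev V (d : ℕ) := Fin d → ℤ

/-- Nearest-neighbour adjacency on `ℤ^d`. -/
def adj {d : ℕ} (x y : V d) : Prop := (∑ i, (x i - y i).natAbs) = 1

/-- `ℓ∞` distance between two points. -/
def dinf {d : ℕ} (x y : V d) : ℕ := Finset.univ.sup fun i => (x i - y i).natAbs

/-- `A` and `B` are joined by a nearest-neighbour path contained in `S`. -/
def ConnIn {d : ℕ} (S A B : Set (V d)) : Prop :=
  ∃ (n : ℕ) (γ : ℕ → V d), γ 0 ∈ A ∧ γ n ∈ B ∧ (∀ k, k ≤ n → γ k ∈ S) ∧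
    ∀ k, k < n → adj (γ k) (γ (k + 1))

/-- A set is connected: any two of its points are joined inside it. -/
def IsConnSet {d : ℕ} (S : Set (V d)) : Prop := ∀ x ∈ S, ∀ y ∈ S, ConnIn S {x} {y}

/-- The connected component of `x` in `S`. -/
def comp {d : ℕ} (S : Set (V d)) (x : V d) : Set (V d) := {y | ConnIn S {x} {y}}

/-- Box of (real) radius `r` centered at `x`. -/
def boxAt {d : ℕ} (x : V d) (r : ℝ) : Set (V d) := {y | ∀ i, |(y i : ℝ) - (x i : ℝ)| ≤ r}

def box (d : ℕ) (r : ℝ) : Set (V d) := boxAt (0 : V d) r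

/-- Inner vertex boundary of the box of radius `r` centered at `x`. -/
def bdryAt {d : ℕ} (x : V d) (r : ℝ) : Set (V d) :=
  {y | y ∈ boxAt x r ∧ ∃ z, z ∉ boxAt x r ∧ adj y z}

def bdry (d : ℕ) (r : ℝ) : Set (V d) := bdryAt (0 : V d) r

/-- `A` is connected to infinity within `S`. -/
def ConnToInf {d : ℕ} (S A : Set (V d)) : Prop := ∀ R : ℕ, 1 ≤ R → ConnIn S A (bdry d R)

/-- The `ℓ∞`-diameter of `S` is at least `r`. -/
def diamGE {d : ℕ} (S : Set (V d)) (r : ℝ) : Prop := ∃ x ∈ S, ∃ y ∈ S, r ≤ (dinf x y : ℝ)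

def unitV (d : ℕ) (i : Fin d) : V d := fun j => if j = i then 1 else 0

/-- `k`-step transition probabilities of simple random walk on `ℤ^d`. -/
def srwP (d : ℕ) : ℕ → V d → V d → ℝ
  | 0, x, y => if x = y then 1 else 0
  | (k + 1), x, y =>
      (1 / (2 * d)) * ∑ i : Fin d, (srwP d k (x + unitV d i) y + srwP d k (x - unitV d i) y)

/-- Green function of simple random walk on `ℤ^d`. -/
def green (d : ℕ) (x y : V d) : ℝ := ∑' k : ℕ, srwP d k x y

/-- `ℓ`-step transition kernel of the lazy simple random walk on `ℤ^d`. -/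
def lazyP (d : ℕ) : ℕ → V d → V d → ℝ
  | 0, x, y => if x = y then 1 else 0
  | (k + 1), x, y =>
      (1 / 2) * lazyP d k x y +
        (1 / (4 * d)) * ∑ i : Fin d, (lazyP d k (x + unitV d i) y + lazyP d k (x - unitV d i) y)

/-- `φ` is a centered Gaussian field with covariance function `C`: every finite linear
combination is a centered Gaussian variable with the corresponding variance. -/
def IsCGF {Ω : Type*} [MeasurableSpace Ω] {d : ℕ} (P : Measure Ω)
    (φ : V d → Ω → ℝ) (C : V d → V d → ℝ) : Prop :=
  (∀ x, Measurable (φ x)) ∧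
    ∀ (s : Finset (V d)) (a : V d → ℝ),
      Measure.map (fun ω => ∑ x ∈ s, a x * φ x ω) P =
        gaussianReal 0 (Real.toNNReal (∑ x ∈ s, ∑ y ∈ s, a x * a y * C x y))

/-- `φ` is a Gaussian free field on `ℤ^d`. -/
def IsGFF {Ω : Type*} [MeasurableSpace Ω] {d : ℕ} (P : Measure Ω) (φ : V d → Ω → ℝ) : Prop :=
  IsCGF P φ (green d)

/-- The level set `{φ ≥ h}`. -/
def lvl {d : ℕ} {Ω : Type*} (φ : V d → Ω → ℝ) (h : ℝ) (ω : Ω) : Set (V d) := {x | h ≤ φ x ω}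

/-- The whole field, as one random variable with values in `V d → ℝ`. -/
def proc {Ω : Type*} {d : ℕ} (φ : V d → Ω → ℝ) : Ω → V d → ℝ := fun ω x => φ x ω

/-- The critical parameter `h_*`. -/
def hStar (d : ℕ) {Ω : Type*} [MeasurableSpace Ω] (P : Measure Ω) (φ : V d → Ω → ℝ) : ℝ :=
  sInf {h : ℝ | P {ω | ConnToInf (lvl φ h ω) {(0 : V d)}} = 0}

/-- The critical parameter `h_{**}`. -/
def hStarStar (d : ℕ) {Ω : Type*} [MeasurableSpace Ω] (P : Measure Ω) (φ : V d → Ω → ℝ) : ℝ :=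
  sInf {h : ℝ |
    (⨅ R : ℕ, P {ω | ConnIn (lvl φ h ω) (box d ((R : ℝ) + 1)) (bdry d (2 * ((R : ℝ) + 1)))}) = 0}

/-- `u(R) = exp((log R)^{1/3})`. -/
def ufn (R : ℝ) : ℝ := Real.exp (Real.log R ^ ((1 : ℝ) / 3))

def tildeSet (d : ℕ) {Ω : Type*} [MeasurableSpace Ω] (P : Measure Ω) (φ : V d → Ω → ℝ) :
    Set ℝ :=
  {h : ℝ |
    (⨅ R : ℕ, ENNReal.ofReal (((R : ℝ) + 1) ^ d) *
        P {ω | ¬ ConnIn (lvl φ h ω) (box d (ufn ((R : ℝ) + 1))) (bdry d ((R : ℝ) + 1))}) = 0}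

/-- The critical parameter `h̃`. -/
def hTilde (d : ℕ) {Ω : Type*} [MeasurableSpace Ω] (P : Measure Ω) (φ : V d → Ω → ℝ) : ℝ :=
  sSup (tildeSet d P φ)

/-- The event `Exist(R,α)`. -/
def ExistEv (d : ℕ) {Ω : Type*} (φ : V d → Ω → ℝ) (R : ℕ) (α : ℝ) : Set Ω :=
  {ω | ∃ x ∈ lvl φ α ω ∩ box d (R : ℝ),
    diamGE (comp (lvl φ α ω ∩ box d (R : ℝ)) x) ((R : ℝ) / 5)}

/-- The event `Unique(R,α)`. -/
def UniqueEv (d : ℕ) {Ω : Type*} (φ : V d → Ω → ℝ) (R : ℕ) (α : ℝ) : Set Ω :=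
  {ω | ∀ x ∈ lvl φ α ω ∩ box d (R : ℝ), ∀ y ∈ lvl φ α ω ∩ box d (R : ℝ),
    diamGE (comp (lvl φ α ω ∩ box d (R : ℝ)) x) ((R : ℝ) / 10) →
    diamGE (comp (lvl φ α ω ∩ box d (R : ℝ)) y) ((R : ℝ) / 10) →
    ConnIn (lvl φ α ω ∩ box d (2 * (R : ℝ))) {x} {y}}

/-- `φ` strongly percolates up to level `h`. -/
def StronglyPerc (d : ℕ) {Ω : Type*} [MeasurableSpace Ω] (P : Measure Ω)
    (φ : V d → Ω → ℝ) (h : ℝ) : Prop :=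
  ∃ c : ℝ, 0 < c ∧ ∃ ρ : ℝ, ρ ∈ Set.Ioc (0 : ℝ) 1 ∧
    ∀ α : ℝ, α ≤ h → ∀ R : ℕ, 1 ≤ R →
      ENNReal.ofReal (1 - Real.exp (-c * (R : ℝ) ^ ρ)) ≤ P (ExistEv d φ R α) ∧
      ENNReal.ofReal (1 - Real.exp (-c * (R : ℝ) ^ ρ)) ≤ P (UniqueEv d φ R α)

/-- The critical parameter `h̄`. -/
def hBar (d : ℕ) {Ω : Type*} [MeasurableSpace Ω] (P : Measure Ω) (φ : V d → Ω → ℝ) : ℝ :=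
  sSup {h : ℝ | StronglyPerc d P φ h}


/-- Covariance of the truncated field `φ^L`. -/
def covTrunc (d L : ℕ) (x y : V d) : ℝ := (1 / 2) * ∑ ℓ ∈ Finset.range (L + 1), lazyP d ℓ x y

/-- Covariance of the tail field `φ - φ^L`. -/
def covTail (d L : ℕ) (x y : V d) : ℝ := (1 / 2) * ∑' ℓ : ℕ, lazyP d (ℓ + L + 1) x y

/-- `U` is a family of i.i.d. uniform-`[0,1]` random variables. -/
def IsIIDUnif {Ω : Type*} [MeasurableSpace Ω] {d : ℕ} (P : Measure Ω)
    (U : V d → Ω → ℝ) : Prop :=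
  (∀ x, Measurable (U x)) ∧
    (∀ x, Measure.map (U x) P = volume.restrict (Set.Icc (0 : ℝ) 1)) ∧
    iIndepFun U P

/-- The noised level set `T_δ {φ^L ≥ h}`, driven by the uniform variables `U`. -/
def TdLvl {Ω : Type*} {d : ℕ} (U φL : V d → Ω → ℝ) (δ h : ℝ) (ω : Ω) : Set (V d) :=
  {x | 1 - δ / 2 ≤ U x ω ∨ (δ / 2 < U x ω ∧ U x ω < 1 - δ / 2 ∧ h ≤ φL x ω)}

/-- `h_*(δ,L)` for the noised truncated model. -/
def hStarT (d : ℕ) {Ω : Type*} [MeasurableSpace Ω] (P : Measure Ω)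
    (U φL : V d → Ω → ℝ) (δ : ℝ) : ℝ :=
  sInf {h : ℝ | P {ω | ConnToInf (TdLvl U φL δ h ω) {(0 : V d)}} = 0}

/-- `h_{**}(δ,L)` for the noised truncated model. -/
def hStarStarT (d : ℕ) {Ω : Type*} [MeasurableSpace Ω] (P : Measure Ω)
    (U φL : V d → Ω → ℝ) (δ : ℝ) : ℝ :=
  sInf {h : ℝ |
    (⨅ R : ℕ, P {ω | ConnIn (TdLvl U φL δ h ω) (box d ((R : ℝ) + 1))
      (bdry d (2 * ((R : ℝ) + 1)))}) = 0}

/-- `h̃(δ,L)` for the noised truncated model. -/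
def hTildeT (d : ℕ) {Ω : Type*} [MeasurableSpace Ω] (P : Measure Ω)
    (U φL : V d → Ω → ℝ) (δ : ℝ) : ℝ :=
  sSup {h : ℝ |
    (⨅ R : ℕ, ENNReal.ofReal (((R : ℝ) + 1) ^ d) *
        P {ω | ¬ ConnIn (TdLvl U φL δ h ω) (box d (ufn ((R : ℝ) + 1)))
          (bdry d ((R : ℝ) + 1))}) = 0}

/-- The truncated fields `φ^L` are coupled with `φ` so that, for each `L`, `φ^L` and
`φ - φ^L` are independent centered Gaussian fields with the stated covariances. -/
def IsTruncCoupling (d : ℕ) {Ω : Type*} [MeasurableSpace Ω] (P : Measure Ω)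
    (φ : V d → Ω → ℝ) (φL : ℕ → V d → Ω → ℝ) : Prop :=
  ∀ L : ℕ, IsCGF P (φL L) (covTrunc d L) ∧
    IsCGF P (fun x ω => φ x ω - φL L x ω) (covTail d L) ∧
    IndepFun (proc (φL L)) (proc fun x ω => φ x ω - φL L x ω) P

section ProductSpace

variable {ι : Type*} [DecidableEq ι] (ν : ι → Measure ℝ) [∀ i, IsProbabilityMeasure (ν i)]

/-- Measurable functions with values in `[0,1]`. -/
structure IsUnitFn {α : Type*} [MeasurableSpace α] (f : α → ℝ) : Prop where
  meas : Measurable f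
  nonneg : ∀ w, 0 ≤ f w
  le_one : ∀ w, f w ≤ 1

lemma IsUnitFn.integrable {α : Type*} [MeasurableSpace α] {f : α → ℝ} (hf : IsUnitFn f)
    (μ : Measure α) [IsProbabilityMeasure μ] : Integrable f μ :=
  Integrable.of_bound hf.meas.aestronglyMeasurable 1
    (ae_of_all _ fun w => by
      rw [Real.norm_eq_abs, abs_of_nonneg (hf.nonneg w)]; exact hf.le_one w)

lemma IsUnitFn.mul {α : Type*} [MeasurableSpace α] {f g : α → ℝ} (hf : IsUnitFn f)
    (hg : IsUnitFn g) : IsUnitFn fun w => f w * g w :=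
  ⟨hf.meas.mul hg.meas, fun w => mul_nonneg (hf.nonneg w) (hg.nonneg w),
    fun w => mul_le_one₀ (hf.le_one w) (hg.nonneg w) (hg.le_one w)⟩

lemma IsUnitFn.one_sub {α : Type*} [MeasurableSpace α] {f : α → ℝ} (hf : IsUnitFn f) :
    IsUnitFn fun w => 1 - f w :=
  ⟨measurable_const.sub hf.meas, fun w => sub_nonneg.2 (hf.le_one w),
    fun w => by linarith [hf.nonneg w]⟩

lemma IsUnitFn.indicator {α : Type*} [MeasurableSpace α] {s : Set α} (hs : MeasurableSet s) :
    IsUnitFn (s.indicator fun _ => (1 : ℝ)) :=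
  ⟨measurable_const.indicator hs, fun w => indicator_nonneg (fun _ _ => zero_le_one) w,
    fun w => indicator_le_self' (fun _ _ => zero_le_one) w⟩

lemma IsUnitFn.comp {α β : Type*} [MeasurableSpace α] [MeasurableSpace β] {f : α → ℝ}
    (hf : IsUnitFn f) {u : β → α} (hu : Measurable u) : IsUnitFn fun w => f (u w) :=
  ⟨hf.meas.comp hu, fun _ => hf.nonneg _, fun _ => hf.le_one _⟩

/-- `G` only depends on the coordinates in `N`. -/
def DepOn {ι α : Type*} (G : (ι → ℝ) → α) (N : Set ι) : Prop :=
  ∀ w w' : ι → ℝ, (∀ i ∈ N, w i = w' i) → G w = G w'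

lemma measurable_update_pair (i : ι) :
    Measurable fun p : (ι → ℝ) × ℝ => Function.update p.1 i p.2 := by
  refine measurable_pi_iff.2 fun j => ?_
  by_cases h : j = i
  · subst h; simpa using measurable_snd
  · simp only [Function.update_of_ne h]
    exact (measurable_pi_apply j).comp measurable_fst

lemma map_update_infinitePi (i : ι) :
    Measure.map (fun p : (ι → ℝ) × ℝ => Function.update p.1 i p.2)
      ((Measure.infinitePi ν).prod (ν i)) = Measure.infinitePi ν := by
  refine Measure.eq_infinitePi _ fun s t ht => ?_
  rw [Measure.map_apply (measurable_update_pair i)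
    (MeasurableSet.pi s.countable_toSet fun j _ => ht j)]
  have : (fun p : (ι → ℝ) × ℝ => Function.update p.1 i p.2) ⁻¹' ((s : Set ι).pi t) =
      (((s.erase i : Finset ι) : Set ι).pi t) ×ˢ (if i ∈ s then t i else univ) := by
    ext p
    simp only [mem_preimage, Set.mem_pi, Finset.mem_coe, mem_prod, Finset.mem_erase]
    constructor
    · intro h
      refine ⟨fun j hj => ?_, ?_⟩
      · simpa [Function.update_of_ne hj.1] using h j hj.2
      · split_ifs with hi
        · simpa using h i hi
        · trivial
    · rintro ⟨h1, h2⟩ j hj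
      by_cases hji : j = i
      · subst hji; simpa [hj] using h2
      · simpa [Function.update_of_ne hji] using h1 j ⟨hji, hj⟩
  rw [this, Measure.prod_prod, Measure.infinitePi_pi ν (fun j _ => ht j)]
  split_ifs with hi
  · rw [mul_comm, Finset.mul_prod_erase s (fun j => ν j (t j)) hi]
  · simp [Finset.erase_eq_of_notMem hi]

/-- Averaging over coordinate `i`. -/
def avg (i : ι) (F : (ι → ℝ) → ℝ) (w : ι → ℝ) : ℝ := ∫ x, F (Function.update w i x) ∂(ν i)

variable {ν}

lemma IsUnitFn.update {F : (ι → ℝ) → ℝ} (hF : IsUnitFn F) (w : ι → ℝ) (i : ι) :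
    IsUnitFn fun x : ℝ => F (Function.update w i x) :=
  hF.comp (measurable_update w)

lemma IsUnitFn.integral {α : Type*} [MeasurableSpace α] {F : α → ℝ} (hF : IsUnitFn F)
    (μ : Measure α) [IsProbabilityMeasure μ] : 0 ≤ ∫ w, F w ∂μ ∧ ∫ w, F w ∂μ ≤ 1 := by
  refine ⟨integral_nonneg hF.nonneg, ?_⟩
  calc ∫ w, F w ∂μ ≤ ∫ _, (1 : ℝ) ∂μ :=
        integral_mono (hF.integrable μ) (integrable_const _) hF.le_one
    _ = 1 := by simp

lemma IsUnitFn.avg {F : (ι → ℝ) → ℝ} (hF : IsUnitFn F) (i : ι) : IsUnitFn (avg ν i F) := by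
  refine ⟨?_, fun w => ((hF.update w i).integral (ν i)).1,
    fun w => ((hF.update w i).integral (ν i)).2⟩
  exact (StronglyMeasurable.integral_prod_right (ν := ν i)
    (f := fun w x => F (Function.update w i x))
    (hF.meas.comp (measurable_update_pair i)).stronglyMeasurable).measurable

lemma integral_avg {F : (ι → ℝ) → ℝ} (hF : IsUnitFn F) (i : ι) :
    ∫ w, GFFperc.avg ν i F w ∂(Measure.infinitePi ν) = ∫ w, F w ∂(Measure.infinitePi ν) := by
  conv_rhs => rw [← map_update_infinitePi ν i]
  rw [integral_map (measurable_update_pair i).aemeasurable hF.meas.aestronglyMeasurable]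
  rw [integral_prod]
  · rfl
  · exact (hF.comp (measurable_update_pair i)).integrable _

lemma avg_mul_of_dep {ι : Type*} [DecidableEq ι] {ν : ι → Measure ℝ}
    {F G : (ι → ℝ) → ℝ} (i : ι) (hG : DepOn G {i}ᶜ) (w : ι → ℝ) :
    avg ν i (fun w => F w * G w) w = avg ν i F w * G w := by
  unfold avg
  rw [← integral_mul_const]
  refine integral_congr_ae (ae_of_all _ fun x => ?_)
  have : G (Function.update w i x) = G w :=
    hG _ _ fun j hj => Function.update_of_ne (by simpa using hj) _ _
  simp [this]

lemma avg_dep {ι : Type*} [DecidableEq ι] {ν : ι → Measure ℝ}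
    {F : (ι → ℝ) → ℝ} {N : Set ι} (i : ι) (hF : DepOn F N) :
    DepOn (avg ν i F) (N \ {i}) := by
  intro w w' h
  unfold avg
  congr 1; ext x
  refine hF _ _ fun j hj => ?_
  by_cases hji : j = i
  · subst hji; simp
  · simp [Function.update_of_ne hji, h j ⟨hj, hji⟩]

lemma DepOn.mono {ι α : Type*} {F : (ι → ℝ) → α} {N M : Set ι} (hF : DepOn F N) (h : N ⊆ M) :
    DepOn F M := fun w w' hw => hF w w' fun i hi => hw i (h hi)

lemma integral_mul_avg_left {F G : (ι → ℝ) → ℝ} (hF : IsUnitFn F) (hG : IsUnitFn G) (i : ι) :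
    ∫ w, F w * avg ν i G w ∂(Measure.infinitePi ν) =
      ∫ w, avg ν i F w * avg ν i G w ∂(Measure.infinitePi ν) := by
  rw [← integral_avg (hF.mul (hG.avg i)) i]
  congr 1; ext w
  exact avg_mul_of_dep i ((avg_dep (N := univ) i fun w w' h => by
    rw [show w = w' from funext fun j => h j trivial]).mono (by intro j; simp +contextual)) w

lemma integral_mul_avg_comm {F G : (ι → ℝ) → ℝ} (hF : IsUnitFn F) (hG : IsUnitFn G) (i : ι) :
    ∫ w, F w * avg ν i G w ∂(Measure.infinitePi ν) =
      ∫ w, avg ν i F w * G w ∂(Measure.infinitePi ν) := by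
  rw [integral_mul_avg_left hF hG]
  simp_rw [mul_comm (avg ν i F _)]
  rw [← integral_mul_avg_left hG hF]

/-- The averaged conditional variance of `f` in direction `i`. -/
def condVar (ν : ι → Measure ℝ) (i : ι) (f : (ι → ℝ) → ℝ) : ℝ :=
  ∫ w, avg ν i f w * (1 - avg ν i f w) ∂(Measure.infinitePi ν)

/-- Covariance of `f` with a function of finitely many coordinates. -/
theorem cov_le_sum_condVar {f : (ι → ℝ) → ℝ} (hf : IsUnitFn f) (N : Finset ι) :
    ∀ {G : (ι → ℝ) → ℝ}, IsUnitFn G → DepOn G (N : Set ι) →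
    ∫ w, f w * G w ∂(Measure.infinitePi ν) -
      (∫ w, f w ∂(Measure.infinitePi ν)) * ∫ w, G w ∂(Measure.infinitePi ν) ≤
      ∑ i ∈ N, condVar ν i f := by
  induction N using Finset.induction_on with
  | empty =>
    intro G hG hdep
    have : G = fun _ => G 0 := by
      ext w; exact hdep _ _ (by simp)
    rw [this]
    simp [integral_mul_const]
  | insert i N hi ih =>
    intro G hG hdep
    rw [Finset.sum_insert hi]
    have h1 := ih (hG.avg i) ((avg_dep (ν := ν) i hdep).mono (by intro j; simp +contextual))
    rw [integral_avg hG] at h1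
    have h2 : ∫ w, f w * G w ∂(Measure.infinitePi ν) -
        ∫ w, f w * avg ν i G w ∂(Measure.infinitePi ν) ≤ condVar ν i f := by
      rw [integral_mul_avg_comm hf hG, ← integral_sub ((hf.mul hG).integrable _)
        (((hf.avg i).mul hG).integrable _)]
      have e : condVar ν i f =
          ∫ w, f w * (1 - avg ν i f w) ∂(Measure.infinitePi ν) := by
        unfold condVar
        rw [← integral_avg (hf.mul (hf.avg i).one_sub) i]
        congr 1; ext w
        refine (avg_mul_of_dep i (G := fun w => 1 - avg ν i f w) ?_ w).symm
        intro w w' h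
        have := avg_dep (ν := ν) (N := univ) (F := f) i (fun w w' h => by
          rw [show w = w' from funext fun j => h j trivial]) w w'
            (fun j hj => h j (by simpa using hj))
        simp [this]
      rw [e]
      refine integral_mono (((hf.mul hG).integrable _).sub (((hf.avg i).mul hG).integrable _))
        ((hf.mul (hf.avg i).one_sub).integrable _) fun w => ?_
      have a1 := hf.nonneg w; have a2 := hf.le_one w
      have b1 := hG.nonneg w; have b2 := hG.le_one w
      have c1 := (hf.avg (ν := ν) i).nonneg w; have c2 := (hf.avg (ν := ν) i).le_one w
      simp only
      nlinarith [mul_nonneg a1 b1, mul_nonneg c1 b1, mul_nonneg c1 (sub_nonneg.2 a2),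
        mul_nonneg a1 (sub_nonneg.2 c2), mul_nonneg b1 (mul_nonneg c1 (sub_nonneg.2 a2)),
        mul_nonneg (sub_nonneg.2 b2) (mul_nonneg a1 (sub_nonneg.2 c2))]
    linarith

/-- Independence of functions of disjoint sets of coordinates. -/
theorem integral_mul_of_disjoint {f G : (ι → ℝ) → ℝ} (hf : IsUnitFn f) (hG : IsUnitFn G)
    (N : Finset ι) (hfd : DepOn f ((N : Set ι)ᶜ)) (hGd : DepOn G (N : Set ι)) :
    ∫ w, f w * G w ∂(Measure.infinitePi ν) =
      (∫ w, f w ∂(Measure.infinitePi ν)) * ∫ w, G w ∂(Measure.infinitePi ν) := by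
  induction N using Finset.induction_on generalizing G with
  | empty =>
    have : G = fun _ => G 0 := by
      ext w; exact hGd _ _ (by simp)
    rw [this]
    simp [integral_mul_const]
  | insert i N hi ih =>
    have h1 := ih (hG.avg i) (hfd.mono (by intro j; simp))
      ((avg_dep (ν := ν) i hGd).mono (by intro j; simp +contextual))
    rw [integral_avg hG] at h1
    rw [← h1, integral_mul_avg_comm hf hG]
    have : avg ν i f = f := by
      ext w
      unfold avg
      have : ∀ x, f (Function.update w i x) = f w := fun x =>
        hfd _ _ fun j hj => Function.update_of_ne (by rintro rfl; simp at hj) _ _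
      simp [this]
    rw [this]

lemma chebyshev_integral_mul (ρ : Measure ℝ) [IsProbabilityMeasure ρ] {f g : ℝ → ℝ}
    (hf : IsUnitFn f) (hg : IsUnitFn g) (mf : Monotone f) (mg : Monotone g) :
    (∫ x, f x ∂ρ) * ∫ x, g x ∂ρ ≤ ∫ x, f x * g x ∂ρ := by
  have key : 0 ≤ ∫ p : ℝ × ℝ, (f p.1 - f p.2) * (g p.1 - g p.2) ∂(ρ.prod ρ) := by
    refine integral_nonneg fun p => ?_
    rcases le_total p.1 p.2 with h | h
    · exact mul_nonneg_of_nonpos_of_nonpos (sub_nonpos.2 (mf h)) (sub_nonpos.2 (mg h))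
    · exact mul_nonneg (sub_nonneg.2 (mf h)) (sub_nonneg.2 (mg h))
  have i11 := ((hf.comp measurable_fst).mul (hg.comp measurable_fst)).integrable (ρ.prod ρ)
  have i12 := ((hf.comp measurable_fst).mul (hg.comp measurable_snd)).integrable (ρ.prod ρ)
  have i21 := ((hf.comp measurable_snd).mul (hg.comp measurable_fst)).integrable (ρ.prod ρ)
  have i22 := ((hf.comp measurable_snd).mul (hg.comp measurable_snd)).integrable (ρ.prod ρ)
  have e : (fun p : ℝ × ℝ => (f p.1 - f p.2) * (g p.1 - g p.2)) = fun p =>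
      (f p.1 * g p.1 - f p.1 * g p.2) - (f p.2 * g p.1 - f p.2 * g p.2) := by
    ext p; ring
  rw [e, integral_sub (f := fun p : ℝ × ℝ => f p.1 * g p.1 - f p.1 * g p.2)
    (g := fun p : ℝ × ℝ => f p.2 * g p.1 - f p.2 * g p.2) (i11.sub i12) (i21.sub i22),
    integral_sub i11 i12, integral_sub i21 i22, integral_prod_mul (fun x => f x) (fun y => g y)]
      at key
  have s21 : ∫ p : ℝ × ℝ, f p.2 * g p.1 ∂(ρ.prod ρ) = (∫ x, f x ∂ρ) * ∫ x, g x ∂ρ := by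
    simp_rw [mul_comm (f _)]
    rw [integral_prod_mul (fun x => g x) (fun y => f y), mul_comm]
  have s11 : ∫ p : ℝ × ℝ, f p.1 * g p.1 ∂(ρ.prod ρ) = ∫ x, f x * g x ∂ρ := by
    have := integral_prod_mul (μ := ρ) (ν := ρ) (fun x => f x * g x) (fun _ => (1 : ℝ))
    simpa using this
  have s22 : ∫ p : ℝ × ℝ, f p.2 * g p.2 ∂(ρ.prod ρ) = ∫ x, f x * g x ∂ρ := by
    have := integral_prod_mul (μ := ρ) (ν := ρ) (fun _ => (1 : ℝ)) (fun x => f x * g x)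
    simpa using this
  rw [s21, s11, s22] at key
  linarith

lemma monotone_update (w : ι → ℝ) (i : ι) : Monotone fun x : ℝ => Function.update w i x := by
  intro x y h j
  by_cases hji : j = i
  · subst hji; simpa using h
  · simp [Function.update_of_ne hji]

lemma monotone_avg {F : (ι → ℝ) → ℝ} (hF : IsUnitFn F) (m : Monotone F) (i : ι) :
    Monotone (avg ν i F) := by
  intro w w' h
  refine integral_mono ((hF.update w i).integrable _) ((hF.update w' i).integrable _)
    fun x => m ?_
  intro j
  by_cases hji : j = i
  · subst hji; simp
  · simp [Function.update_of_ne hji, h j]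

/-- The Harris inequality. -/
theorem harris {f : (ι → ℝ) → ℝ} (hf : IsUnitFn f) (mf : Monotone f) (N : Finset ι) :
    ∀ {G : (ι → ℝ) → ℝ}, IsUnitFn G → Monotone G → DepOn G (N : Set ι) →
    (∫ w, f w ∂(Measure.infinitePi ν)) * ∫ w, G w ∂(Measure.infinitePi ν) ≤
      ∫ w, f w * G w ∂(Measure.infinitePi ν) := by
  induction N using Finset.induction_on with
  | empty =>
    intro G hG mG hdep
    have : G = fun _ => G 0 := by
      ext w; exact hdep _ _ (by simp)
    rw [this]
    simp [integral_mul_const]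
  | insert i N hi ih =>
    intro G hG mG hdep
    have h1 := ih (hG.avg i) (monotone_avg hG mG i)
      ((avg_dep (ν := ν) i hdep).mono (by intro j; simp +contextual))
    rw [integral_avg hG] at h1
    refine h1.trans ?_
    rw [integral_mul_avg_left hf hG, ← integral_avg (hf.mul hG) i]
    refine integral_mono (((hf.avg i).mul (hG.avg i)).integrable _)
      (((hf.mul hG).avg i).integrable _) fun w => ?_
    exact chebyshev_integral_mul (ν i) (hf.update w i) (hG.update w i)
      (mf.comp (monotone_update w i)) (mG.comp (monotone_update w i))

/-- Pivotality estimate: if `f ≤ g` and `F` are increasing and the event `g - f` excludes `F`,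
then `P(F) P(g - f)` is bounded by the conditional variances of `f` over the support of `F`. -/
theorem opening_bound {f g F : (ι → ℝ) → ℝ} (hf : IsUnitFn f) (hg : IsUnitFn g)
    (hF : IsUnitFn F) (mg : Monotone g) (mF : Monotone F) (N : Finset ι)
    (hN : DepOn F (N : Set ι)) (hex : ∀ w, g w * F w ≤ f w * F w) :
    (∫ w, F w ∂(Measure.infinitePi ν)) *
      (∫ w, g w ∂(Measure.infinitePi ν) - ∫ w, f w ∂(Measure.infinitePi ν)) ≤
      ∑ i ∈ N, condVar ν i f := by
  have h1 := cov_le_sum_condVar (ν := ν) hf N hF hN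
  have h2 := harris (ν := ν) hg mg N hF mF hN
  have h3 : ∫ w, g w * F w ∂(Measure.infinitePi ν) ≤ ∫ w, f w * F w ∂(Measure.infinitePi ν) :=
    integral_mono ((hg.mul hF).integrable _) ((hf.mul hF).integrable _) hex
  nlinarith

/-- Dual pivotality estimate, for closing a site. -/
theorem closing_bound {f g G : (ι → ℝ) → ℝ} (hf : IsUnitFn f) (hg : IsUnitFn g)
    (hG : IsUnitFn G) (mg : Monotone g) (mG : Monotone G) (N : Finset ι)
    (hN : DepOn G (N : Set ι)) (hex : ∀ w, (f w - g w) * (1 - G w) ≤ 0) :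
    (1 - ∫ w, G w ∂(Measure.infinitePi ν)) *
      (∫ w, f w ∂(Measure.infinitePi ν) - ∫ w, g w ∂(Measure.infinitePi ν)) ≤
      ∑ i ∈ N, condVar ν i f := by
  have h1 := cov_le_sum_condVar (ν := ν) hf N hG hN
  have h2 := harris (ν := ν) hg mg N hG mG hN
  have h3 : ∫ w, (f w + g w * G w) ∂(Measure.infinitePi ν) ≤
      ∫ w, (f w * G w + g w) ∂(Measure.infinitePi ν) :=
    integral_mono ((hf.integrable _).add ((hg.mul hG).integrable _))
      (((hf.mul hG).integrable _).add (hg.integrable _)) fun w => by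
        have := hex w
        simp only
        nlinarith
  rw [integral_add (hf.integrable _) ((hg.mul hG).integrable _),
    integral_add ((hf.mul hG).integrable _) (hg.integrable _)] at h3
  nlinarith

end ProductSpace

section GaussianEstimates

lemma gauss_real_eq_integral {s : Set ℝ} :
    (gaussianReal 0 1).real s = ∫ x in s, gaussianPDFReal 0 1 x := by
  rw [measureReal_def, gaussianReal_apply_eq_integral 0 one_ne_zero s, ENNReal.toReal_ofReal]
  exact integral_nonneg fun x => gaussianPDFReal_nonneg _ _ _

lemma gaussPDF_shift_le {τ x : ℝ} (hτ : 0 ≤ τ) (hx : τ ≤ x) :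
    gaussianPDFReal 0 1 x ≤ Real.exp (-((x - τ) ^ 2 / 2)) * gaussianPDFReal 0 1 τ := by
  simp only [gaussianPDFReal, NNReal.coe_one, sub_zero, mul_one]
  rw [mul_left_comm, ← Real.exp_add]
  refine mul_le_mul_of_nonneg_left (Real.exp_le_exp.2 ?_) (by positivity)
  nlinarith [mul_nonneg hτ (sub_nonneg.2 hx)]

lemma gaussPDF_left_ge {τ x : ℝ} (h1 : x ≤ τ) (h2 : τ - 1 ≤ x) (hτ : 0 ≤ τ) :
    Real.exp (-(1 / 2)) * gaussianPDFReal 0 1 τ ≤ gaussianPDFReal 0 1 x := by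
  simp only [gaussianPDFReal, NNReal.coe_one, sub_zero, mul_one]
  rw [mul_left_comm, ← Real.exp_add]
  refine mul_le_mul_of_nonneg_left (Real.exp_le_exp.2 ?_) (by positivity)
  nlinarith [mul_nonneg hτ (sub_nonneg.2 h1), mul_nonneg (sub_nonneg.2 h1) (sub_nonneg.2 h2)]

/-- The constant in the one-dimensional Gaussian isoperimetric estimate. -/
def gaussC : ℝ := Real.sqrt (2 * Real.pi) * Real.exp (1 / 2) + 1

lemma gaussC_pos : 0 < gaussC := by unfold gaussC; positivity

lemma integral_exp_neg_sq_half (τ : ℝ) :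
    ∫ x, Real.exp (-((x - τ) ^ 2 / 2)) = Real.sqrt (2 * Real.pi) ∧
      Integrable fun x => Real.exp (-((x - τ) ^ 2 / 2)) := by
  have e : (fun x : ℝ => Real.exp (-((x - τ) ^ 2 / 2))) =
      fun x => (fun y : ℝ => Real.exp (-(1 / 2) * y ^ 2)) (x - τ) := by
    ext x; congr 1; ring
  rw [e]
  constructor
  · rw [integral_sub_right_eq_self (fun y : ℝ => Real.exp (-(1 / 2) * y ^ 2)) τ,
      integral_gaussian]
    congr 1; field_simp
  · exact (integrable_exp_neg_mul_sq (by norm_num : (0 : ℝ) < 1 / 2)).comp_sub_right τ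

lemma gauss_tail_le_increment {τ t : ℝ} (hτ : 0 ≤ τ) (ht : 0 < t) (ht1 : t ≤ 1) :
    t * (gaussianReal 0 1).real (Ici τ) ≤
      Real.sqrt (2 * Real.pi) * Real.exp (1 / 2) * (gaussianReal 0 1).real (Ico (τ - t) τ) := by
  have hint : Integrable (gaussianPDFReal 0 1) := integrable_gaussianPDFReal 0 1
  have h1 : (gaussianReal 0 1).real (Ici τ) ≤
      Real.sqrt (2 * Real.pi) * gaussianPDFReal 0 1 τ := by
    rw [gauss_real_eq_integral, ← (integral_exp_neg_sq_half τ).1, ← integral_mul_const]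
    have hi := (integral_exp_neg_sq_half τ).2.mul_const (gaussianPDFReal 0 1 τ)
    calc ∫ x in Ici τ, gaussianPDFReal 0 1 x
        ≤ ∫ x in Ici τ, Real.exp (-((x - τ) ^ 2 / 2)) * gaussianPDFReal 0 1 τ :=
          setIntegral_mono_on hint.integrableOn hi.integrableOn measurableSet_Ici
            fun x hx => gaussPDF_shift_le hτ hx
      _ ≤ _ := setIntegral_le_integral hi (ae_of_all _ fun x =>
          mul_nonneg (Real.exp_pos _).le (gaussianPDFReal_nonneg _ _ _))
  have h2 : t * (Real.exp (-(1 / 2)) * gaussianPDFReal 0 1 τ) ≤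
      (gaussianReal 0 1).real (Ico (τ - t) τ) := by
    rw [gauss_real_eq_integral]
    calc t * (Real.exp (-(1 / 2)) * gaussianPDFReal 0 1 τ)
        = ∫ _ in Ico (τ - t) τ, Real.exp (-(1 / 2)) * gaussianPDFReal 0 1 τ := by
          rw [setIntegral_const]; simp [ht.le]
      _ ≤ _ := setIntegral_mono_on (integrableOn_const (by simp)) hint.integrableOn
          measurableSet_Ico fun x hx =>
            gaussPDF_left_ge hx.2.le (by linarith [hx.1]) hτ
  have h3 : Real.exp (1 / 2) * Real.exp (-(1 / 2)) = 1 := by rw [← Real.exp_add]; simp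
  calc t * (gaussianReal 0 1).real (Ici τ)
      ≤ t * (Real.sqrt (2 * Real.pi) * gaussianPDFReal 0 1 τ) := by gcongr
    _ = Real.sqrt (2 * Real.pi) * Real.exp (1 / 2) *
        (t * (Real.exp (-(1 / 2)) * gaussianPDFReal 0 1 τ)) := by
          linear_combination (- t * Real.sqrt (2 * Real.pi) * gaussianPDFReal 0 1 τ) * h3
    _ ≤ _ := by gcongr

lemma gauss_map_neg : Measure.map (fun x : ℝ => -x) (gaussianReal 0 1) = gaussianReal 0 1 := by
  have := gaussianReal_map_neg (μ := 0) (v := 1)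
  simpa using this

lemma gauss_real_neg (s : Set ℝ) (hs : MeasurableSet s) :
    (gaussianReal 0 1).real (Neg.neg ⁻¹' s) = (gaussianReal 0 1).real s := by
  conv_rhs => rw [← gauss_map_neg]
  rw [map_measureReal_apply measurable_neg hs]

lemma gauss_threshold {τ t : ℝ} (ht : 0 < t) (ht1 : t ≤ 1) :
    t * ((gaussianReal 0 1).real (Ici τ) * (1 - (gaussianReal 0 1).real (Ici τ))) ≤
      gaussC * (gaussianReal 0 1).real (Ico (τ - t) τ) := by
  set p := (gaussianReal 0 1).real (Ici τ) with hp
  set D := (gaussianReal 0 1).real (Ico (τ - t) τ) with hD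
  have hp0 : 0 ≤ p := measureReal_nonneg
  have hp1 : p ≤ 1 := measureReal_le_one
  have hD0 : 0 ≤ D := measureReal_nonneg
  rcases le_or_gt 0 τ with hτ | hτ
  · have := gauss_tail_le_increment hτ ht ht1
    unfold gaussC
    have h2 : t * (p * (1 - p)) ≤ t * p := by
      gcongr; nlinarith
    linarith
  · have h1 := gauss_tail_le_increment (τ := -τ + t) (by linarith) ht ht1
    have e1 : (gaussianReal 0 1).real (Ico (-τ + t - t) (-τ + t)) = D := by
      rw [hD, ← gauss_real_neg (Ico (τ - t) τ) measurableSet_Ico]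
      have : Neg.neg ⁻¹' Ico (τ - t) τ = Ioc (-τ) (-τ + t) := by
        ext x; simp only [mem_preimage, mem_Ico, mem_Ioc]
        constructor <;> rintro ⟨h, h'⟩ <;> constructor <;> linarith
      have e : -τ + t - t = -τ := by ring
      rw [this, e]
      exact measureReal_congr (Ico_ae_eq_Ioc' (by
        have := nullSingletonClass_gaussianReal (μ := 0) (v := 1) one_ne_zero
        exact measure_singleton _) (by
        have := nullSingletonClass_gaussianReal (μ := 0) (v := 1) one_ne_zero
        exact measure_singleton _))
    have e2 : 1 - p = D + (gaussianReal 0 1).real (Ici (-τ + t)) := by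
      have a1 : 1 - p = (gaussianReal 0 1).real (Iio τ) := by
        rw [hp, ← probReal_compl_eq_one_sub measurableSet_Ici, compl_Ici]
      have a2 : (gaussianReal 0 1).real (Iio τ) =
          (gaussianReal 0 1).real (Iio (τ - t)) + D := by
        rw [hD, ← measureReal_union (by
          rw [Set.disjoint_left]; intro x hx hx'; simp at hx hx'; linarith) measurableSet_Ico,
          Iio_union_Ico_eq_Iio (by linarith)]
      have a3 : (gaussianReal 0 1).real (Iio (τ - t)) =
          (gaussianReal 0 1).real (Ici (-τ + t)) := by
        rw [← gauss_real_neg (Iio (τ - t)) measurableSet_Iio]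
        have : Neg.neg ⁻¹' Iio (τ - t) = Ioi (-τ + t) := by
          ext x; simp only [mem_preimage, mem_Iio, mem_Ioi]
          constructor <;> intro h <;> linarith
        rw [this]
        exact measureReal_congr (Ioi_ae_eq_Ici' (by
          have := nullSingletonClass_gaussianReal (μ := 0) (v := 1) one_ne_zero
          exact measure_singleton _))
      rw [a1, a2, a3, add_comm]
    rw [e1] at h1
    have h2 : t * (p * (1 - p)) ≤ t * (1 - p) := by
      gcongr; nlinarith
    have h3 : t * D ≤ D := by nlinarith
    unfold gaussC
    rw [e2] at h2 ⊢
    nlinarith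

lemma monotone_zero_one_cases {f : ℝ → ℝ} (mf : Monotone f) (h01 : ∀ x, f x = 0 ∨ f x = 1) :
    (∀ x, f x = 0) ∨ (∀ x, f x = 1) ∨
      ∃ τ, (∀ x, τ < x → f x = 1) ∧ ∀ x, x < τ → f x = 0 := by
  by_cases h0 : ∀ x, f x = 0
  · exact Or.inl h0
  by_cases h1 : ∀ x, f x = 1
  · exact Or.inr (Or.inl h1)
  push Not at h0 h1
  obtain ⟨a, ha⟩ := h0
  obtain ⟨b, hb⟩ := h1
  have ha : f a = 1 := (h01 a).resolve_left ha
  have hb : f b = 0 := (h01 b).resolve_right hb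
  refine Or.inr (Or.inr ⟨sInf {x | f x = 1}, ?_, ?_⟩)
  · intro x hx
    obtain ⟨y, hy, hyx⟩ := exists_lt_of_csInf_lt ⟨a, ha⟩ hx
    have := mf hyx.le
    rw [hy.out] at this
    rcases h01 x with h | h
    · linarith
    · exact h
  · intro x hx
    rcases h01 x with h | h
    · exact h
    · exfalso
      have : sInf {x | f x = 1} ≤ x := csInf_le ⟨b, by
        intro y hy
        by_contra hlt
        push Not at hlt
        have := mf hlt.le
        rw [hb, hy.out] at this
        linarith⟩ h
      linarith

lemma gauss_isoperimetry_add {f : ℝ → ℝ} (mf : Monotone f) (h01 : ∀ x, f x = 0 ∨ f x = 1)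
    {t : ℝ} (ht : 0 < t) (ht1 : t ≤ 1) :
    t * ((∫ x, f x ∂(gaussianReal 0 1)) * (1 - ∫ x, f x ∂(gaussianReal 0 1))) ≤
      gaussC * (∫ x, f (x + t) ∂(gaussianReal 0 1) - ∫ x, f x ∂(gaussianReal 0 1)) := by
  have hna := nullSingletonClass_gaussianReal (μ := 0) (v := 1) one_ne_zero
  rcases monotone_zero_one_cases mf h01 with h | h | ⟨τ, h1, h0⟩
  · simp [h]
  · simp [h]
  · have key : ∀ s : ℝ, ∫ x, f (x + s) ∂(gaussianReal 0 1) =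
        (gaussianReal 0 1).real (Ici (τ - s)) := by
      intro s
      have : (fun x => f (x + s)) =ᵐ[gaussianReal 0 1]
          (Ici (τ - s)).indicator fun _ => (1 : ℝ) := by
        have hne : ∀ᵐ x ∂(gaussianReal 0 1), x ≠ τ - s := by
          simp [ae_iff]
        filter_upwards [hne] with x hx
        rcases lt_or_gt_of_ne hx with h | h
        · rw [h0 _ (by linarith), indicator_of_notMem (by simpa using lt_sub_iff_add_lt.1 h)]
        · rw [h1 _ (by linarith), indicator_of_mem (by simpa using sub_le_iff_le_add.1 h.le)]
      rw [integral_congr_ae this, integral_indicator measurableSet_Ici]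
      simp
    have k0 := key 0
    simp only [add_zero, sub_zero] at k0
    rw [key t, k0]
    have : (gaussianReal 0 1).real (Ici (τ - t)) - (gaussianReal 0 1).real (Ici τ) =
        (gaussianReal 0 1).real (Ico (τ - t) τ) := by
      rw [← Ico_union_Ici_eq_Ici (show τ - t ≤ τ by linarith), measureReal_union (by
        rw [Set.disjoint_left]; intro x hx hx'; simp at hx hx'; linarith) measurableSet_Ici]
      ring
    rw [this]
    exact gauss_threshold ht ht1

lemma gauss_integral_neg (f : ℝ → ℝ) :
    ∫ x, f (-x) ∂(gaussianReal 0 1) = ∫ x, f x ∂(gaussianReal 0 1) := by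
  conv_rhs => rw [← gauss_map_neg]
  exact ((MeasurableEquiv.neg ℝ).measurableEmbedding.integral_map (g := f)).symm

lemma gauss_isoperimetry_sub {f : ℝ → ℝ} (hf : IsUnitFn f) (mf : Monotone f)
    (h01 : ∀ x, f x = 0 ∨ f x = 1) {t : ℝ} (ht : 0 < t) (ht1 : t ≤ 1) :
    t * ((∫ x, f x ∂(gaussianReal 0 1)) * (1 - ∫ x, f x ∂(gaussianReal 0 1))) ≤
      gaussC * (∫ x, f x ∂(gaussianReal 0 1) - ∫ x, f (x - t) ∂(gaussianReal 0 1)) := by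
  have := gauss_isoperimetry_add (f := fun x => 1 - f (-x))
    (fun x y h => sub_le_sub_left (mf (neg_le_neg h)) 1)
    (fun x => by rcases h01 (-x) with h | h <;> simp [h]) ht ht1
  have e1 : ∫ x, (1 - f (-x)) ∂(gaussianReal 0 1) = 1 - ∫ x, f x ∂(gaussianReal 0 1) := by
    rw [integral_sub (integrable_const _) ((hf.comp measurable_neg).integrable _),
      gauss_integral_neg]
    simp
  have e2 : ∫ x, (1 - f (-(x + t))) ∂(gaussianReal 0 1) =
      1 - ∫ x, f (x - t) ∂(gaussianReal 0 1) := by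
    rw [← gauss_integral_neg (fun x => f (x - t)),
      integral_sub (integrable_const _) ((hf.comp (by fun_prop)).integrable _)]
    simp [neg_add_rev, sub_eq_add_neg, add_comm]
  rw [e1, e2] at this
  linarith

/-- Gaussian tail bound. -/
lemma gauss_tail (v : NNReal) {σ e : ℝ} (hv : (v : ℝ) ≤ σ) (hσ : 0 < σ) (he : 0 ≤ e) :
    (gaussianReal 0 v).real (Ici e) ≤ Real.exp (-(e ^ 2 / (2 * σ))) := by
  have h := measure_ge_le_exp_mul_mgf (μ := gaussianReal 0 v) (X := id) e
    (t := e / σ) (by positivity) (by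
      exact integrable_exp_mul_gaussianReal (e / σ))
  have h2 : mgf id (gaussianReal 0 v) (e / σ) = Real.exp (v * (e / σ) ^ 2 / 2) := by
    rw [mgf_id_gaussianReal]; simp
  rw [h2, ← Real.exp_add] at h
  refine le_trans h (Real.exp_le_exp.2 ?_)
  have : (v : ℝ) * (e / σ) ^ 2 / 2 ≤ σ * (e / σ) ^ 2 / 2 := by gcongr
  have e3 : -(e / σ) * e + σ * (e / σ) ^ 2 / 2 = -(e ^ 2 / (2 * σ)) := by field_simp; ring
  linarith

section Shift

variable {ι : Type*} [DecidableEq ι] {ν : ι → Measure ℝ} [∀ i, IsProbabilityMeasure (ν i)]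

lemma update_shift_update (w : ι → ℝ) (i : ι) (x t : ℝ) :
    Function.update (Function.update w i x) i (Function.update w i x i + t) =
      Function.update w i (x + t) := by
  simp

lemma measurable_shift (i : ι) (t : ℝ) :
    Measurable fun w : ι → ℝ => Function.update w i (w i + t) :=
  (measurable_update_pair i).comp (g := fun p : (ι → ℝ) × ℝ => Function.update p.1 i p.2)
    (measurable_id.prodMk ((measurable_pi_apply (X := fun _ : ι => ℝ) i).add_const t))

lemma condVar_le_shift_add {f : (ι → ℝ) → ℝ} (hf : IsUnitFn f) (mf : Monotone f)
    (h01 : ∀ w, f w = 0 ∨ f w = 1) (i : ι) (hi : ν i = gaussianReal 0 1) {t : ℝ}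
    (ht : 0 < t) (ht1 : t ≤ 1) :
    t * condVar ν i f ≤ gaussC * (∫ w, f (Function.update w i (w i + t))
      ∂(Measure.infinitePi ν) - ∫ w, f w ∂(Measure.infinitePi ν)) := by
  have hs := hf.comp (measurable_shift i t)
  rw [← integral_avg hs i, ← integral_avg hf i, ← integral_sub ((hs.avg i).integrable _)
    ((hf.avg i).integrable _), ← integral_const_mul, condVar, ← integral_const_mul]
  refine integral_mono (((hf.avg i).mul (hf.avg i).one_sub).integrable _ |>.const_mul _)
    ((((hs.avg i).integrable _).sub ((hf.avg i).integrable _)).const_mul _) fun w => ?_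
  have := gauss_isoperimetry_add (mf.comp (monotone_update w i)) (fun x => h01 _) ht ht1
  simp only [avg, hi, update_shift_update]
  exact this

lemma condVar_le_shift_sub {f : (ι → ℝ) → ℝ} (hf : IsUnitFn f) (mf : Monotone f)
    (h01 : ∀ w, f w = 0 ∨ f w = 1) (i : ι) (hi : ν i = gaussianReal 0 1) {t : ℝ}
    (ht : 0 < t) (ht1 : t ≤ 1) :
    t * condVar ν i f ≤ gaussC * (∫ w, f w ∂(Measure.infinitePi ν) -
      ∫ w, f (Function.update w i (w i - t)) ∂(Measure.infinitePi ν)) := by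
  have hs := hf.comp (measurable_shift i (-t))
  simp only [← sub_eq_add_neg] at hs
  rw [← integral_avg hs i, ← integral_avg hf i, ← integral_sub ((hf.avg i).integrable _)
    ((hs.avg i).integrable _), ← integral_const_mul, condVar, ← integral_const_mul]
  refine integral_mono (((hf.avg i).mul (hf.avg i).one_sub).integrable _ |>.const_mul _)
    ((((hf.avg i).integrable _).sub ((hs.avg i).integrable _)).const_mul _) fun w => ?_
  have := gauss_isoperimetry_sub (hf.update w i) (mf.comp (monotone_update w i))
    (fun x => h01 _) ht ht1
  simp only [avg, hi, sub_eq_add_neg, update_shift_update]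
  simpa only [sub_eq_add_neg] using this

end Shift

end GaussianEstimates

section Lazy

variable {d : ℕ}

lemma lazyP_succ (k : ℕ) (x y : V d) : lazyP d (k + 1) x y =
    (1 / 2) * lazyP d k x y +
      (1 / (4 * d)) * ∑ i : Fin d, (lazyP d k (x + unitV d i) y + lazyP d k (x - unitV d i) y) :=
  rfl

lemma lazyP_nonneg (k : ℕ) : ∀ x y : V d, 0 ≤ lazyP d k x y := by
  induction k with
  | zero => intro x y; simp only [lazyP]; split_ifs <;> norm_num
  | succ k ih =>
    intro x y
    rw [lazyP_succ]
    have : 0 ≤ ∑ i : Fin d, (lazyP d k (x + unitV d i) y + lazyP d k (x - unitV d i) y) :=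
      Finset.sum_nonneg fun i _ => add_nonneg (ih _ _) (ih _ _)
    have := ih x y
    positivity

lemma lazyP_le_one (k : ℕ) : ∀ x y : V d, lazyP d k x y ≤ 1 := by
  induction k with
  | zero => intro x y; simp only [lazyP]; split_ifs <;> norm_num
  | succ k ih =>
    intro x y
    rw [lazyP_succ]
    have h : ∑ i : Fin d, (lazyP d k (x + unitV d i) y + lazyP d k (x - unitV d i) y) ≤
        ∑ _i : Fin d, (2 : ℝ) :=
      Finset.sum_le_sum fun i _ => by linarith [ih (x + unitV d i) y, ih (x - unitV d i) y]
    have h0 := ih x y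
    rcases Nat.eq_zero_or_pos d with rfl | hd
    · simp; linarith
    · have hd' : (0 : ℝ) < d := by exact_mod_cast hd
      calc _ ≤ (1 / 2) * 1 + (1 / (4 * (d : ℝ))) * ∑ _i : Fin d, (2 : ℝ) := by gcongr
        _ = 1 := by simp; field_simp; norm_num

lemma unitV_abs_le (i j : Fin d) : |unitV d i j| ≤ 1 := by
  unfold unitV; split_ifs <;> simp

lemma lazyP_eq_zero (k : ℕ) : ∀ (x y : V d) (j : Fin d), (k : ℤ) < |x j - y j| →
    lazyP d k x y = 0 := by
  induction k with
  | zero =>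
    intro x y j h
    simp only [lazyP]
    rw [if_neg]
    rintro rfl
    simp at h
  | succ k ih =>
    intro x y j h
    rw [lazyP_succ, ih x y j (by push_cast at h; linarith), Finset.sum_eq_zero]
    · simp
    · intro i _
      have hu := abs_le.1 (unitV_abs_le i j)
      push_cast at h
      rw [ih _ _ j, ih _ _ j, add_zero]
      · rw [lt_abs] at h ⊢
        simp only [Pi.sub_apply]
        rcases h with h | h
        · left; linarith
        · right; linarith
      · rw [lt_abs] at h ⊢
        simp only [Pi.add_apply]
        rcases h with h | h
        · left; linarith
        · right; linarith

/-- A symmetry of the nearest-neighbour graph `ℤ^d`. -/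
structure LatSym (σ : V d → V d) : Prop where
  inj : Function.Injective σ
  nbr : ∀ (F : V d → ℝ) (x : V d), ∑ i : Fin d, (F (σ (x + unitV d i)) + F (σ (x - unitV d i))) =
    ∑ i : Fin d, (F (σ x + unitV d i) + F (σ x - unitV d i))

lemma LatSym.lazyP {σ : V d → V d} (hσ : LatSym σ) (k : ℕ) :
    ∀ x y, lazyP d k (σ x) (σ y) = lazyP d k x y := by
  induction k with
  | zero => intro x y; simp only [GFFperc.lazyP, hσ.inj.eq_iff]
  | succ k ih =>
    intro x y
    rw [lazyP_succ, lazyP_succ, ih, ← hσ.nbr (fun z => GFFperc.lazyP d k z (σ y)) x]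
    simp only [ih]

lemma latSym_add (a : V d) : LatSym fun x : V d => x + a where
  inj := add_left_injective a
  nbr F x := Finset.sum_congr rfl fun i _ => by
    rw [add_right_comm, add_sub_right_comm]

lemma latSym_neg : LatSym fun x : V d => -x where
  inj := neg_injective
  nbr F x := Finset.sum_congr rfl fun i _ => by
    rw [neg_add, ← sub_eq_add_neg, neg_sub', sub_neg_eq_add, add_comm]

/-- Reflection of the `j`-th coordinate. -/
def flipV (j : Fin d) (x : V d) : V d := fun i => if i = j then -x i else x i

lemma flipV_flipV (j : Fin d) (x : V d) : flipV j (flipV j x) = x := by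
  ext i; unfold flipV; split_ifs <;> simp

lemma latSym_flip (j : Fin d) : LatSym (flipV (d := d) j) where
  inj := Function.LeftInverse.injective (g := flipV j) (flipV_flipV j)
  nbr F x := Finset.sum_congr rfl fun i _ => by
    by_cases h : i = j
    · subst h
      have e1 : flipV i (x + unitV d i) = flipV i x - unitV d i := by
        ext l; simp only [flipV, unitV, Pi.add_apply, Pi.sub_apply]; split_ifs <;> ring
      have e2 : flipV i (x - unitV d i) = flipV i x + unitV d i := by
        ext l; simp only [flipV, unitV, Pi.add_apply, Pi.sub_apply]; split_ifs <;> ring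
      rw [e1, e2, add_comm]
    · have e1 : flipV j (x + unitV d i) = flipV j x + unitV d i := by
        ext l; simp only [flipV, unitV, Pi.add_apply]
        by_cases hl : l = j
        · subst hl; simp [Ne.symm h]
        · simp [hl]
      have e2 : flipV j (x - unitV d i) = flipV j x - unitV d i := by
        ext l; simp only [flipV, unitV, Pi.sub_apply]
        by_cases hl : l = j
        · subst hl; simp [Ne.symm h]
        · simp [hl]
      rw [e1, e2]

lemma latSym_perm (e : Equiv.Perm (Fin d)) : LatSym fun (x : V d) => x ∘ e where
  inj x y h := by
    ext i
    have := congrFun h (e.symm i)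
    simpa using this
  nbr F x := by
    rw [← Equiv.sum_comp e (fun i => F ((x + unitV d i) ∘ e) + F ((x - unitV d i) ∘ e))]
    refine Finset.sum_congr rfl fun i _ => ?_
    have e0 : unitV d (e i) ∘ e = unitV d i := by
      ext l; simp [unitV]
    have e1 : (x + unitV d (e i)) ∘ e = x ∘ e + unitV d i := by
      rw [← e0]; rfl
    have e2 : (x - unitV d (e i)) ∘ e = x ∘ e - unitV d i := by
      rw [← e0]; rfl
    rw [e1, e2]

lemma LatSym.comp {σ τ : V d → V d} (hσ : LatSym σ) (hτ : LatSym τ) :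
    LatSym fun x => σ (τ x) where
  inj := hσ.inj.comp hτ.inj
  nbr F x := by rw [hτ.nbr (fun z => F (σ z)), hσ.nbr]

lemma lazyP_add_right (k : ℕ) (x y a : V d) : lazyP d k (x + a) (y + a) = lazyP d k x y :=
  (latSym_add a).lazyP k x y

lemma lazyP_symm (k : ℕ) (x y : V d) : lazyP d k x y = lazyP d k y x := by
  rw [← latSym_neg.lazyP k x y, ← lazyP_add_right k (-x) (-y) (x + y)]
  congr 1 <;> abel

lemma lazyP_self (k : ℕ) (x : V d) : lazyP d k x x = lazyP d k 0 0 := by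
  rw [← lazyP_add_right k 0 0 x, zero_add]

/-- The finite box of radius `k` around `x`. -/
def cube (x : V d) (k : ℕ) : Finset (V d) :=
  Fintype.piFinset fun i => Finset.Icc (x i - k) (x i + k)

lemma mem_cube {x z : V d} {k : ℕ} : z ∈ cube x k ↔ ∀ i, |x i - z i| ≤ k := by
  simp only [cube, Fintype.mem_piFinset, Finset.mem_Icc, abs_le]
  refine forall_congr' fun i => ?_
  constructor <;> rintro ⟨h, h'⟩ <;> constructor <;> linarith

lemma lazyP_eq_zero_of_notMem {k : ℕ} {x z : V d} (h : z ∉ cube x k) : lazyP d k x z = 0 := by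
  rw [mem_cube] at h
  push Not at h
  obtain ⟨i, hi⟩ := h
  exact lazyP_eq_zero k x z i hi

lemma summable_of_cube {f : V d → ℝ} (x : V d) (k : ℕ) (h : ∀ z, z ∉ cube x k → f z = 0) :
    Summable f := summable_of_ne_finset_zero (s := cube x k) fun z hz => h z hz

lemma summable_lazyP_mul (k : ℕ) (x : V d) (g : V d → ℝ) :
    Summable fun z => lazyP d k x z * g z :=
  summable_of_cube x k fun z hz => by rw [lazyP_eq_zero_of_notMem hz, zero_mul]

lemma lazyP_chapman (k l : ℕ) : ∀ x y : V d,
    ∑' z, lazyP d k x z * lazyP d l z y = lazyP d (k + l) x y := by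
  induction k with
  | zero =>
    intro x y
    rw [tsum_eq_single x]
    · simp [lazyP]
    · intro z hz; simp [lazyP, Ne.symm hz]
  | succ k ih =>
    intro x y
    have hs : ∀ x' : V d, Summable fun z => lazyP d k x' z * lazyP d l z y :=
      fun x' => summable_lazyP_mul k x' _
    have : (fun z => lazyP d (k + 1) x z * lazyP d l z y) = fun z =>
        (1 / 2) * (lazyP d k x z * lazyP d l z y) + (1 / (4 * (d : ℝ))) *
          ∑ i : Fin d, (lazyP d k (x + unitV d i) z * lazyP d l z y +
            lazyP d k (x - unitV d i) z * lazyP d l z y) := by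
      ext z
      rw [lazyP_succ, add_mul, mul_assoc, mul_assoc, Finset.sum_mul]
      simp only [add_mul]
    rw [this, (hs x).mul_left _ |>.tsum_add (Summable.mul_left _ (summable_sum fun i _ =>
      (hs _).add (hs _))), tsum_mul_left, tsum_mul_left, Summable.tsum_finsetSum (fun i _ =>
      (hs _).add (hs _)), ih]
    rw [show k + 1 + l = (k + l) + 1 by ring, lazyP_succ]
    congr 2
    refine Finset.sum_congr rfl fun i _ => ?_
    rw [(hs _).tsum_add (hs _), ih, ih]

/-- Coefficients of the white-noise decomposition of the free field at level `k`:
one Gaussian variable per site and one per edge. -/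
def levKer (d k : ℕ) (x z : V d) : Option (Fin d) → ℝ
  | none => lazyP d k x z / Real.sqrt 2
  | some i => (lazyP d k x z + lazyP d k x (z + unitV d i)) / Real.sqrt (8 * d)

lemma levKer_eq_zero {k : ℕ} {x z : V d} (h : z ∉ cube x (k + 1)) (o : Option (Fin d)) :
    levKer d k x z o = 0 := by
  rw [mem_cube] at h
  push Not at h
  obtain ⟨j, hj⟩ := h
  push_cast at hj
  have h1 := lazyP_eq_zero k x z j (by linarith)
  cases o with
  | none => simp [levKer, h1]
  | some i =>
    have hu := abs_le.1 (unitV_abs_le i j)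
    have h2 := lazyP_eq_zero k x (z + unitV d i) j (by
      rw [lt_abs] at hj ⊢
      simp only [Pi.add_apply]
      rcases hj with h | h
      · left; linarith
      · right; linarith)
    simp [levKer, h1, h2]

lemma levKer_nonneg (k : ℕ) (x z : V d) (o : Option (Fin d)) : 0 ≤ levKer d k x z o := by
  cases o with
  | none => exact div_nonneg (lazyP_nonneg _ _ _) (Real.sqrt_nonneg _)
  | some i =>
    exact div_nonneg (add_nonneg (lazyP_nonneg _ _ _) (lazyP_nonneg _ _ _))
      (Real.sqrt_nonneg _)

lemma levKer_le_one (k : ℕ) (x z : V d) (o : Option (Fin d)) : levKer d k x z o ≤ 1 := by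
  cases o with
  | none =>
    refine div_le_one_of_le₀ ((lazyP_le_one _ _ _).trans ?_) (Real.sqrt_nonneg _)
    rw [Real.one_le_sqrt]; norm_num
  | some i =>
    refine div_le_one_of_le₀ ((add_le_add (lazyP_le_one _ _ _) (lazyP_le_one _ _ _)).trans ?_)
      (Real.sqrt_nonneg _)
    have : (1 : ℝ) ≤ d := by
      have := i.pos
      exact_mod_cast this
    rw [Real.le_sqrt (by norm_num) (by positivity)]
    linarith

lemma tsum_lazyP_sq (k : ℕ) (x y : V d) :
    ∑' z, lazyP d k x z * lazyP d k y z = lazyP d (2 * k) x y := by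
  rw [two_mul, ← lazyP_chapman]
  simp only [lazyP_symm k y]

lemma tsum_lazyP_shift (k : ℕ) (x y a b : V d) :
    ∑' z, lazyP d k x (z + a) * lazyP d k y (z + b) =
      ∑' z, lazyP d k x z * lazyP d k y (z + b - a) := by
  rw [← (Equiv.addRight a).tsum_eq (fun z => lazyP d k x z * lazyP d k y (z + b - a))]
  refine tsum_congr fun z => ?_
  simp only [Equiv.coe_addRight]
  congr 2; abel

/-- Level-`k` covariance identity. -/
lemma tsum_levKer (hd : 0 < d) (k : ℕ) (x y : V d) :
    ∑' z, ∑ o, levKer d k x z o * levKer d k y z o =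
      (1 / 2) * (lazyP d (2 * k) x y + lazyP d (2 * k + 1) x y) := by
  have hd' : (0 : ℝ) < d := by exact_mod_cast hd
  have s2 : Real.sqrt 2 * Real.sqrt 2 = 2 := Real.mul_self_sqrt (by norm_num)
  have s8 : Real.sqrt (8 * d) * Real.sqrt (8 * d) = 8 * d := Real.mul_self_sqrt (by positivity)
  have hsum : ∀ (a b : V d), Summable fun z => lazyP d k x (z + a) * lazyP d k y (z + b) := by
    intro a b
    have := (summable_lazyP_mul k x (fun z => lazyP d k y (z + b - a)))
    rw [← (Equiv.addRight a).summable_iff] at this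
    refine this.congr fun z => ?_
    simp only [Function.comp, Equiv.coe_addRight]
    congr 2; abel
  have h00 := hsum 0 0
  simp only [add_zero] at h00
  have h0 : ∀ b, Summable fun z => lazyP d k x z * lazyP d k y (z + b) := by
    intro b; simpa using hsum 0 b
  have h1 : ∀ a, Summable fun z => lazyP d k x (z + a) * lazyP d k y z := by
    intro a; simpa using hsum a 0
  have e : (fun z => ∑ o, levKer d k x z o * levKer d k y z o) = fun z =>
      (1 / 2) * (lazyP d k x z * lazyP d k y z) + (1 / (8 * (d : ℝ))) * ∑ i : Fin d,
        ((lazyP d k x z * lazyP d k y z +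
          lazyP d k x (z + unitV d i) * lazyP d k y (z + unitV d i)) +
        (lazyP d k x z * lazyP d k y (z + unitV d i) +
          lazyP d k x (z + unitV d i) * lazyP d k y z)) := by
    ext z
    rw [Fintype.sum_option, Finset.mul_sum]
    congr 1
    · simp only [levKer]; rw [div_mul_div_comm, s2]; ring
    · refine Finset.sum_congr rfl fun i _ => ?_
      simp only [levKer]; rw [div_mul_div_comm, s8]; field_simp; ring
  have hodd : lazyP d (2 * k + 1) x y = (1 / 2) * lazyP d (2 * k) x y + (1 / (4 * (d : ℝ))) *
      ∑ i : Fin d, ((∑' z, lazyP d k x z * lazyP d k y (z + unitV d i)) +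
        ∑' z, lazyP d k x z * lazyP d k y (z - unitV d i)) := by
    have t : ∀ a : V d, ∑' z, lazyP d k x z * lazyP d k y (z + a) =
        lazyP d (2 * k) (x + a) y := by
      intro a
      rw [← tsum_lazyP_sq]
      rw [← (Equiv.addRight a).tsum_eq (fun z => lazyP d k (x + a) z * lazyP d k y z)]
      simp only [Equiv.coe_addRight, lazyP_add_right]
    have t' : ∀ a : V d, ∑' z, lazyP d k x z * lazyP d k y (z - a) =
        lazyP d (2 * k) (x - a) y := by
      intro a; simpa [sub_eq_add_neg] using t (-a)
    simp only [t, t']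
    rw [lazyP_succ]
  rw [e, (h00.mul_left _).tsum_add (Summable.mul_left _ (summable_sum fun i _ =>
    ((h00.add (hsum _ _)).add ((h0 _).add (h1 _))))), tsum_mul_left, tsum_mul_left,
    Summable.tsum_finsetSum (fun i _ => ((h00.add (hsum _ _)).add ((h0 _).add (h1 _)))), hodd]
  have t1 : ∀ i : Fin d, ∑' z, ((lazyP d k x z * lazyP d k y z +
          lazyP d k x (z + unitV d i) * lazyP d k y (z + unitV d i)) +
        (lazyP d k x z * lazyP d k y (z + unitV d i) +
          lazyP d k x (z + unitV d i) * lazyP d k y z)) =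
      2 * lazyP d (2 * k) x y + ((∑' z, lazyP d k x z * lazyP d k y (z + unitV d i)) +
        ∑' z, lazyP d k x z * lazyP d k y (z - unitV d i)) := by
    intro i
    rw [(h00.add (hsum _ _)).tsum_add ((h0 _).add (h1 _)), h00.tsum_add (hsum _ _),
      (h0 _).tsum_add (h1 _), tsum_lazyP_shift]
    have := tsum_lazyP_shift k x y (unitV d i) 0
    simp only [add_zero] at this
    rw [this]
    simp only [add_sub_cancel_right]
    rw [tsum_lazyP_sq]; ring
  simp only [t1]
  rw [Finset.sum_add_distrib, tsum_lazyP_sq]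
  simp only [Finset.sum_const, Finset.card_univ, Fintype.card_fin, nsmul_eq_mul]
  field_simp
  ring

end Lazy

section ReturnBound

/-- Symbol of the lazy walk. -/
def symb (d : ℕ) (θ : Fin d → ℝ) : ℝ := 1 / 2 + (1 / (2 * d)) * ∑ i, Real.cos (θ i)

/-- Uniform (non-normalised) measure on the torus. -/
def torus (d : ℕ) : Measure (Fin d → ℝ) :=
  Measure.pi fun _ => volume.restrict (Ioc (-Real.pi) Real.pi)

instance (d : ℕ) : IsFiniteMeasure (torus d) := by unfold torus; infer_instance

lemma integral_char (n : ℤ) :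
    ∫ θ in Ioc (-Real.pi) Real.pi, Complex.exp (θ * n * Complex.I) =
      if n = 0 then (2 * Real.pi : ℂ) else 0 := by
  rw [← intervalIntegral.integral_of_le (by linarith [Real.pi_pos])]
  split_ifs with h
  · subst h; simp; ring
  · have e : (fun θ : ℝ => Complex.exp (θ * n * Complex.I)) =
        fun θ : ℝ => Complex.exp ((n * Complex.I) * θ) := by
      ext θ; congr 1; ring
    rw [e, integral_exp_mul_complex (by simp [h])]
    have : Complex.exp (n * Complex.I * (Real.pi : ℂ)) =
        Complex.exp (n * Complex.I * ((-Real.pi : ℝ) : ℂ)) := by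
      rw [Complex.exp_eq_exp_iff_exists_int]
      exact ⟨n, by push_cast; ring⟩
    rw [this, sub_self, zero_div]

lemma integral_torus_cos (d : ℕ) (x : V d) :
    ∫ θ, Real.cos (∑ i, θ i * x i) ∂(torus d) = if x = 0 then (2 * Real.pi) ^ d else 0 := by
  have h1 : ∫ θ, Complex.exp ((∑ i, θ i * x i : ℝ) * Complex.I) ∂(torus d) =
      ((if x = 0 then (2 * Real.pi) ^ d else 0 : ℝ) : ℂ) := by
    have e : (fun θ : Fin d → ℝ => Complex.exp ((∑ i, θ i * x i : ℝ) * Complex.I)) =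
        fun θ => ∏ i, Complex.exp (θ i * x i * Complex.I) := by
      ext θ
      rw [← Complex.exp_sum]
      congr 1
      push_cast
      rw [Finset.sum_mul]
    rw [e, torus, integral_fintype_prod_eq_prod (𝕜 := ℂ)
      (f := fun i (t : ℝ) => Complex.exp (t * x i * Complex.I))]
    simp only [integral_char]
    split_ifs with hx
    · subst hx; simp
    · obtain ⟨i, hi⟩ := Function.ne_iff.1 hx
      rw [Finset.prod_eq_zero (Finset.mem_univ i)]
      · simp
      · simpa using hi
  have hint : Integrable (fun θ : Fin d → ℝ =>
      Complex.exp ((∑ i, θ i * x i : ℝ) * Complex.I)) (torus d) := by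
    refine Integrable.of_bound (C := 1) (Continuous.aestronglyMeasurable (by fun_prop))
      (ae_of_all _ fun θ => ?_)
    rw [Complex.norm_exp_ofReal_mul_I]
  have h2 := integral_re hint
  rw [h1] at h2
  simp only [RCLike.re_to_complex, Complex.exp_ofReal_mul_I_re, Complex.ofReal_re] at h2
  exact h2

variable {d : ℕ}

lemma abs_symb_le (θ : Fin d → ℝ) : |symb d θ| ≤ 1 := by
  unfold symb
  rcases Nat.eq_zero_or_pos d with rfl | hd
  · norm_num
  · have hd' : (0 : ℝ) < d := by exact_mod_cast hd
    have h1 : ∑ i, Real.cos (θ i) ≤ ∑ _i : Fin d, (1 : ℝ) :=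
      Finset.sum_le_sum fun i _ => Real.cos_le_one _
    have h2 : ∑ _i : Fin d, (-1 : ℝ) ≤ ∑ i, Real.cos (θ i) :=
      Finset.sum_le_sum fun i _ => Real.neg_one_le_cos _
    simp at h1 h2
    rw [abs_le]
    have e : (1 / (2 * (d : ℝ))) * d = 1 / 2 := by field_simp
    have h3 : (1 / (2 * (d : ℝ))) * ∑ i, Real.cos (θ i) ≤ (1 / (2 * (d : ℝ))) * d := by gcongr
    have h4 : (1 / (2 * (d : ℝ))) * (-d) ≤ (1 / (2 * (d : ℝ))) * ∑ i, Real.cos (θ i) := by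
      gcongr
    constructor <;> nlinarith

lemma symb_nonneg (θ : Fin d → ℝ) : 0 ≤ symb d θ := by
  unfold symb
  rcases Nat.eq_zero_or_pos d with rfl | hd
  · simp
  · have hd' : (0 : ℝ) < d := by exact_mod_cast hd
    have h2 : ∑ _i : Fin d, (-1 : ℝ) ≤ ∑ i, Real.cos (θ i) :=
      Finset.sum_le_sum fun i _ => Real.neg_one_le_cos _
    simp at h2
    have e : (1 / (2 * (d : ℝ))) * d = 1 / 2 := by field_simp
    have h4 : (1 / (2 * (d : ℝ))) * (-d) ≤ (1 / (2 * (d : ℝ))) * ∑ i, Real.cos (θ i) := by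
      gcongr
    nlinarith

lemma continuous_symb : Continuous (symb d) := by unfold symb; fun_prop

lemma integrable_symb_cos (k : ℕ) (x : V d) :
    Integrable (fun θ => symb d θ ^ k * Real.cos (∑ i, θ i * x i)) (torus d) := by
  refine Integrable.of_bound (C := 1)
    ((continuous_symb.pow k).mul (by fun_prop)).aestronglyMeasurable (ae_of_all _ fun θ => ?_)
  rw [norm_mul, norm_pow, Real.norm_eq_abs, Real.norm_eq_abs]
  exact mul_le_one₀ (pow_le_one₀ (abs_nonneg _) (abs_symb_le θ)) (abs_nonneg _)
    (Real.abs_cos_le_one _)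

lemma cos_add_unit (θ : Fin d → ℝ) (x : V d) (i : Fin d) :
    Real.cos (∑ j, θ j * ((x + unitV d i) j : ℤ)) +
      Real.cos (∑ j, θ j * ((x - unitV d i) j : ℤ)) =
      2 * Real.cos (θ i) * Real.cos (∑ j, θ j * x j) := by
  have h : ∑ j, θ j * (unitV d i j : ℝ) = θ i := by
    simp [unitV]
  have e1 : ∑ j, θ j * ((x + unitV d i) j : ℤ) = ∑ j, θ j * x j + θ i := by
    rw [← h, ← Finset.sum_add_distrib]
    exact Finset.sum_congr rfl fun j _ => by simp [mul_add]
  have e2 : ∑ j, θ j * ((x - unitV d i) j : ℤ) = ∑ j, θ j * x j - θ i := by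
    rw [← h, ← Finset.sum_sub_distrib]
    exact Finset.sum_congr rfl fun j _ => by simp [mul_sub]
  rw [e1, e2, Real.cos_add, Real.cos_sub]; ring

lemma integral_symb (k : ℕ) : ∀ x y : V d,
    ∫ θ, symb d θ ^ k * Real.cos (∑ i, θ i * (x - y) i) ∂(torus d) =
      (2 * Real.pi) ^ d * lazyP d k x y := by
  induction k with
  | zero =>
    intro x y
    have := integral_torus_cos d (x - y)
    simp only [pow_zero, one_mul, lazyP, mul_ite, mul_one, mul_zero]
    rw [this]
    simp [sub_eq_zero]
  | succ k ih =>
    intro x y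
    have e : (fun θ => symb d θ ^ (k + 1) * Real.cos (∑ i, θ i * (x - y) i)) = fun θ =>
        (1 / 2) * (symb d θ ^ k * Real.cos (∑ i, θ i * (x - y) i)) + (1 / (4 * (d : ℝ))) *
          ∑ i, (symb d θ ^ k * Real.cos (∑ j, θ j * (x + unitV d i - y) j) +
            symb d θ ^ k * Real.cos (∑ j, θ j * (x - unitV d i - y) j)) := by
      ext θ
      have : ∀ i, symb d θ ^ k * Real.cos (∑ j, θ j * (x + unitV d i - y) j) +
            symb d θ ^ k * Real.cos (∑ j, θ j * (x - unitV d i - y) j) =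
          symb d θ ^ k * (2 * Real.cos (θ i) * Real.cos (∑ j, θ j * (x - y) j)) := by
        intro i
        rw [← mul_add, ← cos_add_unit]
        simp only [add_sub_right_comm, sub_right_comm]
      simp only [this]
      rw [pow_succ, ← Finset.mul_sum, ← Finset.sum_mul, ← Finset.mul_sum]
      have hs : symb d θ = 1 / 2 + (1 / (2 * d)) * ∑ i, Real.cos (θ i) := rfl
      rw [mul_assoc, hs]
      rcases Nat.eq_zero_or_pos d with rfl | hd
      · simp; ring
      · have hd' : (d : ℝ) ≠ 0 := by exact_mod_cast hd.ne'
        field_simp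
        ring
    have hi : ∀ i : Fin d, Integrable (fun θ =>
        symb d θ ^ k * Real.cos (∑ j, θ j * (x + unitV d i - y) j) +
          symb d θ ^ k * Real.cos (∑ j, θ j * (x - unitV d i - y) j)) (torus d) := fun i =>
      (integrable_symb_cos k _).add (integrable_symb_cos k _)
    rw [e, integral_add ((integrable_symb_cos k _).const_mul _)
      ((integrable_finsetSum _ fun i _ => hi i).const_mul _),
      integral_const_mul, integral_const_mul, integral_finsetSum _ (fun i _ => hi i), ih]
    have : ∀ i : Fin d, ∫ θ, (symb d θ ^ k * Real.cos (∑ j, θ j * (x + unitV d i - y) j) +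
            symb d θ ^ k * Real.cos (∑ j, θ j * (x - unitV d i - y) j)) ∂(torus d) =
        (2 * Real.pi) ^ d * (lazyP d k (x + unitV d i) y + lazyP d k (x - unitV d i) y) := by
      intro i
      rw [integral_add (integrable_symb_cos k _) (integrable_symb_cos k _), ih, ih]; ring
    simp only [this]
    rw [← Finset.mul_sum, lazyP_succ]; ring

lemma symb_le_exp (hd : 0 < d) {θ : Fin d → ℝ} (h : ∀ i, |θ i| ≤ Real.pi) :
    symb d θ ≤ Real.exp (-∑ i, θ i ^ 2 / (Real.pi ^ 2 * d)) := by
  have hd' : (0 : ℝ) < d := by exact_mod_cast hd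
  refine le_trans ?_ (Real.add_one_le_exp _)
  have h1 : ∑ i, Real.cos (θ i) ≤ ∑ i, (1 - 2 / Real.pi ^ 2 * θ i ^ 2) :=
    Finset.sum_le_sum fun i _ => Real.cos_le_one_sub_mul_cos_sq (h i)
  have h2 : (1 / (2 * (d : ℝ))) * ∑ i, Real.cos (θ i) ≤
      (1 / (2 * (d : ℝ))) * ∑ i, (1 - 2 / Real.pi ^ 2 * θ i ^ 2) := by gcongr
  have h3 : (1 / (2 * (d : ℝ))) * ∑ i, (1 - 2 / Real.pi ^ 2 * θ i ^ 2) =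
      1 / 2 - ∑ i, θ i ^ 2 / (Real.pi ^ 2 * d) := by
    rw [Finset.sum_sub_distrib, mul_sub, ← Finset.mul_sum, ← Finset.sum_div]
    simp
    field_simp
  unfold symb
  linarith

lemma lazyP_return (hd : 3 ≤ d) : ∃ C : ℝ, 0 < C ∧ ∀ k : ℕ, 1 ≤ k →
    lazyP d k 0 0 ≤ C * (1 / Real.sqrt k) ^ 3 := by
  have hd0 : 0 < d := by omega
  have hd' : (0 : ℝ) < d := by exact_mod_cast hd0
  set B : ℝ := Real.sqrt (Real.pi * (Real.pi ^ 2 * d)) with hB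
  have hBpos : 0 < B := by positivity
  refine ⟨B ^ d, by positivity, fun k hk => ?_⟩
  have hk' : (0 : ℝ) < k := by exact_mod_cast hk
  set b : ℝ := k / (Real.pi ^ 2 * d) with hb
  have hbpos : 0 < b := by positivity
  have h0 := integral_symb k (0 : V d) 0
  simp only [sub_zero, Pi.zero_apply, Int.cast_zero, mul_zero, Finset.sum_const_zero,
    Real.cos_zero, mul_one] at h0
  have hg : Integrable (fun θ : ℝ => Real.exp (-b * θ ^ 2)) := integrable_exp_neg_mul_sq hbpos
  have hbound : ∫ θ, symb d θ ^ k ∂(torus d) ≤ (B / Real.sqrt k) ^ d := by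
    have hae : ∀ᵐ θ ∂(torus d), ∀ i, |θ i| ≤ Real.pi := by
      rw [ae_all_iff]
      intro i
      have hq : Filter.Tendsto (Function.eval i) (ae (torus d))
          (ae (volume.restrict (Ioc (-Real.pi) Real.pi))) :=
        Measure.tendsto_eval_ae_ae
      refine hq.eventually (p := fun t : ℝ => |t| ≤ Real.pi) ?_
      filter_upwards [ae_restrict_mem measurableSet_Ioc] with t ht
      exact abs_le.2 ⟨ht.1.le, ht.2⟩
    have hpi : Integrable (fun θ : Fin d → ℝ => ∏ i, Real.exp (-b * θ i ^ 2)) (torus d) :=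
      Integrable.fintype_prod (f := fun _ (t : ℝ) => Real.exp (-b * t ^ 2))
        (μ := fun _ => volume.restrict (Ioc (-Real.pi) Real.pi)) fun i => hg.restrict
    calc ∫ θ, symb d θ ^ k ∂(torus d)
        ≤ ∫ θ, ∏ i, Real.exp (-b * θ i ^ 2) ∂(torus d) := by
          refine integral_mono_ae ?_ hpi ?_
          · have := integrable_symb_cos k (0 : V d)
            simpa using this
          · filter_upwards [hae] with θ hθ
            calc symb d θ ^ k ≤ Real.exp (-∑ i, θ i ^ 2 / (Real.pi ^ 2 * d)) ^ k :=
                  pow_le_pow_left₀ (symb_nonneg θ) (symb_le_exp hd0 hθ) k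
              _ = ∏ i, Real.exp (-b * θ i ^ 2) := by
                  rw [← Real.exp_nat_mul, ← Real.exp_sum, mul_neg, Finset.mul_sum,
                    ← Finset.sum_neg_distrib]
                  congr 1
                  refine Finset.sum_congr rfl fun i _ => ?_
                  rw [hb]; ring
      _ = ∏ _i : Fin d, ∫ t in Ioc (-Real.pi) Real.pi, Real.exp (-b * t ^ 2) := by
          rw [torus]
          exact integral_fintype_prod_eq_prod (𝕜 := ℝ)
            (f := fun _ (t : ℝ) => Real.exp (-b * t ^ 2))
      _ ≤ ∏ _i : Fin d, (B / Real.sqrt k) := by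
          refine Finset.prod_le_prod (fun i _ => integral_nonneg fun t => (Real.exp_pos _).le)
            fun i _ => ?_
          refine (setIntegral_le_integral hg (ae_of_all _ fun t => (Real.exp_pos _).le)).trans ?_
          rw [integral_gaussian, hB, ← Real.sqrt_div' _ hk'.le, hb]
          apply le_of_eq
          congr 1
          field_simp
      _ = _ := by simp [div_pow]
  have h1 : lazyP d k 0 0 ≤ (2 * Real.pi) ^ d * lazyP d k 0 0 := by
    have : (1 : ℝ) ≤ (2 * Real.pi) ^ d := one_le_pow₀ (by linarith [Real.pi_gt_three])
    nlinarith [lazyP_nonneg k (0 : V d) 0]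
  have hs1 : 1 / Real.sqrt k ≤ 1 := by
    rw [div_le_one (Real.sqrt_pos.2 hk'), Real.one_le_sqrt]
    exact_mod_cast hk
  calc lazyP d k 0 0 ≤ (B / Real.sqrt k) ^ d := by
        rw [h0] at hbound; exact h1.trans hbound
    _ = B ^ d * (1 / Real.sqrt k) ^ d := by rw [← mul_pow]; ring
    _ ≤ B ^ d * (1 / Real.sqrt k) ^ 3 := by
        gcongr ?_ * ?_
        exact pow_le_pow_of_le_one (by positivity) hs1 hd

end ReturnBound

section LinearFields

section LinearLaw

variable {ι : Type*} [DecidableEq ι] {ν : ι → Measure ℝ} [∀ i, IsProbabilityMeasure (ν i)]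

lemma map_linear_infinitePi (T : Finset ι) (c : ι → ℝ) (hν : ∀ i ∈ T, ν i = gaussianReal 0 1) :
    Measure.map (fun w => ∑ i ∈ T, c i * w i) (Measure.infinitePi ν) =
      gaussianReal 0 (Real.toNNReal (∑ i ∈ T, c i ^ 2)) := by
  induction T using Finset.induction_on with
  | empty => simp
  | insert i T hi ih =>
    have hindep : iIndepFun (fun i (w : ι → ℝ) => c i * w i) (Measure.infinitePi ν) :=
      iIndepFun_infinitePi (X := fun i x => c i * x) fun i => by fun_prop
    have h1 := hindep.indepFun_finsetSum_of_notMem (fun i => by fun_prop) hi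
    have h2 : Measure.map (fun w : ι → ℝ => c i * w i) (Measure.infinitePi ν) =
        gaussianReal 0 (Real.toNNReal (c i ^ 2)) := by
      have h3 : Measure.map (fun w : ι → ℝ => w i) (Measure.infinitePi ν) = gaussianReal 0 1 := by
        have := Measure.infinitePi_map_eval ν i
        rw [hν i (Finset.mem_insert_self _ _)] at this
        exact this
      have h4 := gaussianReal_map_const_mul (μ := 0) (v := 1) (c i)
      rw [← h3, Measure.map_map (by fun_prop) (by fun_prop)] at h4
      rw [mul_zero, mul_one] at h4
      rw [Real.toNNReal_of_nonneg (sq_nonneg _)]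
      exact h4
    have h5 := gaussianReal_add_gaussianReal_of_indepFun h1.symm h2 (v₂ :=
      Real.toNNReal (∑ i ∈ T, c i ^ 2)) (m₂ := 0) (by
        rw [← ih fun j hj => hν j (Finset.mem_insert_of_mem hj)]
        congr 1; ext w; simp)
    rw [Finset.sum_insert hi, Real.toNNReal_add (sq_nonneg _)
      (Finset.sum_nonneg fun _ _ => sq_nonneg _)]
    rw [add_zero] at h5
    rw [← h5]
    congr 1; ext w; simp [Finset.sum_insert hi]

end LinearLaw

/-- Sources of randomness: a scale, a site, and either the site itself or an edge direction. -/
abbrev Src (d : ℕ) := ℕ × V d × Option (Fin d)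

/-- Coordinates: Gaussian sources and uniform noise variables. -/
abbrev Ix (d : ℕ) := Src d ⊕ V d

def nu (d : ℕ) : Ix d → Measure ℝ
  | Sum.inl _ => gaussianReal 0 1
  | Sum.inr _ => volume.restrict (Icc (0 : ℝ) 1)

instance (d : ℕ) (i : Ix d) : IsProbabilityMeasure (nu d i) := by
  cases i with
  | inl s => unfold nu; infer_instance
  | inr x => unfold nu; exact ⟨by simp⟩

def mu0 (d : ℕ) : Measure (Ix d → ℝ) := Measure.infinitePi (nu d)

instance (d : ℕ) : IsProbabilityMeasure (mu0 d) := by unfold mu0; infer_instance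

variable {d : ℕ}

def ker (x : V d) (s : Src d) : ℝ := levKer d s.1 x s.2.1 s.2.2

lemma ker_nonneg (x : V d) (s : Src d) : 0 ≤ ker x s := levKer_nonneg _ _ _ _

lemma ker_le_one (x : V d) (s : Src d) : ker x s ≤ 1 := levKer_le_one _ _ _ _

def lin (T : Finset (Src d)) (w : Ix d → ℝ) (x : V d) : ℝ := ∑ s ∈ T, ker x s * w (Sum.inl s)

def srcs (A : Finset ℕ) (x : V d) (m : ℕ) : Finset (Src d) :=
  A ×ˢ cube x m ×ˢ Finset.univ

lemma mem_srcs {A : Finset ℕ} {x : V d} {m : ℕ} {s : Src d} :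
    s ∈ srcs A x m ↔ s.1 ∈ A ∧ s.2.1 ∈ cube x m := by
  simp [srcs, Finset.mem_product]

lemma ker_eq_zero {x : V d} {s : Src d} {m : ℕ} (h : s.1 < m) (hs : s.2.1 ∉ cube x m) :
    ker x s = 0 := by
  refine levKer_eq_zero ?_ _
  rw [mem_cube] at hs ⊢
  push Not at hs ⊢
  obtain ⟨i, hi⟩ := hs
  refine ⟨i, lt_of_le_of_lt ?_ hi⟩
  exact_mod_cast h

lemma measurable_lin (T : Finset (Src d)) (x : V d) : Measurable fun w => lin T w x := by
  unfold lin; fun_prop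

/-- The level-`< 2^n` field. -/
def psi (n : ℕ) (w : Ix d → ℝ) (x : V d) : ℝ := lin (srcs (Finset.range (2 ^ n)) x (2 ^ n)) w x

lemma measurable_psi (n : ℕ) (x : V d) : Measurable fun w : Ix d → ℝ => psi n w x :=
  measurable_lin _ _

lemma lin_law (s : Finset (V d)) (a : V d → ℝ) (T : Finset (Src d)) :
    Measure.map (fun w => ∑ x ∈ s, a x * lin T w x) (mu0 d) =
      gaussianReal 0 (Real.toNNReal (∑ t ∈ T, (∑ x ∈ s, a x * ker x t) ^ 2)) := by
  have := map_linear_infinitePi (ν := nu d) (T.map ⟨Sum.inl, Sum.inl_injective⟩)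
    (fun i => match i with
      | Sum.inl t => ∑ x ∈ s, a x * ker x t
      | Sum.inr _ => 0) (by
      intro i hi
      obtain ⟨t, -, rfl⟩ := Finset.mem_map.1 hi
      rfl)
  rw [Finset.sum_map] at this
  simp only [Function.Embedding.coeFn_mk, Finset.sum_map] at this
  rw [mu0, ← this]
  congr 1; ext w
  simp only [lin, Finset.mul_sum, Finset.sum_mul]
  rw [Finset.sum_comm]
  simp only [mul_assoc]

lemma lin_law_single (x : V d) (T : Finset (Src d)) :
    Measure.map (fun w => lin T w x) (mu0 d) =
      gaussianReal 0 (Real.toNNReal (∑ t ∈ T, ker x t ^ 2)) := by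
  have := lin_law {x} (fun _ => 1) T
  simpa using this

lemma lin_eq_of_subset {n : ℕ} {x : V d} {T : Finset (Src d)}
    (h1 : srcs (Finset.range (2 ^ n)) x (2 ^ n) ⊆ T) (h2 : ∀ t ∈ T, t.1 < 2 ^ n)
    (w : Ix d → ℝ) : psi n w x = lin T w x := by
  refine Finset.sum_subset h1 fun t ht hn => ?_
  rw [ker_eq_zero (h2 t ht), zero_mul]
  intro hc
  exact hn (mem_srcs.2 ⟨Finset.mem_range.2 (h2 t ht), hc⟩)

lemma exists_cube_superset (s : Finset (V d)) (m : ℕ) : ∃ M : ℕ, ∀ x ∈ s, cube x m ⊆ cube 0 M := by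
  induction s using Finset.induction_on with
  | empty => exact ⟨0, by simp⟩
  | insert x s hx ih =>
    obtain ⟨M, hM⟩ := ih
    obtain ⟨K, hK⟩ : ∃ K : ℕ, ∀ i, |x i| ≤ K := by
      refine ⟨Finset.univ.sup fun i => (x i).natAbs, fun i => ?_⟩
      rw [Int.abs_eq_natAbs]
      exact_mod_cast Finset.le_sup (f := fun i => (x i).natAbs) (Finset.mem_univ i)
    refine ⟨M + (K + m), fun y hy z hz => ?_⟩
    rw [mem_cube]
    intro i
    rcases Finset.mem_insert.1 hy with rfl | hy
    · have h1 := mem_cube.1 hz i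
      have h2 := hK i
      have h3 : |(0 : V d) i - z i| ≤ |y i - z i| + |y i| := by
        have := abs_sub_abs_le_abs_sub (z i) (y i)
        rw [Pi.zero_apply, zero_sub, abs_neg, abs_sub_comm (y i)]; linarith
      push_cast; linarith
    · have h1 := mem_cube.1 (hM y hy hz) i
      push_cast; linarith

lemma sum_ker_mul (hd : 0 < d) (A : Finset ℕ) (x y : V d) {m : ℕ} (B : Finset (V d))
    (hA : ∀ k ∈ A, k < m) (hB : cube x m ⊆ B) :
    ∑ t ∈ A ×ˢ B ×ˢ (Finset.univ : Finset (Option (Fin d))), ker x t * ker y t =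
      ∑ k ∈ A, (1 / 2) * (lazyP d (2 * k) x y + lazyP d (2 * k + 1) x y) := by
  rw [Finset.sum_product]
  refine Finset.sum_congr rfl fun k hk => ?_
  rw [← tsum_levKer hd, Finset.sum_product, tsum_eq_sum (s := B)]
  · rfl
  · intro z hz
    refine Finset.sum_eq_zero fun o _ => ?_
    have : ker x (k, z, o) = 0 := ker_eq_zero (hA k hk) fun h => hz (hB h)
    rw [show levKer d k x z o = 0 from this, zero_mul]

lemma sum_range_two_mul (f : ℕ → ℝ) (n : ℕ) :
    ∑ k ∈ Finset.range n, (f (2 * k) + f (2 * k + 1)) = ∑ l ∈ Finset.range (2 * n), f l := by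
  induction n with
  | zero => simp
  | succ n ih => rw [Finset.sum_range_succ, ih, mul_add, mul_one, Finset.sum_range_succ,
      Finset.sum_range_succ]; ring

lemma psi_isCGF (hd : 0 < d) (n : ℕ) :
    IsCGF (mu0 d) (fun x w => psi n w x) (covTrunc d (2 ^ (n + 1) - 1)) := by
  refine ⟨fun x => measurable_psi n x, fun s a => ?_⟩
  obtain ⟨M, hM⟩ := exists_cube_superset s (2 ^ n)
  set T : Finset (Src d) := Finset.range (2 ^ n) ×ˢ cube 0 M ×ˢ Finset.univ with hT
  have h1 : ∀ x ∈ s, ∀ w, psi n w x = lin T w x := fun x hx w =>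
    lin_eq_of_subset (Finset.product_subset_product_right
      (Finset.product_subset_product_left (hM x hx)))
      (fun t ht => Finset.mem_range.1 (Finset.mem_product.1 ht).1) w
  have h2 : (fun w => ∑ x ∈ s, a x * psi n w x) = fun w => ∑ x ∈ s, a x * lin T w x := by
    ext w
    exact Finset.sum_congr rfl fun x hx => by rw [h1 x hx]
  rw [h2, lin_law]
  congr 2
  calc ∑ t ∈ T, (∑ x ∈ s, a x * ker x t) ^ 2
      = ∑ t ∈ T, ∑ x ∈ s, ∑ y ∈ s, a x * a y * (ker x t * ker y t) := by
        refine Finset.sum_congr rfl fun t _ => ?_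
        rw [sq, Finset.sum_mul_sum]
        refine Finset.sum_congr rfl fun x _ => Finset.sum_congr rfl fun y _ => by ring
    _ = ∑ x ∈ s, ∑ y ∈ s, a x * a y * ∑ t ∈ T, ker x t * ker y t := by
        rw [Finset.sum_comm]
        refine Finset.sum_congr rfl fun x _ => ?_
        rw [Finset.sum_comm]
        refine Finset.sum_congr rfl fun y _ => ?_
        rw [Finset.mul_sum]
    _ = _ := by
        refine Finset.sum_congr rfl fun x hx => Finset.sum_congr rfl fun y _ => ?_
        rw [hT, sum_ker_mul hd _ x y (m := 2 ^ n) _ (fun k hk => Finset.mem_range.1 hk) (hM x hx),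
          covTrunc, ← Finset.mul_sum, sum_range_two_mul (fun l => lazyP d l x y)]
        have : 2 ^ (n + 1) - 1 + 1 = 2 * 2 ^ n := by
          have : 0 < 2 ^ n := by positivity
          rw [pow_succ]; omega
        rw [this]

/-- The block (at scale `n`) of a site. -/
def blk (n : ℕ) (z : V d) : V d := fun i => z i / 2 ^ n

def blkSrc (n : ℕ) (v x : V d) : Finset (Src d) :=
  (srcs (Finset.Ico (2 ^ n) (2 ^ (n + 1))) x (2 ^ (n + 1))).filter fun s => blk n s.2.1 = v

/-- The contribution of the block `v` to the scale-`n` increment. -/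
def xi (n : ℕ) (v : V d) (w : Ix d → ℝ) (x : V d) : ℝ := lin (blkSrc n v x) w x

def near (n : ℕ) (x : V d) : Finset (V d) := cube (blk n x) 2

lemma blk_mem_near {n : ℕ} {x z : V d} (h : z ∈ cube x (2 ^ (n + 1))) : blk n z ∈ near n x := by
  unfold near
  rw [mem_cube] at h ⊢
  intro i
  have h1 := abs_le.1 (h i)
  have hp : (0 : ℤ) < 2 ^ n := by positivity
  have e1 : (x i + 2 * 2 ^ n) / 2 ^ n = x i / 2 ^ n + 2 := Int.add_mul_ediv_right _ _ hp.ne'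
  have e2 : (x i + (-2) * 2 ^ n) / 2 ^ n = x i / 2 ^ n + (-2) := Int.add_mul_ediv_right _ _ hp.ne'
  have h2 : z i / 2 ^ n ≤ (x i + 2 * 2 ^ n) / 2 ^ n :=
    Int.ediv_le_ediv hp (by have := h1.1; push_cast at this; rw [pow_succ] at this; linarith)
  have h3 : (x i + (-2) * 2 ^ n) / 2 ^ n ≤ z i / 2 ^ n :=
    Int.ediv_le_ediv hp (by have := h1.2; push_cast at this; rw [pow_succ] at this; linarith)
  unfold blk
  rw [abs_le]
  push_cast
  constructor <;> linarith

lemma psi_succ (n : ℕ) (w : Ix d → ℝ) (x : V d) :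
    psi (n + 1) w x = psi n w x + ∑ v ∈ near n x, xi n v w x := by
  have h1 : psi n w x = lin (srcs (Finset.range (2 ^ n)) x (2 ^ (n + 1))) w x := by
    refine lin_eq_of_subset ?_ ?_ w
    · refine Finset.product_subset_product_right (Finset.product_subset_product_left ?_)
      intro z hz
      rw [mem_cube] at hz ⊢
      intro i
      refine (hz i).trans ?_
      exact_mod_cast Nat.pow_le_pow_right (by norm_num) n.le_succ
    · intro t ht
      exact Finset.mem_range.1 (mem_srcs.1 ht).1
  have h2 : ∑ v ∈ near n x, xi n v w x =
      lin (srcs (Finset.Ico (2 ^ n) (2 ^ (n + 1))) x (2 ^ (n + 1))) w x := by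
    unfold xi blkSrc lin
    exact Finset.sum_fiberwise_of_maps_to (fun t ht => blk_mem_near (mem_srcs.1 ht).2) _
  rw [h1, h2]
  unfold psi lin srcs
  rw [Finset.sum_product, Finset.sum_product, Finset.sum_product,
    Finset.sum_range_add_sum_Ico _ (Nat.pow_le_pow_right (by norm_num) n.le_succ)]

lemma inv_sqrt_cube_le {l : ℝ} (hl : 1 ≤ l) :
    (1 / Real.sqrt l) ^ 3 ≤ 4 * (1 / Real.sqrt l - 1 / Real.sqrt (l + 1)) := by
  have h0 : 0 < Real.sqrt l := Real.sqrt_pos.2 (by linarith)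
  set s := Real.sqrt l with hs
  set t := Real.sqrt (l + 1) with ht
  have h1 : 0 < t := Real.sqrt_pos.2 (by linarith)
  have hss : s ^ 2 = l := Real.sq_sqrt (by linarith)
  have htt : t ^ 2 = l + 1 := Real.sq_sqrt (by linarith)
  have hst : t ≤ 3 / 2 * s := by
    refine Real.sqrt_le_iff.2 ⟨by positivity, ?_⟩
    nlinarith
  have e : 1 / s - 1 / t = 1 / (s * t * (s + t)) := by
    field_simp
    nlinarith
  rw [e, div_pow, one_pow, mul_one_div, div_le_div_iff₀ (by positivity) (by positivity)]
  have h2 : t * (s + t) ≤ 4 * s ^ 2 := by nlinarith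
  nlinarith

lemma sum_lazyP_le (hd : 3 ≤ d) : ∃ C : ℝ, 0 < C ∧ ∀ m : ℕ, 1 ≤ m → ∀ k : ℕ,
    ∑ l ∈ Finset.range k, lazyP d (l + m) 0 0 ≤ C / Real.sqrt m := by
  obtain ⟨C, hC, h⟩ := lazyP_return hd
  refine ⟨C * 4, by positivity, fun m hm k => ?_⟩
  have key : ∑ l ∈ Finset.range k, lazyP d (l + m) 0 0 ≤
      C * 4 * (1 / Real.sqrt m - 1 / Real.sqrt ((k + m : ℕ) : ℝ)) := by
    induction k with
    | zero => simp
    | succ k ih =>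
      rw [Finset.sum_range_succ]
      have h1 := h (k + m) (by omega)
      have h2 := inv_sqrt_cube_le (l := ((k + m : ℕ) : ℝ))
        (by exact_mod_cast (by omega : 1 ≤ k + m))
      have h3 : ((k + 1 + m : ℕ) : ℝ) = ((k + m : ℕ) : ℝ) + 1 := by push_cast; ring
      rw [h3]
      nlinarith
  refine key.trans ?_
  rw [mul_sub, mul_one_div]
  have : 0 ≤ C * 4 * (1 / Real.sqrt ((k + m : ℕ) : ℝ)) := by positivity
  linarith

/-- Variance bounds for the scale increments and for the tail field. -/
lemma variance_bounds (hd : 3 ≤ d) : ∃ C : ℝ, 0 < C ∧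
    (∀ (n : ℕ) (v x : V d), ∑ t ∈ blkSrc n v x, ker x t ^ 2 ≤ C / Real.sqrt (2 ^ n)) ∧
    ∀ (n : ℕ) (x : V d), covTail d (2 ^ (n + 1) - 1) x x ≤ C / Real.sqrt (2 ^ n) := by
  obtain ⟨C, hC, h⟩ := sum_lazyP_le hd
  have hmono : ∀ n : ℕ, C / Real.sqrt ((2 ^ (n + 1) : ℕ) : ℝ) ≤ C / Real.sqrt (2 ^ n) := by
    intro n
    have : Real.sqrt (2 ^ n) ≤ Real.sqrt ((2 ^ (n + 1) : ℕ) : ℝ) := by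
      refine Real.sqrt_le_sqrt ?_
      push_cast
      exact pow_le_pow_right₀ (by norm_num) n.le_succ
    have h0 : 0 < Real.sqrt ((2 : ℝ) ^ n) := by positivity
    gcongr
  refine ⟨C, hC, fun n v x => ?_, fun n x => ?_⟩
  · refine le_trans ?_ ((h (2 ^ (n + 1)) (Nat.one_le_two_pow) (2 * 2 ^ n)).trans (hmono n))
    calc ∑ t ∈ blkSrc n v x, ker x t ^ 2
        ≤ ∑ t ∈ srcs (Finset.Ico (2 ^ n) (2 ^ (n + 1))) x (2 ^ (n + 1)), ker x t * ker x t := by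
          simp only [← sq]
          exact Finset.sum_le_sum_of_subset_of_nonneg (Finset.filter_subset _ _)
            fun _ _ _ => sq_nonneg _
      _ = ∑ k ∈ Finset.Ico (2 ^ n) (2 ^ (n + 1)),
            (1 / 2) * (lazyP d (2 * k) x x + lazyP d (2 * k + 1) x x) :=
          sum_ker_mul (by omega) _ x x _ (fun k hk => (Finset.mem_Ico.1 hk).2) subset_rfl
      _ ≤ ∑ k ∈ Finset.Ico (2 ^ n) (2 ^ (n + 1)),
            (lazyP d (2 * k) 0 0 + lazyP d (2 * k + 1) 0 0) := by
          refine Finset.sum_le_sum fun k _ => ?_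
          rw [lazyP_self (2 * k) x, lazyP_self (2 * k + 1) x]
          linarith [lazyP_nonneg (2 * k) (0 : V d) 0, lazyP_nonneg (2 * k + 1) (0 : V d) 0]
      _ = ∑ l ∈ Finset.range (2 * 2 ^ n), lazyP d (l + 2 ^ (n + 1)) 0 0 := by
          rw [Finset.sum_Ico_eq_sum_range, ← sum_range_two_mul, pow_succ]
          refine Finset.sum_congr (by congr 1; omega) fun k _ => ?_
          congr 2 <;> ring
  · have hL : 2 ^ (n + 1) - 1 + 1 = 2 ^ (n + 1) := Nat.sub_add_cancel Nat.one_le_two_pow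
    unfold covTail
    have h1 : ∑' l : ℕ, lazyP d (l + (2 ^ (n + 1) - 1) + 1) x x ≤ C / Real.sqrt (2 ^ n) := by
      refine Real.tsum_le_of_sum_range_le (fun l => lazyP_nonneg _ _ _) fun k => ?_
      refine le_trans (le_of_eq ?_) ((h (2 ^ (n + 1)) (Nat.one_le_two_pow) k).trans (hmono n))
      refine Finset.sum_congr rfl fun l _ => ?_
      rw [lazyP_self, add_assoc, hL]
    have h2 : 0 ≤ ∑' l : ℕ, lazyP d (l + (2 ^ (n + 1) - 1) + 1) x x :=
      tsum_nonneg fun l => lazyP_nonneg _ _ _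
    linarith

end LinearFields

section FieldLaws

variable {d : ℕ}

section Laws

variable {Ω Ω' : Type*} [MeasurableSpace Ω] [MeasurableSpace Ω']

lemma measurable_proc {φ : V d → Ω → ℝ} (h : ∀ x, Measurable (φ x)) : Measurable (proc φ) :=
  measurable_pi_iff.2 h

lemma IsCGF.law_unique {P : Measure Ω} {Q : Measure Ω'} [IsProbabilityMeasure P]
    [IsProbabilityMeasure Q] {φ : V d → Ω → ℝ} {φ' : V d → Ω' → ℝ} {C : V d → V d → ℝ}
    (h : IsCGF P φ C) (h' : IsCGF Q φ' C) : P.map (proc φ) = Q.map (proc φ') := by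
  have m := measurable_proc h.1
  have m' := measurable_proc h'.1
  have hp := Measure.isProbabilityMeasure_map (μ := P) m.aemeasurable
  have hp' := Measure.isProbabilityMeasure_map (μ := Q) m'.aemeasurable
  have hr : ∀ I : Finset (V d), Measurable (I.restrict (π := fun _ : V d => ℝ)) :=
    fun I => Finset.measurable_restrict I
  have : ∀ I : Finset (V d), IsFiniteMeasure ((Q.map (proc φ')).map I.restrict) :=
    fun I => inferInstance
  refine IsProjectiveLimit.unique (P := fun I => (Q.map (proc φ')).map I.restrict)
    (fun I => ?_) (fun I => rfl)
  change Measure.map I.restrict (Measure.map (proc φ) P) =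
    Measure.map I.restrict (Measure.map (proc φ') Q)
  rw [Measure.map_map (hr I) m, Measure.map_map (hr I) m']
  have hq := Measure.isProbabilityMeasure_map (μ := P) ((hr I).comp m).aemeasurable
  have hq' := Measure.isProbabilityMeasure_map (μ := Q) ((hr I).comp m').aemeasurable
  refine Measure.ext_of_charFunDual ?_
  ext L
  rw [charFunDual_eq_charFun_map_one, charFunDual_eq_charFun_map_one]
  congr 1
  rw [Measure.map_map (by fun_prop) ((hr I).comp m), Measure.map_map (by fun_prop) ((hr I).comp m')]
  set a : V d → ℝ := fun x => if hx : x ∈ I then L (Pi.single ⟨x, hx⟩ 1) else 0 with ha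
  have key : ∀ f : V d → ℝ, L (I.restrict f) = ∑ x ∈ I, a x * f x := by
    intro f
    refine (LinearMap.pi_apply_eq_sum_univ (L : (I → ℝ) →ₗ[ℝ] ℝ) (I.restrict f)).trans ?_
    rw [← Finset.sum_coe_sort I]
    refine Finset.sum_congr rfl fun x _ => ?_
    simp only [ha, x.2, dite_true, smul_eq_mul, Finset.restrict]
    rw [mul_comm]
    congr 1
    simp only [ContinuousLinearMap.coe_coe]
    congr 1
    ext y
    simp [Pi.single_apply, eq_comm]
  have e1 : L ∘ I.restrict ∘ proc φ = fun ω => ∑ x ∈ I, a x * φ x ω := by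
    ext ω; exact key _
  have e2 : L ∘ I.restrict ∘ proc φ' = fun ω => ∑ x ∈ I, a x * φ' x ω := by
    ext ω; exact key _
  rw [e1, e2, h.2, h'.2]

lemma IsCGF.neg {P : Measure Ω} {φ : V d → Ω → ℝ} {C : V d → V d → ℝ} (h : IsCGF P φ C) :
    IsCGF P (fun x ω => -φ x ω) C := by
  refine ⟨fun x => (h.1 x).neg, fun s a => ?_⟩
  have := h.2 s (fun x => -a x)
  simpa using this

lemma IsCGF.comp {P : Measure Ω} {φ : V d → Ω → ℝ} {C : V d → V d → ℝ} (h : IsCGF P φ C)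
    {σ : V d → V d} (hσ : Function.Injective σ) (hC : ∀ x y, C (σ x) (σ y) = C x y) :
    IsCGF P (fun x ω => φ (σ x) ω) C := by
  refine ⟨fun x => h.1 _, fun s a => ?_⟩
  have := h.2 (s.image σ) (fun y => a (Function.invFun σ y))
  rw [Finset.sum_image hσ.injOn] at this
  simp only [Finset.sum_image hσ.injOn, Function.leftInverse_invFun hσ _, hC] at this
  exact this

lemma IsCGF.map_single {P : Measure Ω} {φ : V d → Ω → ℝ} {C : V d → V d → ℝ} (h : IsCGF P φ C)
    (x : V d) : P.map (φ x) = gaussianReal 0 (Real.toNNReal (C x x)) := by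
  have := h.2 {x} (fun _ => 1)
  simpa using this

lemma covTrunc_sym {σ : V d → V d} (hσ : LatSym σ) (L : ℕ) (x y : V d) :
    covTrunc d L (σ x) (σ y) = covTrunc d L x y := by
  unfold covTrunc; simp only [hσ.lazyP]

end Laws

section ProductLaws

lemma measurable_psi_pi (n : ℕ) : Measurable fun w : Ix d → ℝ => psi n w :=
  measurable_pi_iff.2 fun x => measurable_psi n x

lemma psi_law_sym (hd : 0 < d) (n : ℕ) {σ : V d → V d} (hσ : LatSym σ) :
    (mu0 d).map (fun w x => psi n w (σ x)) = (mu0 d).map (psi n) :=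
  ((psi_isCGF hd n).comp hσ.inj (covTrunc_sym hσ _)).law_unique (psi_isCGF hd n)

lemma iIndepFun_coord : iIndepFun (fun (i : Ix d) (w : Ix d → ℝ) => w i) (mu0 d) :=
  iIndepFun_infinitePi (P := nu d) (X := fun _ x => x) fun _ => measurable_id

lemma isIIDUnif_coord : IsIIDUnif (mu0 d) (fun x w => w (Sum.inr x)) := by
  refine ⟨fun x => by fun_prop, fun x => ?_, ?_⟩
  · exact Measure.infinitePi_map_eval (nu d) (Sum.inr x)
  · exact iIndepFun_coord.precomp Sum.inr_injective

lemma indep_noise_source :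
    IndepFun (fun (w : Ix d → ℝ) (x : V d) => w (Sum.inr x))
      (fun (w : Ix d → ℝ) (s : Src d) => w (Sum.inl s)) (mu0 d) := by
  refine IndepFun.process_indepFun_process (X := fun (x : V d) (w : Ix d → ℝ) => w (Sum.inr x))
    (Y := fun (s : Src d) (w : Ix d → ℝ) => w (Sum.inl s)) (fun x => by fun_prop)
    (fun s => by fun_prop) fun I J => ?_
  have h := iIndepFun_coord (d := d).indepFun_finset (I.map ⟨Sum.inr, Sum.inr_injective⟩)
    (J.map ⟨Sum.inl, Sum.inl_injective⟩) (by
      rw [Finset.disjoint_left]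
      intro i hi hj
      obtain ⟨x, -, rfl⟩ := Finset.mem_map.1 hi
      obtain ⟨s, -, hs⟩ := Finset.mem_map.1 hj
      simp at hs) (fun i => by fun_prop)
  exact h.comp (φ := fun f (x : I) => f ⟨Sum.inr x, Finset.mem_map_of_mem _ x.2⟩)
    (ψ := fun f (s : J) => f ⟨Sum.inl s, Finset.mem_map_of_mem _ s.2⟩)
    (by fun_prop) (by fun_prop)

lemma indep_noise_psi (n : ℕ) :
    IndepFun (fun (w : Ix d → ℝ) (x : V d) => w (Sum.inr x)) (psi n) (mu0 d) := by
  exact indep_noise_source.comp (φ := id)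
    (ψ := fun f x => ∑ s ∈ srcs (Finset.range (2 ^ n)) x (2 ^ n), ker x s * f s)
    measurable_id (by fun_prop)

variable {Ω : Type*} [MeasurableSpace Ω] {P : Measure Ω} [IsProbabilityMeasure P]

lemma joint_law (hd : 0 < d) {n : ℕ} {φ U : V d → Ω → ℝ}
    (hφ : IsCGF P φ (covTrunc d (2 ^ (n + 1) - 1))) (hU : IsIIDUnif P U)
    (hind : IndepFun (proc U) (proc φ) P) :
    P.map (fun ω => (proc U ω, proc φ ω)) =
      (mu0 d).map (fun w => ((fun x => w (Sum.inr x)), psi n w)) := by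
  have mU := measurable_proc hU.1
  have mφ := measurable_proc hφ.1
  have h0 := isIIDUnif_coord (d := d)
  rw [(indepFun_iff_map_prod_eq_prod_map_map mU.aemeasurable mφ.aemeasurable).1 hind,
    (indepFun_iff_map_prod_eq_prod_map_map
      (measurable_pi_iff.2 fun x => measurable_pi_apply (Sum.inr x)).aemeasurable
      (measurable_psi_pi n).aemeasurable).1 (indep_noise_psi n)]
  have e1 : P.map (proc φ) = (mu0 d).map (psi n) := hφ.law_unique (psi_isCGF hd n)
  have e2 : P.map (proc U) = (mu0 d).map (fun w x => w (Sum.inr x)) := by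
    rw [show proc U = fun ω x => U x ω from rfl, hU.2.2.map_fun_eq_infinitePi_map hU.1,
      h0.2.2.map_fun_eq_infinitePi_map h0.1]
    simp only [hU.2.1, h0.2.1]
  rw [e1, e2]

end ProductLaws

section SetEvents

/-- An increasing, measurable property of sets of sites. -/
structure IncEv (T : Set (V d) → Prop) : Prop where
  mono : ∀ ⦃S S' : Set (V d)⦄, S ⊆ S' → T S → T S'
  meas : MeasurableSet {S : Set (V d) | T S}

/-- The property is determined by the sites in a finite set. -/
def LocalTo (T : Set (V d) → Prop) (W : Finset (V d)) : Prop := ∀ S, T S → T (S ∩ W)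

lemma IncEv.local_mono {T : Set (V d) → Prop} (hT : IncEv T) {W : Finset (V d)}
    (hW : LocalTo T W) {S S' : Set (V d)} (h : ∀ x ∈ W, x ∈ S → x ∈ S') (hS : T S) : T S' :=
  hT.mono (fun x hx => h x hx.2 hx.1) (hW S hS)

lemma IncEv.measurableSet {Ω : Type*} [MeasurableSpace Ω] {T : Set (V d) → Prop} (hT : IncEv T)
    {S : Ω → Set (V d)} (hS : ∀ x, MeasurableSet {ω | x ∈ S ω}) :
    MeasurableSet {ω | T (S ω)} := by
  have : Measurable S := measurable_set_iff.2 fun x => measurable_mem.2 (hS x)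
  exact this hT.meas

variable {Ω : Type*} [MeasurableSpace Ω] {P : Measure Ω} [IsProbabilityMeasure P]

/-- Replacing a field by another one whose difference is a Gaussian field of small variance. -/
lemma compare_fields {T : Set (V d) → Prop} (hT : IncEv T) {W : Finset (V d)}
    (hW : LocalTo T W) {X Y : V d → Ω → ℝ} {C : V d → V d → ℝ}
    (hC : IsCGF P (fun x ω => X x ω - Y x ω) C) {σ : ℝ} (hσ : 0 < σ) (hCσ : ∀ x, C x x ≤ σ)
    (h : ℝ) {η : ℝ} (hη : 0 ≤ η) :
    P.real {ω | T (lvl X (h + η) ω)} ≤ P.real {ω | T (lvl Y h ω)} +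
      W.card * Real.exp (-(η ^ 2 / (2 * σ))) := by
  have h1 : {ω | T (lvl X (h + η) ω)} ⊆ {ω | T (lvl Y h ω)} ∪
      ⋃ x ∈ W, {ω | η ≤ X x ω - Y x ω} := by
    intro ω hω
    by_cases hc : ∃ x ∈ W, η ≤ X x ω - Y x ω
    · right
      simpa using hc
    · left
      push Not at hc
      refine hT.local_mono hW (fun x hx hS => ?_) hω
      have := hc x hx
      simp only [lvl, mem_ofPred_eq] at hS ⊢
      linarith
  have h2 : ∀ x ∈ W, P.real {ω | η ≤ X x ω - Y x ω} ≤ Real.exp (-(η ^ 2 / (2 * σ))) := by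
    intro x _
    have e := hC.map_single x
    have : P.real {ω | η ≤ X x ω - Y x ω} =
        (gaussianReal 0 (Real.toNNReal (C x x))).real (Ici η) := by
      rw [← e, map_measureReal_apply (hC.1 x) measurableSet_Ici]; rfl
    rw [this]
    refine gauss_tail _ ?_ hσ hη
    rw [Real.coe_toNNReal']
    exact max_le (hCσ x) hσ.le
  calc P.real {ω | T (lvl X (h + η) ω)}
      ≤ P.real ({ω | T (lvl Y h ω)} ∪ ⋃ x ∈ W, {ω | η ≤ X x ω - Y x ω}) :=
        measureReal_mono h1
    _ ≤ P.real {ω | T (lvl Y h ω)} + P.real (⋃ x ∈ W, {ω | η ≤ X x ω - Y x ω}) :=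
        measureReal_union_le _ _
    _ ≤ _ := by
        gcongr
        refine (measureReal_biUnion_finset_le _ _).trans ((Finset.sum_le_sum h2).trans ?_)
        simp

/-- The probability that the level set of `psi n` has property `T`. -/
def pr (n : ℕ) (T : Set (V d) → Prop) (h : ℝ) : ℝ :=
  (mu0 d).real {w | T {x | h ≤ psi n w x}}

lemma pr_nonneg (n : ℕ) (T : Set (V d) → Prop) (h : ℝ) : 0 ≤ pr n T h := measureReal_nonneg

lemma pr_anti (n : ℕ) {T : Set (V d) → Prop} (hT : IncEv T) {h h' : ℝ} (hh : h ≤ h') :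
    pr n T h' ≤ pr n T h :=
  measureReal_mono fun _ hw => hT.mono (fun _ hx => hh.trans hx) hw

lemma pr_mono (n : ℕ) {T T' : Set (V d) → Prop} (hTT : ∀ S, T S → T' S) (h : ℝ) :
    pr n T h ≤ pr n T' h :=
  measureReal_mono fun _ hw => hTT _ hw

lemma measurableSet_field {Ω : Type*} [MeasurableSpace Ω] {T : Set (V d) → Prop} (hT : IncEv T)
    {K : Ω → V d → ℝ} (hK : ∀ x, Measurable fun ω => K ω x) (h : ℝ) :
    MeasurableSet {ω | T {x | h ≤ K ω x}} :=
  hT.measurableSet fun x => measurableSet_le measurable_const (hK x)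

lemma law_real_eq {Ω Ω' : Type*} [MeasurableSpace Ω] [MeasurableSpace Ω'] {P : Measure Ω}
    {Q : Measure Ω'} {X : Ω → V d → ℝ} {Y : Ω' → V d → ℝ} (mX : Measurable X)
    (mY : Measurable Y) (h : P.map X = Q.map Y) {T : Set (V d) → Prop} (hT : IncEv T) (a : ℝ) :
    P.real {ω | T {x | a ≤ X ω x}} = Q.real {ω | T {x | a ≤ Y ω x}} := by
  have hm : MeasurableSet {f : V d → ℝ | T {x | a ≤ f x}} :=
    measurableSet_field hT (K := fun f : V d → ℝ => f) (fun x => measurable_pi_apply x) a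
  have h1 := map_measureReal_apply (μ := P) mX hm
  have h2 := map_measureReal_apply (μ := Q) mY hm
  rw [h] at h1
  exact h1.symm.trans h2

lemma pr_sym (hd : 0 < d) (n : ℕ) {σ : V d → V d} (hσ : LatSym σ) {T : Set (V d) → Prop}
    (hT : IncEv T) (h : ℝ) :
    (mu0 d).real {w | T {x | h ≤ psi n w (σ x)}} = pr n T h :=
  law_real_eq (measurable_pi_iff.2 fun x => measurable_psi n (σ x)) (measurable_psi_pi n)
    (psi_law_sym hd n hσ) hT h

/-- The hypothesis on the limiting field: at every dyadic scale it splits into a truncated field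
and a tail field. -/
def Splits (P : Measure Ω) (φ : V d → Ω → ℝ) : Prop :=
  ∀ n : ℕ, ∃ φL : V d → Ω → ℝ, IsCGF P φL (covTrunc d (2 ^ (n + 1) - 1)) ∧
    IsCGF P (fun x ω => φ x ω - φL x ω) (covTail d (2 ^ (n + 1) - 1))

/-- Comparison of the full field with the truncated one, in both directions. -/
lemma transfer (hd : 3 ≤ d) : ∃ c : ℝ, 0 < c ∧ ∀ {φ : V d → Ω → ℝ}, Splits P φ →
    ∀ {T : Set (V d) → Prop}, IncEv T → ∀ {W : Finset (V d)}, LocalTo T W →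
    ∀ (n : ℕ) (h : ℝ) {η : ℝ}, 0 ≤ η →
    P.real {ω | T (lvl φ (h + η) ω)} ≤ pr n T h +
      W.card * Real.exp (-(c * η ^ 2 * Real.sqrt (2 ^ n))) ∧
    pr n T (h + η) ≤ P.real {ω | T (lvl φ h ω)} +
      W.card * Real.exp (-(c * η ^ 2 * Real.sqrt (2 ^ n))) := by
  obtain ⟨C, hC, -, hv⟩ := variance_bounds hd
  refine ⟨1 / (2 * C), by positivity, fun {φ} hs {T} hT {W} hW n h {η} hη => ?_⟩
  obtain ⟨φL, h1, h2⟩ := hs n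
  have hd0 : 0 < d := by omega
  have e : ∀ a, P.real {ω | T (lvl φL a ω)} = pr n T a := fun a =>
    law_real_eq (measurable_proc h1.1) (measurable_psi_pi n)
      (h1.law_unique (psi_isCGF hd0 n)) hT a
  have hs' : 0 < Real.sqrt (2 ^ n) := by positivity
  have e2 : 1 / (2 * C) * η ^ 2 * Real.sqrt (2 ^ n) =
      η ^ 2 / (2 * (C / Real.sqrt (2 ^ n))) := by field_simp
  rw [← e, ← e, e2]
  refine ⟨compare_fields hT hW h2 (by positivity) (hv n) h hη,
    compare_fields hT hW (X := φL) (Y := φ) (C := covTail d (2 ^ (n + 1) - 1)) ?_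
      (by positivity) (hv n) h hη⟩
  have := h2.neg
  simpa using this

end SetEvents

end FieldLaws

section LevelSetEvents

variable {d : ℕ}

section SetEventsBasic

lemma IncEv.of_finite {T : Set (V d) → Prop} (mono : ∀ ⦃S S' : Set (V d)⦄, S ⊆ S' → T S → T S')
    (fin : ∀ S, T S → ∃ F : Finset (V d), (F : Set (V d)) ⊆ S ∧ T F) : IncEv T := by
  refine ⟨mono, ?_⟩
  have : {S : Set (V d) | T S} =
      ⋃ F ∈ {F : Finset (V d) | T F}, ⋂ x ∈ F, {S : Set (V d) | x ∈ S} := by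
    ext S
    simp only [mem_ofPred_eq, mem_iUnion, mem_iInter, exists_prop]
    constructor
    · intro h
      obtain ⟨F, hF, hT⟩ := fin S h
      exact ⟨F, hT, fun x hx => hF hx⟩
    · rintro ⟨F, hT, hF⟩
      exact mono (fun x hx => hF x hx) hT
  rw [this]
  refine MeasurableSet.biUnion (to_countable _) fun F _ =>
    Finset.measurableSet_biInter F fun x _ => ?_
  exact measurableSet_setOfPred.2 (measurable_set_mem x)

lemma IncEv.and {T T' : Set (V d) → Prop} (h : IncEv T) (h' : IncEv T') :
    IncEv fun S => T S ∧ T' S :=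
  ⟨fun _ _ hS hT => ⟨h.mono hS hT.1, h'.mono hS hT.2⟩, h.meas.inter h'.meas⟩

lemma IncEv.or {T T' : Set (V d) → Prop} (h : IncEv T) (h' : IncEv T') :
    IncEv fun S => T S ∨ T' S :=
  ⟨fun _ _ hS hT => hT.imp (h.mono hS) (h'.mono hS), h.meas.union h'.meas⟩

lemma IncEv.union {T : Set (V d) → Prop} (h : IncEv T) (A : Set (V d)) :
    IncEv fun S => T (S ∪ A) := by
  refine ⟨fun _ _ hS hT => h.mono (union_subset_union_left A hS) hT, ?_⟩
  exact h.measurableSet (S := fun S : Set (V d) => S ∪ A) fun x =>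
    (measurableSet_setOfPred.2 (measurable_set_mem x)).union (MeasurableSet.const _)

lemma IncEv.dual {T : Set (V d) → Prop} (h : IncEv T) : IncEv fun S => ¬ T Sᶜ := by
  refine ⟨fun _ _ hS hT hT' => hT (h.mono (compl_subset_compl.2 hS) hT'), ?_⟩
  exact (h.measurableSet (S := fun S : Set (V d) => Sᶜ) fun x =>
    (measurableSet_setOfPred.2 (measurable_set_mem x)).compl).compl

lemma LocalTo.mono {T : Set (V d) → Prop} (hm : ∀ ⦃S S' : Set (V d)⦄, S ⊆ S' → T S → T S')
    {W W' : Finset (V d)} (h : LocalTo T W) (hW : W ⊆ W') : LocalTo T W' :=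
  fun S hS => hm (inter_subset_inter_right S (by exact_mod_cast hW)) (h S hS)

lemma LocalTo.dual {T : Set (V d) → Prop}
    (hm : ∀ ⦃S S' : Set (V d)⦄, S ⊆ S' → T S → T S') {W : Finset (V d)} (h : LocalTo T W) :
    LocalTo (fun S => ¬ T Sᶜ) W := by
  intro S hS hT
  refine hS (hm ?_ (h _ hT))
  intro x hx hxS
  exact hx.1 ⟨hxS, hx.2⟩

end SetEventsBasic

section Indicators

/-- The indicator function of the event that the random set `S` has the property `T`. -/
def chi {α : Type*} (T : Set (V d) → Prop) (S : α → Set (V d)) : α → ℝ :=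
  {w | T (S w)}.indicator fun _ => (1 : ℝ)

lemma chi_pos {α : Type*} {T : Set (V d) → Prop} {S : α → Set (V d)} {w : α} (h : T (S w)) :
    chi T S w = 1 := by simp [chi, h]

lemma chi_neg {α : Type*} {T : Set (V d) → Prop} {S : α → Set (V d)} {w : α} (h : ¬ T (S w)) :
    chi T S w = 0 := by simp [chi, h]

lemma chi_cases {α : Type*} (T : Set (V d) → Prop) (S : α → Set (V d)) (w : α) :
    chi T S w = 0 ∨ chi T S w = 1 := by
  by_cases h : T (S w)
  · exact Or.inr (chi_pos h)
  · exact Or.inl (chi_neg h)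

lemma chi_le_chi {α β : Type*} {T T' : Set (V d) → Prop} {S : α → Set (V d)} {S' : β → Set (V d)}
    {w : α} {w' : β} (h : T (S w) → T' (S' w')) : chi T S w ≤ chi T' S' w' := by
  by_cases h1 : T (S w)
  · rw [chi_pos h1, chi_pos (h h1)]
  · rw [chi_neg h1]
    rcases chi_cases T' S' w' with h | h <;> rw [h]; norm_num

/-- A random set of sites, measurable at each site. -/
def RSet {α : Type*} [MeasurableSpace α] (S : α → Set (V d)) : Prop :=
  ∀ x, MeasurableSet {w | x ∈ S w}

lemma IncEv.chi_unit {α : Type*} [MeasurableSpace α] {T : Set (V d) → Prop} (hT : IncEv T)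
    {S : α → Set (V d)} (hS : RSet S) : IsUnitFn (chi T S) :=
  IsUnitFn.indicator (hT.measurableSet hS)

lemma IncEv.integral_chi {α : Type*} [MeasurableSpace α] {T : Set (V d) → Prop} (hT : IncEv T)
    {S : α → Set (V d)} (hS : RSet S) (μ : Measure α) :
    ∫ w, chi T S w ∂μ = μ.real {w | T (S w)} := by
  unfold chi
  exact integral_indicator_one (hT.measurableSet hS)

/-- The random set grows with each coordinate. -/
def RMono (S : (Ix d → ℝ) → Set (V d)) : Prop := ∀ ⦃w w'⦄, w ≤ w' → S w ⊆ S w'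

lemma IncEv.chi_mono {T : Set (V d) → Prop} (hT : IncEv T) {S : (Ix d → ℝ) → Set (V d)}
    (hS : RMono S) : Monotone (chi T S) :=
  fun _ _ hw => chi_le_chi (hT.mono (hS hw))

lemma sum_condVar_le_add {T : Set (V d) → Prop} (hT : IncEv T) {S S' : (Ix d → ℝ) → Set (V d)}
    (hS : RSet S) (mS : RMono S) {τ : ℝ} (hτ : 0 < τ) (hτ1 : τ ≤ 1)
    (N : Finset (Src d))
    (hsh : ∀ i ∈ N, ∀ w,
      S (Function.update w (Sum.inl i) (w (Sum.inl i) + τ)) ⊆ S' w) :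
    ∑ i ∈ N.map ⟨Sum.inl, Sum.inl_injective⟩, condVar (nu d) i (chi T S) ≤
      N.card * (gaussC / τ) * ((mu0 d).real {w | T (S' w)} - (mu0 d).real {w | T (S w)}) := by
  rw [Finset.sum_map, mul_assoc, ← nsmul_eq_mul]
  refine Finset.sum_le_card_nsmul _ _ _ fun i hi => ?_
  have h := condVar_le_shift_add (hT.chi_unit hS) (hT.chi_mono mS) (chi_cases T S)
    (ν := nu d) (Sum.inl i) rfl hτ hτ1
  have e1 : ∫ w, chi T S w ∂(Measure.infinitePi (nu d)) = (mu0 d).real {w | T (S w)} :=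
    hT.integral_chi hS (mu0 d)
  have e2 : ∫ w, chi T S (Function.update w (Sum.inl i) (w (Sum.inl i) + τ))
      ∂(Measure.infinitePi (nu d)) ≤ (mu0 d).real {w | T (S' w)} := by
    have m := measurable_shift (ι := Ix d) (Sum.inl i) τ
    have hS2 : RSet fun w => S (Function.update w (Sum.inl i) (w (Sum.inl i) + τ)) :=
      fun x => m (hS x)
    have := hT.integral_chi hS2 (mu0 d)
    refine le_of_eq_of_le this (measureReal_mono fun w hw => ?_)
    exact hT.mono (hsh i hi w) hw
  rw [e1] at h
  change condVar (nu d) (Sum.inl i) (chi T S) ≤ _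
  rw [div_mul_eq_mul_div, le_div_iff₀ hτ, mul_comm]
  exact h.trans (mul_le_mul_of_nonneg_left (by linarith) gaussC_pos.le)

lemma sum_condVar_le_sub {T : Set (V d) → Prop} (hT : IncEv T) {S S' : (Ix d → ℝ) → Set (V d)}
    (hS : RSet S) (mS : RMono S) {τ : ℝ} (hτ : 0 < τ) (hτ1 : τ ≤ 1)
    (N : Finset (Src d))
    (hsh : ∀ i ∈ N, ∀ w,
      S' w ⊆ S (Function.update w (Sum.inl i) (w (Sum.inl i) - τ))) :
    ∑ i ∈ N.map ⟨Sum.inl, Sum.inl_injective⟩, condVar (nu d) i (chi T S) ≤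
      N.card * (gaussC / τ) * ((mu0 d).real {w | T (S w)} - (mu0 d).real {w | T (S' w)}) := by
  rw [Finset.sum_map, mul_assoc, ← nsmul_eq_mul]
  refine Finset.sum_le_card_nsmul _ _ _ fun i hi => ?_
  have h := condVar_le_shift_sub (hT.chi_unit hS) (hT.chi_mono mS) (chi_cases T S)
    (ν := nu d) (Sum.inl i) rfl hτ hτ1
  have e1 : ∫ w, chi T S w ∂(Measure.infinitePi (nu d)) = (mu0 d).real {w | T (S w)} :=
    hT.integral_chi hS (mu0 d)
  have e2 : (mu0 d).real {w | T (S' w)} ≤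
      ∫ w, chi T S (Function.update w (Sum.inl i) (w (Sum.inl i) - τ))
      ∂(Measure.infinitePi (nu d)) := by
    have m := measurable_shift (ι := Ix d) (Sum.inl i) (-τ)
    simp only [← sub_eq_add_neg] at m
    have hS2 : RSet fun w => S (Function.update w (Sum.inl i) (w (Sum.inl i) - τ)) :=
      fun x => m (hS x)
    have := hT.integral_chi hS2 (mu0 d)
    refine le_of_le_of_eq (measureReal_mono fun w hw => ?_) this.symm
    exact hT.mono (hsh i hi w) hw
  rw [e1] at h
  change condVar (nu d) (Sum.inl i) (chi T S) ≤ _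
  rw [div_mul_eq_mul_div, le_div_iff₀ hτ, mul_comm]
  exact h.trans (mul_le_mul_of_nonneg_left (by linarith) gaussC_pos.le)

end Indicators

end LevelSetEvents

section SingleScale

variable {d : ℕ}

section FieldBasics

lemma card_cube (x : V d) (k : ℕ) : (cube x k).card = (2 * k + 1) ^ d := by
  rw [cube, Fintype.card_piFinset]
  have : ∀ i : Fin d, (Finset.Icc (x i - (k : ℤ)) (x i + k)).card = 2 * k + 1 := by
    intro i
    rw [Int.card_Icc]
    omega
  simp [this]

lemma cube_subset_cube {x y : V d} {k l : ℕ} (h : y ∈ cube x l) : cube y k ⊆ cube x (l + k) := by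
  intro z hz
  rw [mem_cube] at *
  intro i
  have h1 := h i
  have h2 := hz i
  have := abs_sub_le (x i) (y i) (z i)
  push_cast
  linarith

lemma mem_cube_comm {x y : V d} {k : ℕ} : y ∈ cube x k ↔ x ∈ cube y k := by
  simp only [mem_cube, abs_sub_comm]

lemma cube_mono {x : V d} {k l : ℕ} (h : k ≤ l) : cube x k ⊆ cube x l := by
  intro z hz
  rw [mem_cube] at *
  intro i
  have := hz i
  have h' : (k : ℤ) ≤ l := by exact_mod_cast h
  linarith

/-- The base corner of the block `v` at scale `n`. -/
def ctr (n : ℕ) (v : V d) : V d := fun i => 2 ^ n * v i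

/-- The sites which feel the block `v` at scale `n`. -/
def lam (n : ℕ) (v : V d) : Finset (V d) :=
  (cube (ctr n v) (3 * 2 ^ n)).filter fun x => v ∈ near n x

lemma mem_lam {n : ℕ} {v x : V d} : x ∈ lam n v ↔ v ∈ near n x := by
  rw [lam, Finset.mem_filter, and_iff_right_iff_imp]
  intro h
  rw [near, mem_cube] at h
  rw [mem_cube]
  intro i
  have h1 := h i
  simp only [blk, ctr] at *
  have h2 := Int.emod_add_mul_ediv (x i) (2 ^ n)
  have h3 := Int.emod_nonneg (x i) (b := 2 ^ n) (by positivity)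
  have h4 := Int.emod_lt_of_pos (x i) (b := 2 ^ n) (by positivity)
  rw [abs_le] at *
  push_cast at *
  have hp : (0 : ℤ) < 2 ^ n := by positivity
  constructor <;> nlinarith

lemma lam_subset (n : ℕ) (v : V d) : lam n v ⊆ cube (ctr n v) (3 * 2 ^ n) :=
  Finset.filter_subset _ _

lemma card_lam (n : ℕ) (v : V d) : (lam n v).card ≤ (6 * 2 ^ n + 1) ^ d := by
  refine (Finset.card_le_card (lam_subset n v)).trans (le_of_eq ?_)
  rw [card_cube]; ring_nf

lemma lin_mono (T : Finset (Src d)) (x : V d) : Monotone fun w => lin T w x :=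
  fun _ _ h => Finset.sum_le_sum fun s _ => mul_le_mul_of_nonneg_left (h _) (ker_nonneg x s)

lemma psi_mono (n : ℕ) (x : V d) : Monotone fun w => psi n w x := lin_mono _ x

lemma xi_mono (n : ℕ) (v x : V d) : Monotone fun w => xi n v w x := lin_mono _ x

lemma lin_congr {T : Finset (Src d)} {w w' : Ix d → ℝ}
    (h : ∀ s ∈ T, w (Sum.inl s) = w' (Sum.inl s)) (x : V d) : lin T w x = lin T w' x :=
  Finset.sum_congr rfl fun s hs => by rw [h s hs]

lemma lin_update (T : Finset (Src d)) (w : Ix d → ℝ) (i : Src d) (a : ℝ) (x : V d) :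
    lin T (Function.update w (Sum.inl i) a) x =
      lin T w x + if i ∈ T then ker x i * (a - w (Sum.inl i)) else 0 := by
  unfold lin
  rw [← sub_eq_iff_eq_add', ← Finset.sum_sub_distrib]
  have : ∀ s ∈ T, ker x s * Function.update w (Sum.inl i) a (Sum.inl s) -
      ker x s * w (Sum.inl s) = if i = s then ker x i * (a - w (Sum.inl i)) else 0 := by
    intro s _
    by_cases h : i = s
    · subst h; simp; ring
    · have : (Sum.inl s : Ix d) ≠ Sum.inl i := by simpa using Ne.symm h
      simp [Function.update_of_ne this, h]
  rw [Finset.sum_congr rfl this, Finset.sum_ite_eq]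

lemma psi_update_le (n : ℕ) (w : Ix d → ℝ) (i : Src d) {t : ℝ} (ht : 0 ≤ t) (x : V d) :
    psi n (Function.update w (Sum.inl i) (w (Sum.inl i) + t)) x ≤
      psi n w x + if x ∈ cube i.2.1 (2 ^ n) then t else 0 := by
  unfold psi
  rw [lin_update]
  gcongr
  rw [add_sub_cancel_left]
  by_cases h : i ∈ srcs (Finset.range (2 ^ n)) x (2 ^ n)
  · rw [if_pos h, if_pos (mem_cube_comm.1 (mem_srcs.1 h).2)]
    exact mul_le_of_le_one_left ht (ker_le_one x i)
  · rw [if_neg h]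
    split_ifs <;> linarith

lemma le_psi_update (n : ℕ) (w : Ix d → ℝ) (i : Src d) {t : ℝ} (ht : 0 ≤ t) (x : V d) :
    psi n w x - (if x ∈ cube i.2.1 (2 ^ n) then t else 0) ≤
      psi n (Function.update w (Sum.inl i) (w (Sum.inl i) - t)) x := by
  have := psi_update_le n (Function.update w (Sum.inl i) (w (Sum.inl i) - t)) i ht x
  simp only [Function.update_self, Function.update_idem, sub_add_cancel,
    Function.update_eq_self] at this
  linarith

lemma xi_update (n : ℕ) (v : V d) (w : Ix d → ℝ) (i : Src d) (hi : i.1 < 2 ^ n) (a : ℝ)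
    (x : V d) : xi n v (Function.update w (Sum.inl i) a) x = xi n v w x := by
  unfold xi
  rw [lin_update, if_neg, add_zero]
  intro h
  have := (mem_srcs.1 (Finset.mem_filter.1 h).1).1
  rw [Finset.mem_Ico] at this
  omega

/-- The sources which the field at scale `n` uses in the cube of radius `D` around `y`. -/
def locSrc (n : ℕ) (y : V d) (D : ℕ) : Finset (Src d) :=
  srcs (Finset.range (2 ^ n)) y (D + 2 ^ n)

lemma card_locSrc (n : ℕ) (y : V d) (D : ℕ) :
    (locSrc n y D).card = 2 ^ n * ((2 * (D + 2 ^ n) + 1) ^ d * (d + 1)) := by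
  simp [locSrc, srcs, Finset.card_product, card_cube]

lemma psi_eq_of_locSrc {n : ℕ} {y x : V d} {D : ℕ} (hx : x ∈ cube y D) {w w' : Ix d → ℝ}
    (h : ∀ s ∈ locSrc n y D, w (Sum.inl s) = w' (Sum.inl s)) : psi n w x = psi n w' x := by
  refine lin_congr (fun s hs => h s ?_) x
  rw [locSrc, mem_srcs]
  exact ⟨(mem_srcs.1 hs).1, cube_subset_cube hx (mem_srcs.1 hs).2⟩

lemma chi_psi_dep {n : ℕ} {y : V d} {D : ℕ} {F : Set (V d) → Prop} (hF : IncEv F)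
    (hl : LocalTo F (cube y D)) (h : ℝ) :
    DepOn (chi F fun w => {x | h ≤ psi n w x})
      ((locSrc n y D).map ⟨Sum.inl, Sum.inl_injective⟩ : Finset (Ix d)) := by
  intro w w' hw
  have key : ∀ x ∈ cube y D, psi n w x = psi n w' x := fun x hx =>
    psi_eq_of_locSrc hx fun s hs => hw _ (Finset.mem_coe.2 (Finset.mem_map_of_mem _ hs))
  refine le_antisymm (chi_le_chi (hF.local_mono hl fun x hx h1 => ?_))
    (chi_le_chi (hF.local_mono hl fun x hx h1 => ?_))
  · simpa [key x hx] using h1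
  · simpa [key x hx] using h1

lemma rset_psi (n : ℕ) (h : ℝ) : RSet fun w : Ix d → ℝ => {x | h ≤ psi n w x} :=
  fun x => measurableSet_le measurable_const (measurable_psi n x)

lemma rmono_psi (n : ℕ) (h : ℝ) : RMono fun w : Ix d → ℝ => {x | h ≤ psi n w x} :=
  fun _ _ hw x hx => le_trans (show h ≤ _ from hx) (psi_mono n x hw)

end FieldBasics

section ScaleStep

/-- The effect of opening all sites of `lam n v` on the event `T` can be absorbed by a local
perturbation. -/
def Absorb (n : ℕ) (T : Set (V d) → Prop) (v : V d) (D J : ℕ) (κ h : ℝ) : Prop :=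
  ∃ (I : Finset (V d × V d)) (g F : V d × V d → Set (V d) → Prop), I.card ≤ J ∧
    (∀ j ∈ I, IncEv (g j) ∧ IncEv (F j) ∧ LocalTo (F j) (cube (ctr n v) D) ∧
      κ ≤ pr n (F j) h ∧ ∀ S, g j S → F j S → T S) ∧
    ∀ S, T (S ∪ lam n v) → T S ∨ ∃ j ∈ I, g j S

/-- The part of the increment at scale `n` which comes from the blocks other than `v`, with the
blocks in `A` replaced by the constant `e` and a small bump. -/
def baseF (n : ℕ) (e τ : ℝ) (ρ : ℕ) (A : Finset (V d)) (B : V d → Finset (V d))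
    (w : Ix d → ℝ) (x : V d) : ℝ :=
  psi n w x + ∑ u ∈ B x, (if u ∈ A then e else max (xi n u w x) (-e)) +
    τ * ((A.filter fun u => x ∈ cube (ctr n u) ρ).card : ℝ)

variable {n : ℕ} {e τ : ℝ} {ρ : ℕ} {A : Finset (V d)} {B : V d → Finset (V d)}

lemma measurable_baseF (x : V d) : Measurable fun w => baseF n e τ ρ A B w x := by
  unfold baseF
  refine ((measurable_psi n x).add (Finset.measurable_sum _ fun u _ => ?_)).add_const _
  split_ifs
  · exact measurable_const
  · exact (measurable_lin _ x).max measurable_const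

lemma baseF_mono (x : V d) : Monotone fun w => baseF n e τ ρ A B w x := by
  intro w w' h
  unfold baseF
  have h1 := psi_mono n x h
  have h2 : ∀ u ∈ B x, (if u ∈ A then e else max (xi n u w x) (-e)) ≤
      (if u ∈ A then e else max (xi n u w' x) (-e)) := by
    intro u _
    split_ifs
    · exact le_rfl
    · exact max_le_max (xi_mono n u x h) le_rfl
  have h3 := Finset.sum_le_sum h2
  simp only at h1
  linarith

lemma baseF_dep {v x : V d} (hv : v ∉ B x) {w w' : Ix d → ℝ}
    (hw : ∀ s : Src d, (s.1 < 2 ^ n ∨ blk n s.2.1 ≠ v) → w (Sum.inl s) = w' (Sum.inl s)) :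
    baseF n e τ ρ A B w x = baseF n e τ ρ A B w' x := by
  unfold baseF
  congr 2
  · refine lin_congr (fun s hs => hw s (Or.inl ?_)) x
    exact Finset.mem_range.1 (mem_srcs.1 hs).1
  · refine Finset.sum_congr rfl fun u hu => ?_
    congr 2
    refine lin_congr (fun s hs => hw s (Or.inr ?_)) x
    rintro rfl
    rw [(Finset.mem_filter.1 hs).2] at hv
    exact hv hu

lemma psi_sub_le_baseF (he : 0 ≤ e) (hτ : 0 ≤ τ) (w : Ix d → ℝ) (x : V d) :
    psi n w x - (B x).card * e ≤ baseF n e τ ρ A B w x := by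
  unfold baseF
  have h2 : ∀ u ∈ B x, -e ≤ (if u ∈ A then e else max (xi n u w x) (-e)) := by
    intro u _
    split_ifs
    · linarith
    · exact le_max_right _ _
  have h3 := Finset.card_nsmul_le_sum _ _ _ h2
  rw [nsmul_eq_mul] at h3
  have : 0 ≤ τ * ((A.filter fun u => x ∈ cube (ctr n u) ρ).card : ℝ) := by positivity
  linarith

lemma baseF_update (hτ : 0 ≤ τ) (w : Ix d → ℝ) (i : Src d) (hi : i.1 < 2 ^ n) (x : V d) :
    baseF n e τ ρ A B (Function.update w (Sum.inl i) (w (Sum.inl i) + τ)) x ≤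
      baseF n e τ ρ A B w x + if x ∈ cube i.2.1 (2 ^ n) then τ else 0 := by
  unfold baseF
  simp only [xi_update n _ w i hi]
  have := psi_update_le n w i hτ x
  linarith

/-- One block is replaced by a constant. -/
lemma step_single {T : Set (V d) → Prop} (hT : IncEv T) {σ : ℝ} (hσ : 0 < σ)
    (hvar : ∀ v x : V d, ∑ t ∈ blkSrc n v x, ker x t ^ 2 ≤ σ) (he : 0 < e) (hτ : 0 < τ)
    (hτ1 : τ ≤ 1) {D : ℕ} (hρ : ρ = D + 2 ^ n + 2 ^ n) (h : ℝ) {v : V d} (hv : v ∉ A)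
    {q : ℝ} (hq : (lam n v).card * Real.exp (-(e ^ 2 / (2 * σ))) ≤ q) :
    (mu0 d).real {w | T {x | h ≤ baseF n e τ ρ A (near n) w x}} ≤
        (mu0 d).real {w | T {x | h ≤ baseF n e τ ρ (insert v A) (near n) w x}} + q ∧
    ∀ (J : ℕ) (κ : ℝ), 0 < κ → Absorb n T v D J κ (h + (5 ^ d : ℕ) * e) →
      q * (J * ((2 ^ n * ((2 * (D + 2 ^ n) + 1) ^ d * (d + 1)) : ℕ) * (gaussC / τ)) / κ) ≤ 1 →
    (mu0 d).real {w | T {x | h ≤ baseF n e τ ρ A (near n) w x}} ≤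
        (mu0 d).real {w | T {x | h ≤ baseF n e τ ρ (insert v A) (near n) w x}} := by
  classical
  set B : V d → Finset (V d) := fun x => (near n x).erase v with hB
  set Sf : (Ix d → ℝ) → Set (V d) := fun w =>
    {x | h ≤ baseF n e τ ρ A B w x + if v ∈ near n x then e else 0} with hSf
  set Sg : (Ix d → ℝ) → Set (V d) := fun w => Sf w ∪ lam n v with hSg
  set S0 : (Ix d → ℝ) → Set (V d) := fun w => {x | h ≤ baseF n e τ ρ A (near n) w x} with hS0
  set S1 : (Ix d → ℝ) → Set (V d) :=
    fun w => {x | h ≤ baseF n e τ ρ (insert v A) (near n) w x} with hS1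
  have id0 : ∀ w x, baseF n e τ ρ A (near n) w x =
      baseF n e τ ρ A B w x + if v ∈ near n x then max (xi n v w x) (-e) else 0 := by
    intro w x
    unfold baseF
    by_cases hx : v ∈ near n x
    · rw [if_pos hx, ← Finset.add_sum_erase _ _ hx, if_neg hv]; ring
    · rw [if_neg hx, hB]
      simp only [Finset.erase_eq_of_notMem hx, add_zero]
  have id1 : ∀ w x, baseF n e τ ρ (insert v A) (near n) w x =
      baseF n e τ ρ A B w x + (if v ∈ near n x then e else 0) +
        if x ∈ cube (ctr n v) ρ then τ else 0 := by
    intro w x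
    unfold baseF
    have c : (((insert v A).filter fun u => x ∈ cube (ctr n u) ρ).card : ℝ) =
        ((A.filter fun u => x ∈ cube (ctr n u) ρ).card : ℝ) +
          if x ∈ cube (ctr n v) ρ then 1 else 0 := by
      rw [Finset.filter_insert]
      split_ifs with hx
      · rw [Finset.card_insert_of_notMem (fun hh => hv (Finset.mem_filter.1 hh).1)]
        push_cast; ring
      · simp
    have s : ∑ u ∈ B x, (if u ∈ insert v A then e else max (xi n u w x) (-e)) =
        ∑ u ∈ B x, (if u ∈ A then e else max (xi n u w x) (-e)) := by
      refine Finset.sum_congr rfl fun u hu => ?_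
      have : u ≠ v := Finset.ne_of_mem_erase hu
      simp [this]
    have s2 : ∑ u ∈ near n x, (if u ∈ insert v A then e else max (xi n u w x) (-e)) =
        (if v ∈ near n x then e else 0) +
          ∑ u ∈ B x, (if u ∈ insert v A then e else max (xi n u w x) (-e)) := by
      by_cases hx : v ∈ near n x
      · rw [if_pos hx, ← Finset.add_sum_erase _ _ hx, if_pos (Finset.mem_insert_self _ _)]
      · rw [if_neg hx, hB]
        simp only [Finset.erase_eq_of_notMem hx, zero_add]
    rw [s2, s, c, mul_add, mul_ite, mul_one, mul_zero]
    ring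
  have rbase : ∀ x, Measurable fun w =>
      baseF n e τ ρ A B w x + if v ∈ near n x then e else 0 := fun x =>
    (measurable_baseF x).add_const _
  have rSf : RSet Sf := fun x => measurableSet_le measurable_const (rbase x)
  have rSg : RSet Sg := fun x => (rSf x).union (MeasurableSet.const _)
  have mSf : RMono Sf := fun w w' hw x hx => by
    have h1 := baseF_mono (n := n) (e := e) (τ := τ) (ρ := ρ) (A := A) (B := B) x hw
    simp only [hSf, mem_ofPred_eq] at hx ⊢
    simp only at h1
    linarith
  set E : Set (Ix d → ℝ) := ⋃ x ∈ lam n v, {w | e ≤ xi n v w x} with hE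
  have mE : MeasurableSet E := Finset.measurableSet_biUnion _ fun x _ =>
    measurableSet_le measurable_const (measurable_lin _ x)
  set b : (Ix d → ℝ) → ℝ := E.indicator fun _ => (1 : ℝ) with hb
  have ub : IsUnitFn b := IsUnitFn.indicator mE
  have uf := hT.chi_unit rSf
  have ug := hT.chi_unit rSg
  set Nv : Finset (Ix d) :=
    ((lam n v).biUnion (blkSrc n v)).map ⟨Sum.inl, Sum.inl_injective⟩ with hNv
  have bdep : DepOn b (Nv : Set (Ix d)) := by
    intro w w' hw
    have key : ∀ x ∈ lam n v, xi n v w x = xi n v w' x := fun x hx =>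
      lin_congr (fun s hs => hw _ (Finset.mem_coe.2 (Finset.mem_map_of_mem _
        (Finset.mem_biUnion.2 ⟨x, hx, hs⟩)))) x
    have : w ∈ E ↔ w' ∈ E := by
      simp only [hE, mem_iUnion, mem_ofPred_eq, exists_prop]
      exact exists_congr fun x => and_congr_right fun hx => by rw [key x hx]
    simp only [hb, indicator, this]
  have sdep : ∀ w w', (∀ i ∈ (Nv : Set (Ix d))ᶜ, w i = w' i) → Sf w = Sf w' := by
    intro w w' hw
    have key : ∀ x, baseF n e τ ρ A B w x = baseF n e τ ρ A B w' x := fun x => by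
      refine baseF_dep (v := v) (by simp [hB]) fun s hs => hw _ ?_
      simp only [hNv, Finset.coe_map, mem_compl_iff, mem_image, not_exists, not_and]
      intro t ht hts
      obtain rfl : t = s := Sum.inl_injective hts
      obtain ⟨x, -, hx⟩ := Finset.mem_biUnion.1 (Finset.mem_coe.1 ht)
      obtain ⟨h1, h2⟩ := Finset.mem_filter.1 hx
      rcases hs with hs | hs
      · have := (Finset.mem_Ico.1 (mem_srcs.1 h1).1).1
        omega
      · exact hs h2
    simp only [hSf, key]
  have fdep : DepOn (chi T Sf) (Nv : Set (Ix d))ᶜ := fun w w' hw => by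
    have := sdep w w' hw
    exact le_antisymm (chi_le_chi (by rw [this]; exact id)) (chi_le_chi (by rw [this]; exact id))
  have gdep : DepOn (chi T Sg) (Nv : Set (Ix d))ᶜ := fun w w' hw => by
    have : Sg w = Sg w' := by simp only [hSg, sdep w w' hw]
    exact le_antisymm (chi_le_chi (by rw [this]; exact id)) (chi_le_chi (by rw [this]; exact id))
  have hbq : ∫ w, b w ∂(mu0 d) ≤ q := by
    rw [show ∫ w, b w ∂(mu0 d) = (mu0 d).real E from integral_indicator_one mE]
    refine (measureReal_biUnion_finset_le _ _).trans (le_trans ?_ hq)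
    rw [← nsmul_eq_mul]
    refine Finset.sum_le_card_nsmul _ _ _ fun x _ => ?_
    have : (mu0 d).real {w | e ≤ xi n v w x} =
        (gaussianReal 0 (Real.toNNReal (∑ t ∈ blkSrc n v x, ker x t ^ 2))).real (Ici e) := by
      rw [← lin_law_single x, map_measureReal_apply (measurable_lin _ x) measurableSet_Ici]
      rfl
    rw [this]
    refine gauss_tail _ ?_ hσ he.le
    rw [Real.coe_toNNReal']
    exact max_le (hvar v x) hσ.le
  have hb0 : 0 ≤ ∫ w, b w ∂(mu0 d) := (ub.integral (mu0 d)).1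
  have S0f : ∀ w, w ∉ E → S0 w ⊆ Sf w := by
    intro w hw x hx
    simp only [hS0, hSf, mem_ofPred_eq, id0] at hx ⊢
    by_cases hx' : v ∈ near n x
    · rw [if_pos hx'] at hx ⊢
      have : xi n v w x < e := by
        by_contra hc
        exact hw (mem_biUnion (mem_lam.2 hx') (not_lt.1 hc))
      have : max (xi n v w x) (-e) ≤ e := max_le this.le (by linarith)
      linarith
    · rw [if_neg hx'] at hx ⊢
      exact hx
  have S0g : ∀ w, S0 w ⊆ Sg w := by
    intro w x hx
    by_cases hx' : v ∈ near n x
    · exact Or.inr (mem_lam.2 hx')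
    · left
      simp only [hS0, hSf, mem_ofPred_eq, id0, if_neg hx'] at hx ⊢
      exact hx
  have rS0 : RSet S0 := fun x => measurableSet_le measurable_const (measurable_baseF x)
  have hpt : ∀ w, chi T S0 w ≤ chi T Sf w + (chi T Sg w * b w - chi T Sf w * b w) := by
    intro w
    by_cases hw : w ∈ E
    · have : b w = 1 := by simp [hb, hw]
      rw [this]
      have := chi_le_chi (T := T) (T' := T) (hT.mono (S0g w))
      linarith
    · have : b w = 0 := by simp [hb, hw]
      rw [this]
      have := chi_le_chi (T := T) (T' := T) (hT.mono (S0f w hw))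
      linarith
  have I0 := hT.integral_chi rS0 (mu0 d)
  have If := hT.integral_chi rSf (mu0 d)
  have Ig := hT.integral_chi rSg (mu0 d)
  have hmain : (mu0 d).real {w | T (S0 w)} ≤ (mu0 d).real {w | T (Sf w)} +
      q * ((mu0 d).real {w | T (Sg w)} - (mu0 d).real {w | T (Sf w)}) := by
    have i2 : Integrable (fun w => chi T Sg w * b w - chi T Sf w * b w) (mu0 d) :=
      ((ug.mul ub).integrable _).sub ((uf.mul ub).integrable _)
    have h1 : ∫ w, chi T S0 w ∂(mu0 d) ≤
        ∫ w, chi T Sf w + (chi T Sg w * b w - chi T Sf w * b w) ∂(mu0 d) :=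
      integral_mono ((hT.chi_unit rS0).integrable _) ((uf.integrable _).add i2) hpt
    rw [integral_add (uf.integrable _) i2,
      integral_sub ((ug.mul ub).integrable _) ((uf.mul ub).integrable _)] at h1
    have e1 : ∫ w, chi T Sg w * b w ∂(mu0 d) = _ := integral_mul_of_disjoint ug ub Nv gdep bdep
    have e2 : ∫ w, chi T Sf w * b w ∂(mu0 d) = _ := integral_mul_of_disjoint uf ub Nv fdep bdep
    change ∫ w, chi T Sg w * b w ∂(mu0 d) =
      (∫ w, chi T Sg w ∂(mu0 d)) * ∫ w, b w ∂(mu0 d) at e1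
    change ∫ w, chi T Sf w * b w ∂(mu0 d) =
      (∫ w, chi T Sf w ∂(mu0 d)) * ∫ w, b w ∂(mu0 d) at e2
    rw [e1, e2, I0, If, Ig] at h1
    have hfg : (mu0 d).real {w | T (Sf w)} ≤ (mu0 d).real {w | T (Sg w)} :=
      measureReal_mono fun w hw => hT.mono subset_union_left hw
    have := mul_le_mul_of_nonneg_right hbq (sub_nonneg.2 hfg)
    linarith
  have hf1 : (mu0 d).real {w | T (Sf w)} ≤ (mu0 d).real {w | T (S1 w)} := by
    refine measureReal_mono fun w hw => hT.mono (fun x hx => ?_) hw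
    simp only [hS1, hSf, mem_ofPred_eq, id1] at hx ⊢
    split_ifs at hx ⊢ <;> linarith
  have hq0 : 0 ≤ q := hb0.trans hbq
  refine ⟨?_, fun J κ hκ hab hsmall => ?_⟩
  · have hg1 : (mu0 d).real {w | T (Sg w)} ≤ 1 := measureReal_le_one
    have hf0 : 0 ≤ (mu0 d).real {w | T (Sf w)} := measureReal_nonneg
    have : q * ((mu0 d).real {w | T (Sg w)} - (mu0 d).real {w | T (Sf w)}) ≤ q * 1 :=
      mul_le_mul_of_nonneg_left (by linarith) hq0
    linarith
  obtain ⟨I, g, F, hIJ, hI, hcov⟩ := hab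
  set M : ℝ := ((2 ^ n * ((2 * (D + 2 ^ n) + 1) ^ d * (d + 1)) : ℕ) : ℝ) * (gaussC / τ) with hM
  set Δ := (mu0 d).real {w | T (S1 w)} - (mu0 d).real {w | T (Sf w)} with hΔ
  have hΔ0 : 0 ≤ Δ := by rw [hΔ]; linarith
  have hM0 : 0 ≤ M := by have := gaussC_pos; positivity
  have hvar' : ∑ i ∈ (locSrc n (ctr n v) D).map ⟨Sum.inl, Sum.inl_injective⟩,
      condVar (nu d) i (chi T Sf) ≤ M * Δ := by
    have := sum_condVar_le_add hT (S := Sf) (S' := S1) rSf mSf hτ hτ1 (locSrc n (ctr n v) D)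
      (fun i hi w x hx => by
        have hi' := mem_srcs.1 hi
        have h1 := baseF_update (n := n) (e := e) (ρ := ρ) (A := A) (B := B) hτ.le w i
          (Finset.mem_range.1 hi'.1) x
        simp only [hS1, hSf, mem_ofPred_eq, id1] at hx ⊢
        have h2 : (if x ∈ cube i.2.1 (2 ^ n) then τ else 0) ≤
            if x ∈ cube (ctr n v) ρ then τ else 0 := by
          by_cases hc : x ∈ cube i.2.1 (2 ^ n)
          · rw [if_pos hc, if_pos]
            rw [hρ]
            exact cube_subset_cube hi'.2 hc
          · rw [if_neg hc]; split_ifs <;> linarith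
        linarith)
    rw [card_locSrc] at this
    exact this
  have hj : ∀ j ∈ I, (mu0 d).real {w | g j (Sf w) ∨ T (Sf w)} -
      (mu0 d).real {w | T (Sf w)} ≤ M * Δ / κ := by
    intro j hj
    obtain ⟨ig, iF, lF, hκF, hex⟩ := hI j hj
    have iG := ig.or hT
    set SF : (Ix d → ℝ) → Set (V d) := fun w => {x | h + (5 ^ d : ℕ) * e ≤ psi n w x} with hSF
    have hsub : ∀ w, SF w ⊆ Sf w := by
      intro w x hx
      have h1 := psi_sub_le_baseF (n := n) (ρ := ρ) (A := A) (B := B) he.le hτ.le w x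
      have h2 : ((B x).card : ℝ) ≤ (5 ^ d : ℕ) := by
        have : (near n x).card = 5 ^ d := by rw [near, card_cube]
        rw [← this]
        exact_mod_cast Finset.card_le_card (Finset.erase_subset _ _)
      have h3 := mul_le_mul_of_nonneg_right h2 he.le
      simp only [hSF, hSf, mem_ofPred_eq] at hx ⊢
      have : 0 ≤ if v ∈ near n x then e else 0 := by split_ifs <;> linarith
      linarith
    have hb := opening_bound (ν := nu d) uf (iG.chi_unit rSf) (iF.chi_unit (rset_psi n _))
      (iG.chi_mono mSf) (iF.chi_mono (rmono_psi n _)) _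
      (chi_psi_dep iF lF (h + (5 ^ d : ℕ) * e)) (fun w => by
        by_cases h1 : F j (SF w)
        · rw [chi_pos h1, mul_one, mul_one]
          refine chi_le_chi fun h2 => ?_
          rcases h2 with h2 | h2
          · exact hex _ h2 (iF.mono (hsub w) h1)
          · exact h2
        · rw [chi_neg h1, mul_zero, mul_zero])
    have e1 : ∫ w, chi (F j) SF w ∂(Measure.infinitePi (nu d)) = pr n (F j) _ :=
      iF.integral_chi (rset_psi n _) (mu0 d)
    have e2 : ∫ w, chi (fun S => g j S ∨ T S) Sf w ∂(Measure.infinitePi (nu d)) = _ :=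
      iG.integral_chi rSf (mu0 d)
    have e3 : ∫ w, chi T Sf w ∂(Measure.infinitePi (nu d)) = _ := If
    rw [e1, e2, e3] at hb
    rw [le_div_iff₀ hκ, mul_comm]
    refine le_trans ?_ (hb.trans hvar')
    refine mul_le_mul_of_nonneg_right hκF (sub_nonneg.2 (measureReal_mono fun w hw => Or.inr hw))
  have hgf : (mu0 d).real {w | T (Sg w)} - (mu0 d).real {w | T (Sf w)} ≤ J * (M * Δ / κ) := by
    have hind : ∀ w, chi T Sg w - chi T Sf w ≤
        ∑ j ∈ I, (chi (fun S => g j S ∨ T S) Sf w - chi T Sf w) := by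
      intro w
      have hnn : ∀ j ∈ I, 0 ≤ chi (fun S => g j S ∨ T S) Sf w - chi T Sf w := fun j _ =>
        sub_nonneg.2 (chi_le_chi fun hh => Or.inr hh)
      by_cases h1 : T (Sg w)
      · rcases hcov _ h1 with h2 | ⟨j, hj, h2⟩
        · rw [chi_pos h1, chi_pos h2, sub_self]
          rw [chi_pos h2] at hnn
          exact Finset.sum_nonneg hnn
        · refine le_trans ?_ (Finset.single_le_sum hnn hj)
          rw [chi_pos h1, chi_pos (T := fun S => g j S ∨ T S) (S := Sf) (w := w) (Or.inl h2)]
      · rw [chi_neg h1]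
        refine le_trans ?_ (Finset.sum_nonneg hnn)
        rcases chi_cases T Sf w with h2 | h2 <;> rw [h2] <;> norm_num
    have hG : ∀ j ∈ I, Integrable
        (fun w => chi (fun S => g j S ∨ T S) Sf w - chi T Sf w) (mu0 d) := fun j hj =>
      ((((hI j hj).1.or hT).chi_unit rSf).integrable _).sub (uf.integrable _)
    have h1 := integral_mono ((ug.integrable (mu0 d)).sub (uf.integrable _))
      (integrable_finsetSum _ hG) hind
    rw [integral_finsetSum _ hG] at h1
    simp only [Pi.sub_apply] at h1
    rw [integral_sub (ug.integrable _) (uf.integrable _), Ig, If] at h1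
    refine h1.trans ?_
    have h2 : ∀ j ∈ I, ∫ w, (chi (fun S => g j S ∨ T S) Sf w - chi T Sf w) ∂(mu0 d) ≤
        M * Δ / κ := fun j hjI => by
      rw [integral_sub ((((hI j hjI).1.or hT).chi_unit rSf).integrable _) (uf.integrable _), If,
        ((hI j hjI).1.or hT).integral_chi rSf]
      exact hj j hjI
    refine (Finset.sum_le_card_nsmul _ _ _ h2).trans ?_
    rw [nsmul_eq_mul]
    refine mul_le_mul_of_nonneg_right (by exact_mod_cast hIJ) (by positivity)
  have h5 : q * ((mu0 d).real {w | T (Sg w)} - (mu0 d).real {w | T (Sf w)}) ≤ Δ := by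
    calc _ ≤ q * (J * (M * Δ / κ)) := mul_le_mul_of_nonneg_left hgf hq0
      _ = q * (J * M / κ) * Δ := by ring
      _ ≤ 1 * Δ := mul_le_mul_of_nonneg_right hsmall hΔ0
      _ = Δ := one_mul _
  linarith

end ScaleStep

end SingleScale

section ScaleGrowth

variable {d : ℕ}

lemma card_bumps_le (n : ℕ) (ρ : ℕ) (A : Finset (V d)) (x : V d) :
    (A.filter fun u => x ∈ cube (ctr n u) ρ).card ≤ (2 * ρ + 1) ^ d := by
  rw [← card_cube x ρ]
  refine Finset.card_le_card_of_injOn (ctr n) (fun u hu => ?_) fun u _ v _ h => ?_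
  · exact mem_cube_comm.1 (Finset.mem_filter.1 (Finset.mem_coe.1 hu)).2
  · ext i
    have := congrFun h i
    simp only [ctr] at this
    exact mul_left_cancel₀ (by positivity) this

/-- Removal of one scale: the increment of the field between the scales `n` and `n + 1` is
absorbed by a small change of the level. -/
theorem scale_step {T : Set (V d) → Prop} (hT : IncEv T) {W : Finset (V d)} (hW : LocalTo T W)
    {n : ℕ} {σ : ℝ} (hσ : 0 < σ) (hvar : ∀ v x : V d, ∑ t ∈ blkSrc n v x, ker x t ^ 2 ≤ σ)
    {e τ : ℝ} (he : 0 < e) (hτ : 0 < τ) (hτ1 : τ ≤ 1) {D J : ℕ}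
    (hτe : τ * ((2 * (D + 2 ^ n + 2 ^ n) + 1) ^ d : ℕ) ≤ e)
    {q κ : ℝ} (hκ : 0 < κ) (hq : ((6 * 2 ^ n + 1) ^ d : ℕ) * Real.exp (-(e ^ 2 / (2 * σ))) ≤ q)
    (hsmall : q * (J * ((2 ^ n * ((2 * (D + 2 ^ n) + 1) ^ d * (d + 1)) : ℕ) *
      (gaussC / τ)) / κ) ≤ 1) (h : ℝ) (Exc : Finset (V d))
    (hab : ∀ v, v ∉ Exc → Absorb n T v D J κ (h + (5 ^ d : ℕ) * e)) :
    pr (n + 1) T h ≤ pr n T (h - ((5 ^ d : ℕ) + 1) * e) + Exc.card * q := by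
  classical
  set ρ := D + 2 ^ n + 2 ^ n with hρ
  have hq0 : 0 ≤ q := le_trans (by positivity) hq
  have main : ∀ A : Finset (V d),
      (mu0 d).real {w | T {x | h ≤ baseF n e τ ρ ∅ (near n) w x}} ≤
        (mu0 d).real {w | T {x | h ≤ baseF n e τ ρ A (near n) w x}} + (A ∩ Exc).card * q := by
    intro A
    induction A using Finset.induction_on with
    | empty => simp
    | insert v A hv ih =>
      have hq' : (lam n v).card * Real.exp (-(e ^ 2 / (2 * σ))) ≤ q := by
        refine le_trans (mul_le_mul_of_nonneg_right ?_ (Real.exp_pos _).le) hq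
        exact_mod_cast card_lam n v
      obtain ⟨h1, h2⟩ := step_single hT hσ hvar he hτ hτ1 hρ h hv hq'
      by_cases hE : v ∈ Exc
      · rw [Finset.insert_inter_of_mem hE, Finset.card_insert_of_notMem (fun hh =>
          hv (Finset.mem_inter.1 hh).1)]
        push_cast
        linarith
      · rw [Finset.insert_inter_of_notMem hE]
        have := h2 J κ hκ (hab v hE) hsmall
        linarith
  have h0 : pr (n + 1) T h ≤ (mu0 d).real {w | T {x | h ≤ baseF n e τ ρ ∅ (near n) w x}} := by
    refine measureReal_mono fun w hw => hT.mono (fun x hx => ?_) hw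
    refine le_trans (show h ≤ psi (n + 1) w x from hx) ?_
    rw [psi_succ]
    simp only [baseF, Finset.notMem_empty, if_false, Finset.filter_empty, Finset.card_empty,
      Nat.cast_zero, mul_zero, add_zero]
    gcongr
    exact le_max_left _ _
  have h1 := main (W.biUnion (near n))
  have h2 : (mu0 d).real
      {w | T {x | h ≤ baseF n e τ ρ (W.biUnion (near n)) (near n) w x}} ≤
      pr n T (h - ((5 ^ d : ℕ) + 1) * e) := by
    refine measureReal_mono fun w hw => hT.local_mono hW (fun x hx hS => ?_) hw
    have hS' : h ≤ baseF n e τ ρ (W.biUnion (near n)) (near n) w x := hS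
    change h - ((5 ^ d : ℕ) + 1) * e ≤ psi n w x
    unfold baseF at hS'
    have e1 : ∑ u ∈ near n x, (if u ∈ W.biUnion (near n) then e else max (xi n u w x) (-e)) =
        (5 ^ d : ℕ) * e := by
      rw [Finset.sum_congr rfl fun u hu => if_pos (Finset.mem_biUnion.2 ⟨x, hx, hu⟩)]
      rw [Finset.sum_const, near, card_cube, nsmul_eq_mul]
    have e2 : τ * (((W.biUnion (near n)).filter fun u => x ∈ cube (ctr n u) ρ).card : ℝ) ≤ e :=
      le_trans (mul_le_mul_of_nonneg_left (by exact_mod_cast card_bumps_le n ρ _ x) hτ.le) hτe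
    rw [e1] at hS'
    linarith
  have h3 : ((W.biUnion (near n) ∩ Exc).card : ℝ) * q ≤ Exc.card * q :=
    mul_le_mul_of_nonneg_right (by exact_mod_cast Finset.card_le_card Finset.inter_subset_right)
      hq0
  linarith

lemma Absorb.anti {n : ℕ} {T : Set (V d) → Prop} {v : V d} {D D' J J' : ℕ} {κ κ' h h' : ℝ}
    (hab : Absorb n T v D J κ h) (hD : D ≤ D') (hJ : J ≤ J') (hκ : κ' ≤ κ) (hh : h' ≤ h) :
    Absorb n T v D' J' κ' h' := by
  obtain ⟨I, g, F, h1, h2, h3⟩ := hab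
  refine ⟨I, g, F, h1.trans hJ, fun j hj => ?_, h3⟩
  obtain ⟨a, b, c, e, f⟩ := h2 j hj
  exact ⟨a, b, c.mono b.mono (cube_mono hD), hκ.trans (e.trans (pr_anti n b hh)), f⟩

/-- The scale `exp (a (n + 1) ^ 3)` which dominates all polynomial quantities. -/
def growth (a : ℝ) (n : ℕ) : ℝ := Real.exp (a * ((n : ℝ) + 1) ^ 3)

lemma one_le_growth {a : ℝ} (ha : 0 ≤ a) (n : ℕ) : 1 ≤ growth a n :=
  Real.one_le_exp (by positivity)

lemma two_pow_le_growth {a : ℝ} (ha : 1 ≤ a) (n : ℕ) : (2 : ℝ) ^ n ≤ growth a n := by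
  have h1 : (2 : ℝ) ^ n ≤ Real.exp n := by
    rw [← Real.exp_one_pow]
    exact pow_le_pow_left₀ (by norm_num) (by have := Real.add_one_le_exp 1; linarith) n
  refine h1.trans (Real.exp_le_exp.2 ?_)
  have hn : (0 : ℝ) ≤ n := Nat.cast_nonneg n
  nlinarith [pow_nonneg hn 3, pow_nonneg hn 2, mul_nonneg (sub_nonneg.2 ha)
    (pow_nonneg (by linarith : (0 : ℝ) ≤ n + 1) 3)]

/-- Double exponentials beat all the polynomial factors. -/
lemma eventually_small (K y a : ℝ) (k : ℕ) (hK : 0 < K) (hy : 0 < y) :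
    ∀ᶠ n : ℕ in atTop, K * growth a n ^ k * Real.exp (-(y * Real.exp (n / 10))) ≤
      (1 / 2) ^ n * Real.exp (-Real.exp ((n + 4) / 20)) := by
  have hu : Tendsto (fun n : ℕ => (n : ℝ) / 20) atTop atTop :=
    tendsto_natCast_atTop_atTop.atTop_div_const (by norm_num)
  have hpoly : ∀ j : ℕ, Tendsto (fun n : ℕ => ((n : ℝ) / 20) ^ j * Real.exp (-((n : ℝ) / 20)))
      atTop (nhds 0) := fun j => (Real.tendsto_pow_mul_exp_neg_atTop_nhds_zero j).comp hu
  have hinv : Tendsto (fun n : ℕ => Real.exp (-((n : ℝ) / 20))) atTop (nhds 0) := by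
    simpa using hpoly 0
  have hlim : Tendsto (fun n : ℕ => (Real.log K * Real.exp (-((n : ℝ) / 20)) +
      k * a * (8000 * (((n : ℝ) / 20) ^ 3 * Real.exp (-((n : ℝ) / 20))) +
        1200 * (((n : ℝ) / 20) ^ 2 * Real.exp (-((n : ℝ) / 20))) +
        60 * (((n : ℝ) / 20) ^ 1 * Real.exp (-((n : ℝ) / 20))) + Real.exp (-((n : ℝ) / 20))) +
      Real.log 2 * 20 * (((n : ℝ) / 20) ^ 1 * Real.exp (-((n : ℝ) / 20)))) + Real.exp (1 / 5))
      atTop (nhds ((Real.log K * 0 + k * a * (8000 * 0 + 1200 * 0 + 60 * 0 + 0) +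
        Real.log 2 * 20 * 0) + Real.exp (1 / 5))) :=
    ((((hinv.const_mul _).add (((((hpoly 3).const_mul _).add ((hpoly 2).const_mul _)).add
      ((hpoly 1).const_mul _)).add hinv |>.const_mul _)).add ((hpoly 1).const_mul _)).add_const _)
  have hbig : Tendsto (fun n : ℕ => y * Real.exp ((n : ℝ) / 20)) atTop atTop :=
    (Real.tendsto_exp_atTop.comp hu).const_mul_atTop hy
  filter_upwards [hlim.eventually_le_const (lt_add_one _), hbig.eventually_ge_atTop
    ((Real.log K * 0 + k * a * (8000 * 0 + 1200 * 0 + 60 * 0 + 0) +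
        Real.log 2 * 20 * 0) + Real.exp (1 / 5) + 1)] with n h1 h2
  have h3 := h1.trans h2
  have hE : 0 < Real.exp ((n : ℝ) / 20) := Real.exp_pos _
  have hEE : Real.exp (-((n : ℝ) / 20)) * Real.exp ((n : ℝ) / 20) = 1 := by
    rw [← Real.exp_add]; simp
  have h4 := mul_le_mul_of_nonneg_right h3 hE.le
  have e10 : Real.exp ((n : ℝ) / 10) = Real.exp ((n : ℝ) / 20) * Real.exp ((n : ℝ) / 20) := by
    rw [← Real.exp_add]; ring_nf
  have e4 : Real.exp (((n : ℝ) + 4) / 20) = Real.exp (1 / 5) * Real.exp ((n : ℝ) / 20) := by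
    rw [← Real.exp_add]; ring_nf
  have h5 : Real.log K + k * (a * ((n : ℝ) + 1) ^ 3) + n * Real.log 2 +
      Real.exp (((n : ℝ) + 4) / 20) ≤ y * Real.exp ((n : ℝ) / 10) := by
    rw [e4, e10]
    have : (Real.log K + k * (a * ((n : ℝ) + 1) ^ 3) + n * Real.log 2) =
      (Real.log K + k * a * (8000 * (((n : ℝ) / 20) ^ 3) + 1200 * (((n : ℝ) / 20) ^ 2) +
        60 * (((n : ℝ) / 20) ^ 1) + 1) + Real.log 2 * 20 * (((n : ℝ) / 20) ^ 1)) *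
        (Real.exp (-((n : ℝ) / 20)) * Real.exp ((n : ℝ) / 20)) := by
      rw [hEE]; ring
    rw [this]
    nlinarith [h4]
  have e1 : K * growth a n ^ k * Real.exp (-(y * Real.exp (n / 10))) =
      Real.exp (Real.log K + k * (a * ((n : ℝ) + 1) ^ 3) - y * Real.exp (n / 10)) := by
    rw [growth, ← Real.exp_nat_mul, sub_eq_add_neg, Real.exp_add, Real.exp_add, Real.exp_log hK]
  have e2 : ((1 : ℝ) / 2) ^ n * Real.exp (-Real.exp (((n : ℝ) + 4) / 20)) =
      Real.exp (-(n * Real.log 2) - Real.exp (((n : ℝ) + 4) / 20)) := by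
    rw [sub_eq_add_neg, Real.exp_add, Real.exp_neg ((n:ℝ) * Real.log 2), Real.exp_nat_mul,
      Real.exp_log two_pos,
      one_div, inv_pow]
  rw [e1, e2]
  exact Real.exp_le_exp.2 (by linarith)

end ScaleGrowth

section MultiScale

variable {d : ℕ}

lemma exp_div_ten_le_growth {a : ℝ} (ha : 1 ≤ a) (n : ℕ) :
    Real.exp ((n : ℝ) / 10) ≤ growth a n := by
  refine Real.exp_le_exp.2 ?_
  have hn : (0 : ℝ) ≤ n := Nat.cast_nonneg n
  nlinarith [pow_nonneg hn 3, pow_nonneg hn 2, mul_nonneg (sub_nonneg.2 ha)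
    (pow_nonneg (by linarith : (0 : ℝ) ≤ n + 1) 3)]

lemma exp_le_sqrt_two_pow (n : ℕ) : Real.exp (3 * n / 10) ≤ Real.sqrt (2 ^ n) := by
  refine Real.le_sqrt_of_sq_le ?_
  have h2 : (0.6931471803 : ℝ) < Real.log 2 := Real.log_two_gt_d9
  rw [← Real.exp_nat_mul, ← Real.exp_log two_pos, ← Real.exp_nat_mul]
  refine Real.exp_le_exp.2 ?_
  have hn : (0 : ℝ) ≤ n := Nat.cast_nonneg n
  push_cast
  nlinarith

/-- The quantitative conditions of `scale_step`, for the increments `s₀ exp (-n / 10)`. -/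
lemma scale_bounds {C s₀ a : ℝ} (hC : 0 < C) (hs : 0 < s₀) (ha : 1 ≤ a) (d : ℕ) :
    ∀ᶠ n : ℕ in atTop, ∀ D : ℕ, (D : ℝ) ≤ growth a n →
      ((6 * 2 ^ n + 1) ^ d : ℕ) *
        Real.exp (-((s₀ * Real.exp (-(n / 10))) ^ 2 / (2 * (C / Real.sqrt (2 ^ n))))) *
        (D * ((2 ^ n * ((2 * (D + 2 ^ n) + 1) ^ d * (d + 1)) : ℕ) *
        (gaussC / (s₀ * Real.exp (-(n / 10)) / ((2 * (D + 2 ^ n + 2 ^ n) + 1) ^ d : ℕ)))) /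
          (growth a n)⁻¹) ≤ 1 ∧
      ((2 * D + 1) ^ d : ℕ) * (((6 * 2 ^ n + 1) ^ d : ℕ) *
        Real.exp (-((s₀ * Real.exp (-(n / 10))) ^ 2 / (2 * (C / Real.sqrt (2 ^ n)))))) ≤
        (1 / 2) ^ n * Real.exp (-Real.exp ((n + 4) / 20)) := by
  have hgC := gaussC_pos
  have hy : 0 < s₀ ^ 2 / (2 * C) := by positivity
  filter_upwards [eventually_small (7 ^ d * 7 ^ d * 7 ^ d * (d + 1) * gaussC / s₀)
      (s₀ ^ 2 / (2 * C)) a (3 * d + 4) (by positivity) hy,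
    eventually_small (7 ^ d * 7 ^ d) (s₀ ^ 2 / (2 * C)) a (2 * d) (by positivity) hy] with n h1 h2
  intro D hD
  set G := growth a n with hG
  set E := Real.exp (-(s₀ ^ 2 / (2 * C) * Real.exp (n / 10))) with hE
  have hE0 : 0 < E := Real.exp_pos _
  have hG1 : 1 ≤ G := one_le_growth (by linarith) n
  have hG0 : 0 < G := by linarith
  have h2G : (2 : ℝ) ^ n ≤ G := two_pow_le_growth ha n
  have hs2 : 0 < Real.sqrt (2 ^ n) := by positivity
  have hexp :
      Real.exp (-((s₀ * Real.exp (-(n / 10))) ^ 2 / (2 * (C / Real.sqrt (2 ^ n))))) ≤ E := by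
    refine Real.exp_le_exp.2 (neg_le_neg ?_)
    have e1 : (s₀ * Real.exp (-((n : ℝ) / 10))) ^ 2 / (2 * (C / Real.sqrt (2 ^ n))) =
        s₀ ^ 2 / (2 * C) * (Real.exp (-((n : ℝ) / 10)) ^ 2 * Real.sqrt (2 ^ n)) := by
      field_simp
    rw [e1]
    refine mul_le_mul_of_nonneg_left ?_ hy.le
    calc Real.exp ((n : ℝ) / 10) = Real.exp (-((n : ℝ) / 10)) ^ 2 * Real.exp (3 * n / 10) := by
          rw [← Real.exp_nat_mul, ← Real.exp_add]; congr 1; push_cast; ring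
      _ ≤ _ := mul_le_mul_of_nonneg_left (exp_le_sqrt_two_pow n) (by positivity)
  have hinv : (Real.exp (-((n : ℝ) / 10)))⁻¹ ≤ G := by
    rw [Real.exp_neg, inv_inv]
    exact exp_div_ten_le_growth ha n
  have b1 : (((6 * 2 ^ n + 1) ^ d : ℕ) : ℝ) ≤ (7 * G) ^ d := by
    push_cast
    exact pow_le_pow_left₀ (by positivity) (by linarith) d
  have b2 : (((2 * (D + 2 ^ n) + 1) ^ d : ℕ) : ℝ) ≤ (7 * G) ^ d := by
    push_cast
    exact pow_le_pow_left₀ (by positivity) (by linarith) d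
  have b3 : (((2 * (D + 2 ^ n + 2 ^ n) + 1) ^ d : ℕ) : ℝ) ≤ (7 * G) ^ d := by
    push_cast
    exact pow_le_pow_left₀ (by positivity) (by linarith) d
  have b4 : (((2 * D + 1) ^ d : ℕ) : ℝ) ≤ (7 * G) ^ d := by
    push_cast
    exact pow_le_pow_left₀ (by positivity) (by linarith) d
  have b0 : (0 : ℝ) < (((2 * (D + 2 ^ n + 2 ^ n) + 1) ^ d : ℕ) : ℝ) := by positivity
  constructor
  · calc _ ≤ ((7 * G) ^ d * E) * (G * ((G * ((7 * G) ^ d * (d + 1))) *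
          (gaussC * (7 * G) ^ d * G / s₀)) * G) := by
          have c1 : gaussC / (s₀ * Real.exp (-((n : ℝ) / 10)) /
              ((2 * (D + 2 ^ n + 2 ^ n) + 1) ^ d : ℕ)) ≤ gaussC * (7 * G) ^ d * G / s₀ := by
            have : gaussC / (s₀ * Real.exp (-((n : ℝ) / 10)) /
              ((2 * (D + 2 ^ n + 2 ^ n) + 1) ^ d : ℕ)) = gaussC *
                ((2 * (D + 2 ^ n + 2 ^ n) + 1) ^ d : ℕ) * (Real.exp (-((n : ℝ) / 10)))⁻¹ / s₀ := by
              field_simp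
            rw [this]
            gcongr
          have c2 : (((2 ^ n * ((2 * (D + 2 ^ n) + 1) ^ d * (d + 1)) : ℕ)) : ℝ) ≤
              G * ((7 * G) ^ d * (d + 1)) := by
            rw [Nat.cast_mul, Nat.cast_mul]
            push_cast at b2 ⊢
            gcongr
          rw [div_inv_eq_mul]
          gcongr
      _ = 7 ^ d * 7 ^ d * 7 ^ d * (d + 1) * gaussC / s₀ * G ^ (3 * d + 4) * E := by
          rw [mul_pow]; ring
      _ ≤ _ := h1
      _ ≤ 1 := by
          refine mul_le_one₀ (pow_le_one₀ (by norm_num) (by norm_num)) (Real.exp_nonneg _) ?_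
          rw [Real.exp_le_one_iff]
          linarith [Real.exp_pos (((n : ℝ) + 4) / 20)]
  · calc _ ≤ (7 * G) ^ d * ((7 * G) ^ d * E) := by gcongr
      _ = 7 ^ d * 7 ^ d * G ^ (2 * d) * E := by rw [mul_pow]; ring
      _ ≤ _ := h2

/-- Removal of all the scales beyond `n₁`, at the cost of a small change of the level. -/
theorem iterate_scales (hd : 3 ≤ d) {a s : ℝ} (ha : 1 ≤ a) (hs : 0 < s) : ∃ n₀ : ℕ, ∀ n₁, n₀ ≤ n₁ →
    ∀ {T : Set (V d) → Prop}, IncEv T → ∀ {W : Finset (V d)}, LocalTo T W → ∀ (h r : ℝ), 1 ≤ r →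
    (∀ n, n₁ ≤ n → ∀ v : V d, (r ≤ Real.exp (((n : ℝ) + 4) ^ 3) ∧ ∀ i, (|v i| : ℝ) ≤ growth a n) ∨
      ∃ (D J : ℕ) (κ : ℝ), (D : ℝ) ≤ growth a n ∧ (J : ℝ) ≤ growth a n ∧ (growth a n)⁻¹ ≤ κ ∧
        Absorb n T v D J κ (h + s)) →
    ∀ N, n₁ ≤ N → pr N T (h + s) ≤ pr n₁ T h +
      2 * Real.exp (-Real.exp (Real.log r ^ ((1 : ℝ) / 3) / 20)) := by
  obtain ⟨C, hC, hvar, -⟩ := variance_bounds hd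
  set b : ℝ := ((5 ^ d : ℕ) : ℝ) with hb
  have hb0 : 0 ≤ b := Nat.cast_nonneg _
  have hx1 : Real.exp (-(1 / 10 : ℝ)) < 1 := by rw [Real.exp_lt_one_iff]; norm_num
  set Z : ℝ := (1 - Real.exp (-(1 / 10 : ℝ)))⁻¹ with hZ
  have hZ0 : 0 < Z := inv_pos.2 (by linarith)
  set s₀ : ℝ := min 1 (s / ((b + 1) * Z + b)) with hs₀
  have hden : 0 < (b + 1) * Z + b := by positivity
  have hs0 : 0 < s₀ := lt_min one_pos (div_pos hs hden)
  have hs1 : s₀ ≤ 1 := min_le_left _ _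
  have hs2 : s₀ * ((b + 1) * Z + b) ≤ s := by
    rw [← le_div_iff₀ hden]; exact min_le_right _ _
  set e : ℕ → ℝ := fun n => s₀ * Real.exp (-((n : ℝ) / 10)) with he
  have he0 : ∀ n, 0 < e n := fun n => by positivity
  have hexp1 : ∀ n : ℕ, Real.exp (-((n : ℝ) / 10)) ≤ 1 := fun n => by
    rw [Real.exp_le_one_iff]; have : (0 : ℝ) ≤ n := Nat.cast_nonneg n; linarith
  have hes : ∀ n, e n ≤ s₀ := fun n => mul_le_of_le_one_right hs0.le (hexp1 n)
  have hpow : ∀ n : ℕ, Real.exp (-((n : ℝ) / 10)) = Real.exp (-(1 / 10 : ℝ)) ^ n := fun n => by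
    rw [← Real.exp_nat_mul]; ring_nf
  have hsum : ∀ s : Finset ℕ, ∑ n ∈ s, e n ≤ s₀ * Z := fun s => by
    have h1 := summable_geometric_of_lt_one (Real.exp_nonneg (-(1 / 10 : ℝ))) hx1
    simp only [he, ← Finset.mul_sum, hpow]
    refine mul_le_mul_of_nonneg_left ?_ hs0.le
    rw [hZ, ← tsum_geometric_of_lt_one (Real.exp_nonneg (-(1 / 10 : ℝ))) hx1]
    exact h1.sum_le_tsum s fun _ _ => by positivity
  obtain ⟨n₀, hn₀⟩ := eventually_atTop.1 (scale_bounds (s₀ := s₀) hC hs0 ha d)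
  refine ⟨n₀, fun n₁ hn₁ T hT W hW h r hr hab => ?_⟩
  set E := Real.exp (-Real.exp (Real.log r ^ ((1 : ℝ) / 3) / 20)) with hE
  have hE0 : 0 < E := Real.exp_pos _
  have key : ∀ N, n₁ ≤ N → pr N T (h + (b + 1) * ∑ k ∈ Finset.Ico n₁ N, e k) ≤ pr n₁ T h +
      (∑ k ∈ Finset.Ico n₁ N, (1 / 2 : ℝ) ^ k) * E := by
    intro N hN
    induction N, hN using Nat.le_induction with
    | base => simp
    | succ n hn ih =>
      set G := growth a n with hG
      have hG1 : 1 ≤ G := one_le_growth (by linarith) n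
      have hfl : ((⌊G⌋₊ : ℕ) : ℝ) ≤ G := Nat.floor_le (by linarith)
      obtain ⟨p1, p2⟩ := hn₀ n (hn₁.trans hn) ⌊G⌋₊ hfl
      set M : ℕ := (2 * (⌊G⌋₊ + 2 ^ n + 2 ^ n) + 1) ^ d with hM
      have hM1 : (1 : ℝ) ≤ M := by
        have : 0 < M := by positivity
        exact_mod_cast this
      classical
      set Exc : Finset (V d) :=
        if r ≤ Real.exp (((n : ℝ) + 4) ^ 3) then cube 0 ⌊G⌋₊ else ∅ with hExc
      have hstep := scale_step hT hW (n := n) (σ := C / Real.sqrt (2 ^ n)) (by positivity)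
        (hvar n) (he0 n) (τ := e n / M) (by have := he0 n; positivity)
        (by rw [div_le_one (by linarith)]; linarith [hes n]) (D := ⌊G⌋₊) (J := ⌊G⌋₊)
        (by rw [div_mul_cancel₀ _ (by linarith)])
        (κ := G⁻¹) (by positivity) le_rfl p1
        (h + (b + 1) * ∑ k ∈ Finset.Ico n₁ (n + 1), e k) Exc (fun v hv => by
          rcases hab n hn v with ⟨h1, h2⟩ | ⟨D, J, κ, hD, hJ, hκ, hA⟩
          · refine absurd ?_ hv
            rw [hExc, if_pos h1, mem_cube]
            intro i
            have : ((|v i| : ℤ) : ℝ) ≤ G := by exact_mod_cast h2 i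
            have h3 := (Nat.le_floor_iff (n := (v i).natAbs) (by linarith : 0 ≤ G)).2
              (by rw [← Int.cast_natCast, Int.natCast_natAbs]; exact this)
            simp only [Pi.zero_apply, zero_sub, abs_neg]
            rw [← Int.natCast_natAbs]
            exact_mod_cast h3
          · refine hA.anti (Nat.le_floor hD) (Nat.le_floor hJ) hκ ?_
            have h4 := hsum (Finset.Ico n₁ (n + 1))
            have h5 := mul_le_mul_of_nonneg_left h4 (by linarith : 0 ≤ b + 1)
            have h6 := mul_le_mul_of_nonneg_left (hes n) hb0
            linarith)
      rw [Finset.sum_Ico_succ_top hn, Finset.sum_Ico_succ_top hn, add_mul _ _ E]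
      rw [Finset.sum_Ico_succ_top hn] at hstep
      have e1 : h + (b + 1) * (∑ k ∈ Finset.Ico n₁ n, e k + e n) - (b + 1) * e n =
          h + (b + 1) * ∑ k ∈ Finset.Ico n₁ n, e k := by ring
      rw [e1] at hstep
      refine hstep.trans ?_
      have e2 : (Exc.card : ℝ) * (((6 * 2 ^ n + 1) ^ d : ℕ) *
          Real.exp (-((e n) ^ 2 / (2 * (C / Real.sqrt (2 ^ n)))))) ≤ (1 / 2) ^ n * E := by
        by_cases hr' : r ≤ Real.exp (((n : ℝ) + 4) ^ 3)
        · rw [hExc, if_pos hr', card_cube]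
          refine p2.trans (mul_le_mul_of_nonneg_left (Real.exp_le_exp.2 (neg_le_neg
            (Real.exp_le_exp.2 ?_))) (by positivity))
          have h1 : Real.log r ≤ ((n : ℝ) + 4) ^ 3 := (Real.log_le_iff_le_exp (by linarith)).2 hr'
          have h2 : Real.log r ^ ((1 : ℝ) / 3) ≤ (n : ℝ) + 4 := by
            have h3 := Real.rpow_le_rpow (Real.log_nonneg hr) h1 (by norm_num : (0 : ℝ) ≤ 1 / 3)
            rwa [← Real.rpow_natCast, ← Real.rpow_mul (by positivity),
              show ((3 : ℕ) : ℝ) * (1 / 3) = 1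
              by norm_num, Real.rpow_one] at h3
          linarith
        · rw [hExc, if_neg hr']
          simp only [Finset.card_empty, Nat.cast_zero, zero_mul]
          positivity
      linarith
  intro N hN
  have h1 := key N hN
  have h2 : ∑ k ∈ Finset.Ico n₁ N, (1 / 2 : ℝ) ^ k ≤ 2 := by
    refine (summable_geometric_two.sum_le_tsum _ fun _ _ => by positivity).trans ?_
    rw [tsum_geometric_two]
  have h3 := mul_le_mul_of_nonneg_right h2 hE0.le
  have h4 : h + (b + 1) * ∑ k ∈ Finset.Ico n₁ N, e k ≤ h + s := by
    have h5 := mul_le_mul_of_nonneg_left (hsum (Finset.Ico n₁ N)) (by linarith : 0 ≤ b + 1)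
    have h6 : 0 ≤ s₀ * b := by positivity
    linarith
  linarith [pr_anti N hT h4]

end MultiScale

section Geometry

variable {d : ℕ}

section Reach

lemma adj_symm {x y : V d} (h : adj x y) : adj y x := by
  unfold adj at *
  rw [← h]
  exact Finset.sum_congr rfl fun i _ => by rw [← Int.natAbs_neg, neg_sub]

lemma adj_iff_abs {x y : V d} : adj x y ↔ ∑ i, |x i - y i| = 1 := by
  unfold adj
  rw [← Nat.cast_inj (R := ℤ)]
  simp

lemma adj.abs_le {x y : V d} (h : adj x y) (i : Fin d) : |x i - y i| ≤ 1 := by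
  rw [adj_iff_abs] at h
  rw [← h]
  exact Finset.single_le_sum (f := fun i => |x i - y i|) (fun _ _ => abs_nonneg _)
    (Finset.mem_univ i)

/-- The site `y` can be reached from `x` by a nearest-neighbour path in `S`. -/
def Reach (S : Set (V d)) (x y : V d) : Prop :=
  x ∈ S ∧ Relation.ReflTransGen (fun u v => adj u v ∧ v ∈ S) x y

lemma Reach.refl {S : Set (V d)} {x : V d} (h : x ∈ S) : Reach S x x := ⟨h, .refl⟩

lemma Reach.left {S : Set (V d)} {x y : V d} (h : Reach S x y) : x ∈ S := h.1

lemma Reach.right {S : Set (V d)} {x y : V d} (h : Reach S x y) : y ∈ S := by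
  obtain ⟨h1, h2⟩ := h
  induction h2 with
  | refl => exact h1
  | tail _ h _ => exact h.2

lemma Reach.trans {S : Set (V d)} {x y z : V d} (h : Reach S x y) (h' : Reach S y z) :
    Reach S x z := ⟨h.1, h.2.trans h'.2⟩

lemma Reach.tail {S : Set (V d)} {x y z : V d} (h : Reach S x y) (ha : adj y z) (hz : z ∈ S) :
    Reach S x z := ⟨h.1, h.2.tail ⟨ha, hz⟩⟩

lemma Reach.induction {S : Set (V d)} {x : V d} {Q : V d → Prop} (h0 : x ∈ S → Q x)
    (h1 : ∀ y z, Reach S x y → adj y z → z ∈ S → Q y → Q z) {y : V d} (h : Reach S x y) : Q y := by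
  obtain ⟨hx, h⟩ := h
  induction h with
  | refl => exact h0 hx
  | tail a b ih => exact h1 _ _ ⟨hx, a⟩ b.1 b.2 ih

lemma Reach.mono {S S' : Set (V d)} (hS : S ⊆ S') {x y : V d} (h : Reach S x y) : Reach S' x y :=
  ⟨hS h.1, h.2.lift id fun _ _ h => ⟨h.1, hS h.2⟩⟩

lemma Reach.symm {S : Set (V d)} {x y : V d} (h : Reach S x y) : Reach S y x :=
  h.induction (Q := fun y => Reach S y x) Reach.refl fun _ _ hy ha hz ih =>
    ((Reach.refl hz).tail (adj_symm ha) hy.right).trans ih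

lemma connIn_iff {S A B : Set (V d)} : ConnIn S A B ↔ ∃ x ∈ A, ∃ y ∈ B, Reach S x y := by
  constructor
  · rintro ⟨n, γ, h0, hn, hS, ha⟩
    refine ⟨γ 0, h0, γ n, hn, ?_⟩
    have : ∀ k, k ≤ n → Reach S (γ 0) (γ k) := by
      intro k
      induction k with
      | zero => intro _; exact Reach.refl (hS 0 (Nat.zero_le _))
      | succ k ih => intro hk; exact (ih (by omega)).tail (ha k (by omega)) (hS _ hk)
    exact this n le_rfl
  · rintro ⟨x, hx, y, hy, h⟩
    suffices ∃ (n : ℕ) (γ : ℕ → V d), γ 0 = x ∧ γ n = y ∧ (∀ k, k ≤ n → γ k ∈ S) ∧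
        ∀ k, k < n → adj (γ k) (γ (k + 1)) by
      obtain ⟨n, γ, h0, hn, h⟩ := this
      exact ⟨n, γ, h0 ▸ hx, hn ▸ hy, h⟩
    clear hy hx
    refine h.induction (Q := fun y => ∃ (n : ℕ) (γ : ℕ → V d), γ 0 = x ∧ γ n = y ∧
      (∀ k, k ≤ n → γ k ∈ S) ∧ ∀ k, k < n → adj (γ k) (γ (k + 1))) ?_ ?_
    · intro hx
      exact ⟨0, fun _ => x, rfl, rfl, fun _ _ => hx, fun _ h => absurd h (Nat.not_lt_zero _)⟩
    · rintro y z - ha hz ⟨n, γ, h0, hn, hS, hadj⟩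
      refine ⟨n + 1, fun k => if k ≤ n then γ k else z, by simp [h0], by simp, ?_, ?_⟩
      · intro k hk
        by_cases hk' : k ≤ n
        · simp only [hk', if_true]; exact hS k hk'
        · simp only [hk', if_false]; exact hz
      · intro k hk
        rcases Nat.lt_succ_iff_lt_or_eq.1 hk with hk' | rfl
        · simp only [hk'.le, Nat.succ_le_of_lt hk', if_true]; exact hadj k hk'
        · simp only [le_refl, if_true, Nat.not_succ_le_self, if_false, hn]; exact ha

lemma connIn_mono {S S' A A' B B' : Set (V d)} (hS : S ⊆ S') (hA : A ⊆ A') (hB : B ⊆ B')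
    (h : ConnIn S A B) : ConnIn S' A' B' := by
  rw [connIn_iff] at *
  obtain ⟨x, hx, y, hy, h⟩ := h
  exact ⟨x, hA hx, y, hB hy, h.mono hS⟩

lemma Reach.finite {S : Set (V d)} {x y : V d} (h : Reach S x y) :
    ∃ F : Finset (V d), (F : Set (V d)) ⊆ S ∧ Reach F x y := by
  classical
  refine h.induction (Q := fun y => ∃ F : Finset (V d), (F : Set (V d)) ⊆ S ∧ Reach F x y)
    (fun hx => ⟨{x}, by simpa using hx, Reach.refl (by simp)⟩) ?_
  rintro y z - ha hz ⟨F, hF, h⟩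
  refine ⟨insert z F, ?_, (h.mono (by simp)).tail ha (by simp)⟩
  rw [Finset.coe_insert]
  exact insert_subset hz hF

lemma incEv_connIn (A B : Set (V d)) : IncEv fun S => ConnIn S A B := by
  refine IncEv.of_finite (fun S S' hS h => connIn_mono hS le_rfl le_rfl h) fun S h => ?_
  obtain ⟨x, hx, y, hy, h⟩ := connIn_iff.1 h
  obtain ⟨F, hF, h'⟩ := h.finite
  exact ⟨F, hF, connIn_iff.2 ⟨x, hx, y, hy, h'⟩⟩

lemma localTo_reach (W : Finset (V d)) (x y : V d) : LocalTo (fun S => Reach (S ∩ W) x y) W :=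
  fun S h => by
    change Reach (S ∩ W ∩ W) x y
    rwa [inter_assoc, inter_self]

lemma incEv_reach_inter (W : Set (V d)) (x y : V d) : IncEv fun S => Reach (S ∩ W) x y := by
  refine IncEv.of_finite (fun S S' hS h => h.mono (inter_subset_inter_left W hS)) fun S h => ?_
  obtain ⟨F, hF, h'⟩ := h.finite
  exact ⟨F, hF.trans inter_subset_left,
      h'.mono (subset_inter le_rfl (hF.trans inter_subset_right))⟩

/-- A path either stays in `B` or has a first exit from `B`. -/
lemma Reach.exit {S B : Set (V d)} {x y : V d} (hx : x ∈ B) (h : Reach S x y) :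
    Reach (S ∩ B) x y ∨ ∃ z z', Reach (S ∩ B) x z ∧ adj z z' ∧ z' ∉ B := by
  refine h.induction (Q := fun y => Reach (S ∩ B) x y ∨
    ∃ z z', Reach (S ∩ B) x z ∧ adj z z' ∧ z' ∉ B) (fun h => Or.inl (.refl ⟨h, hx⟩)) ?_
  rintro y z - ha hz (h | h)
  · by_cases hzB : z ∈ B
    · exact Or.inl (h.tail ha ⟨hz, hzB⟩)
    · exact Or.inr ⟨y, z, h, ha, hzB⟩
  · exact Or.inr h

/-- A path in `S ∪ A` either stays in `S` or has a first visit to `A`. -/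
lemma Reach.first_visit {S A : Set (V d)} {x y : V d} (h : Reach (S ∪ A) x y) :
    Reach S x y ∨ ∃ z ∈ A, Reach (S ∪ {z}) x z := by
  refine h.induction (Q := fun y => Reach S x y ∨ ∃ z ∈ A, Reach (S ∪ {z}) x z) ?_ ?_
  · rintro (h | h)
    · exact Or.inl (.refl h)
    · exact Or.inr ⟨x, h, .refl (Or.inr rfl)⟩
  · rintro y z - ha hz (h | h)
    · rcases hz with hz | hz
      · exact Or.inl (h.tail ha hz)
      · exact Or.inr ⟨z, hz, (h.mono subset_union_left).tail ha (Or.inr rfl)⟩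
    · exact Or.inr h

lemma Reach.map {S S' : Set (V d)} {σ : V d → V d} (hadj : ∀ x y, adj x y → adj (σ x) (σ y))
    (hS : ∀ x ∈ S, σ x ∈ S') {x y : V d} (h : Reach S x y) : Reach S' (σ x) (σ y) :=
  h.induction (Q := fun y => Reach S' (σ x) (σ y)) (fun h => .refl (hS _ h))
    fun _ _ _ ha hz ih => ih.tail (hadj _ _ ha) (hS _ hz)

end Reach

section Boxes

lemma mem_boxAt_iff {x y : V d} {k : ℕ} : y ∈ boxAt x (k : ℝ) ↔ y ∈ cube x k := by
  rw [mem_cube]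
  refine forall_congr' fun i => ?_
  rw [abs_sub_comm (x i)]
  exact_mod_cast Iff.rfl

lemma boxAt_mono {x : V d} {r r' : ℝ} (h : r ≤ r') : boxAt x r ⊆ boxAt x r' :=
  fun _ hy i => (hy i).trans h

lemma mem_boxAt_self (x : V d) {r : ℝ} (h : 0 ≤ r) : x ∈ boxAt x r := fun i => by simpa using h

lemma bdryAt_exists_abs {x y : V d} {k : ℕ} (h : y ∈ bdryAt x (k : ℝ)) : ∃ i, |y i - x i| = k := by
  obtain ⟨h1, z, h2, h3⟩ := h
  rw [mem_boxAt_iff, mem_cube] at h1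
  rw [mem_boxAt_iff, mem_cube] at h2
  push Not at h2
  obtain ⟨i, hi⟩ := h2
  refine ⟨i, le_antisymm (by rw [abs_sub_comm]; exact h1 i) ?_⟩
  have h4 := h3.abs_le i
  have h5 := abs_sub_le (z i) (y i) (x i)
  rw [abs_sub_comm (z i), abs_sub_comm (z i)] at h5
  omega

lemma mem_bdryAt_of_abs {x y : V d} {k : ℕ} (hy : y ∈ cube x k) {i : Fin d} (h : |y i - x i| = k) :
    y ∈ bdryAt x (k : ℝ) := by
  classical
  refine ⟨mem_boxAt_iff.2 hy, ?_⟩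
  set s : ℤ := if 0 ≤ y i - x i then 1 else -1 with hs
  have hs1 : |s| = 1 := by rw [hs]; split_ifs <;> simp
  refine ⟨Function.update y i (y i + s), ?_, ?_⟩
  · rw [mem_boxAt_iff, mem_cube]
    intro hc
    have := hc i
    rw [Function.update_self] at this
    rw [hs] at this
    split_ifs at this with h0
    · rw [abs_of_nonneg h0] at h
      rw [abs_le] at this
      omega
    · push Not at h0
      rw [abs_of_neg h0] at h
      rw [abs_le] at this
      omega
  · rw [adj_iff_abs, Finset.sum_eq_single i]
    · simpa using hs1
    · intro j _ hj
      simp [Function.update_of_ne hj]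
    · simp

/-- A path which starts in a box and ends at, or beyond, its boundary meets the boundary. -/
lemma Reach.hit_bdry {S : Set (V d)} {c x y : V d} {r : ℝ} (hx : x ∈ boxAt c r) (h : Reach S x y)
    (hy : y ∈ bdryAt c r ∨ y ∉ boxAt c r) : ∃ z ∈ bdryAt c r, Reach (S ∩ boxAt c r) x z := by
  rcases h.exit hx with h1 | ⟨z, z', h1, h2, h3⟩
  · rcases hy with hy | hy
    · exact ⟨y, hy, h1⟩
    · exact absurd h1.right.2 hy
  · exact ⟨z, ⟨h1.right.2, z', h3, h2⟩, h1⟩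

lemma localTo_connIn {c : V d} {A : Set (V d)} {k : ℕ} (hA : A ⊆ boxAt c (k : ℝ)) :
    LocalTo (fun S => ConnIn S A (bdryAt c (k : ℝ))) (cube c k) := by
  intro S h
  obtain ⟨x, hx, y, hy, h⟩ := connIn_iff.1 h
  obtain ⟨z, hz, h'⟩ := h.hit_bdry (hA hx) (Or.inl hy)
  refine connIn_iff.2 ⟨x, hx, z, hz, h'.mono (inter_subset_inter_right S ?_)⟩
  exact fun u hu => Finset.mem_coe.2 (mem_boxAt_iff.1 hu)

end Boxes

section Symmetries

lemma adj_add {x y : V d} (a : V d) (h : adj x y) : adj (x + a) (y + a) := by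
  simpa [adj] using h

lemma adj_perm (e : Equiv.Perm (Fin d)) {x y : V d} (h : adj x y) : adj (x ∘ e) (y ∘ e) := by
  unfold adj at *
  rw [← h]
  exact Equiv.sum_comp e fun i => (x i - y i).natAbs

lemma adj_flip (j : Fin d) {x y : V d} (h : adj x y) : adj (flipV j x) (flipV j y) := by
  unfold adj at *
  rw [← h]
  refine Finset.sum_congr rfl fun i _ => ?_
  unfold flipV
  by_cases hi : i = j
  · subst hi; simp; omega
  · simp [hi]

end Symmetries

end Geometry

section Bridging

variable {d : ℕ}

lemma chi_mul {α : Type*} (T T' : Set (V d) → Prop) (S : α → Set (V d)) (w : α) :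
    chi T S w * chi T' S w = chi (fun S => T S ∧ T' S) S w := by
  by_cases a : T (S w)
  · by_cases b : T' (S w)
    · rw [chi_pos a, chi_pos b, chi_pos (T := fun S => T S ∧ T' S) ⟨a, b⟩, one_mul]
    · rw [chi_neg b, mul_zero, chi_neg (T := fun S => T S ∧ T' S) fun c => b c.2]
  · rw [chi_neg a, zero_mul, chi_neg (T := fun S => T S ∧ T' S) fun c => a c.1]

lemma pr_harris {n : ℕ} {h : ℝ} {T₁ T₂ T₃ : Set (V d) → Prop} (h₁ : IncEv T₁) (h₂ : IncEv T₂)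
    {y : V d} {D : ℕ} (hl : LocalTo T₂ (cube y D)) (h₃ : ∀ S, T₁ S → T₂ S → T₃ S) :
    pr n T₁ h * pr n T₂ h ≤ pr n T₃ h := by
  have hS := rset_psi (d := d) n h
  have hM := rmono_psi (d := d) n h
  have key := harris (ν := nu d) (h₁.chi_unit hS) (h₁.chi_mono hM) _ (h₂.chi_unit hS)
    (h₂.chi_mono hM) (chi_psi_dep h₂ hl h)
  simp only [chi_mul] at key
  rw [h₁.integral_chi hS, h₂.integral_chi hS, (h₁.and h₂).integral_chi hS] at key
  exact key.trans (pr_mono n (T := fun S => T₁ S ∧ T₂ S) (fun S hS => h₃ S hS.1 hS.2) h)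

lemma pr_le_sum {ι : Type*} (n : ℕ) {T : Set (V d) → Prop} (I : Finset ι)
    (T' : ι → Set (V d) → Prop) (hT : ∀ S, T S → ∃ i ∈ I, T' i S) (h : ℝ) :
    pr n T h ≤ ∑ i ∈ I, pr n (T' i) h := by
  refine le_trans (measureReal_mono (fun w hw => ?_) (measure_ne_top _ _))
    (measureReal_biUnion_finset_le I
    fun i => {w : Ix d → ℝ | T' i {x | h ≤ psi n w x}})
  obtain ⟨i, hi, h'⟩ := hT _ hw
  exact mem_biUnion (show i ∈ (I : Set ι) from hi) h'

lemma pr_map (hd : 0 < d) (n : ℕ) {σ : V d → V d} (hσ : LatSym σ) {T T' : Set (V d) → Prop}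
    (hT : IncEv T) (hTT : ∀ S, T {x | σ x ∈ S} → T' S) (h : ℝ) : pr n T h ≤ pr n T' h := by
  rw [← pr_sym hd n hσ hT h]
  exact measureReal_mono fun w hw => hTT {x | h ≤ psi n w x} hw

lemma pr_reach_map (hd : 0 < d) (n : ℕ) {σ : V d → V d} (hσ : LatSym σ)
    (hadj : ∀ x y, adj x y → adj (σ x) (σ y)) {W W' : Set (V d)} (hW : ∀ x ∈ W, σ x ∈ W')
    {x y x' y' : V d} (hx : σ x = x') (hy : σ y = y') (h : ℝ) :
    pr n (fun S => Reach (S ∩ W) x y) h ≤ pr n (fun S => Reach (S ∩ W') x' y') h := by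
  subst hx hy
  exact pr_map hd n hσ (incEv_reach_inter W x y)
    (fun S hS => Reach.map (S := {x | σ x ∈ S} ∩ W) (S' := S ∩ W') hadj
      (fun z hz => ⟨hz.1, hW z hz.2⟩) hS) h

lemma reach_of_crossing {S : Set (V d)} {m : ℕ}
    (hS : ConnIn S (box d (m : ℝ)) (bdry d (2 * (m : ℝ)))) :
    ∃ x ∈ cube (0 : V d) m, ∃ i, ∃ z ∈ cube (0 : V d) m, |z i| = m ∧
      Reach (S ∩ cube x m) x (x + z) := by
  obtain ⟨x, hx, y, hy, h⟩ := connIn_iff.1 hS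
  have hx' : x ∈ cube (0 : V d) m := mem_boxAt_iff.1 hx
  have e2 : (2 * (m : ℝ)) = ((2 * m : ℕ) : ℝ) := by push_cast; ring
  rw [bdry, e2] at hy
  obtain ⟨i, hi⟩ := bdryAt_exists_abs hy
  have h1 : y ∈ bdryAt x (m : ℝ) ∨ y ∉ boxAt x (m : ℝ) := by
    by_cases hyx : y ∈ boxAt x (m : ℝ)
    · left
      have h2 := mem_boxAt_iff.1 hyx
      refine mem_bdryAt_of_abs h2 (i := i) ?_
      have h3 := mem_cube.1 h2 i
      have h4 := mem_cube.1 hx' i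
      simp only [Pi.zero_apply, sub_zero, zero_sub, abs_neg] at hi h4
      push_cast at hi
      have h5 := abs_sub_abs_le_abs_sub (y i) (x i)
      rw [abs_sub_comm] at h3
      omega
    · exact Or.inr hyx
  obtain ⟨z, hz, hr⟩ := h.hit_bdry (mem_boxAt_self x (Nat.cast_nonneg m)) h1
  obtain ⟨j, hj⟩ := bdryAt_exists_abs hz
  have hz' := mem_cube.1 (mem_boxAt_iff.1 hz.1)
  refine ⟨x, hx', j, z - x, ?_, by simpa using hj, ?_⟩
  · rw [mem_cube]
    intro l
    simpa [abs_sub_comm] using hz' l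
  · rw [add_sub_cancel]
    exact hr.mono (inter_subset_inter_right S fun u hu => Finset.mem_coe.2 (mem_boxAt_iff.1 hu))

/-- A lower bound on the one-arm event, towards a well-chosen point of each face. -/
lemma exists_face_point (hd : 0 < d) {n m : ℕ} {h p : ℝ} (hp : 0 < p)
    (hc : p ≤ pr n (fun S => ConnIn S (box d (m : ℝ)) (bdry d (2 * (m : ℝ)))) h) (i : Fin d) :
    ∃ z : V d, z i = m ∧ p / ((2 * m + 1) ^ d * d * (2 * m + 1) ^ d) ≤
      pr n (fun S => Reach (S ∩ cube (0 : V d) m) 0 z) h := by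
  set κ := p / ((2 * m + 1) ^ d * d * (2 * m + 1) ^ d) with hκ
  have hd' : (0 : ℝ) < d := by exact_mod_cast hd
  have hκ0 : 0 < κ := by positivity
  have h1 := hc.trans (pr_le_sum n (cube (0 : V d) m ×ˢ (Finset.univ : Finset (Fin d)) ×ˢ
    cube (0 : V d) m) (fun t S => |t.2.2 t.2.1| = m ∧ Reach (S ∩ cube t.1 m) t.1 (t.1 + t.2.2))
    (fun S hS => by
      obtain ⟨x, hx, i, z, hz, h⟩ := reach_of_crossing hS
      exact ⟨(x, i, z), by simp [hx, hz], h⟩) h)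
  have h2 : ∑ _t ∈ cube (0 : V d) m ×ˢ (Finset.univ : Finset (Fin d)) ×ˢ cube (0 : V d) m, κ =
      p := by
    rw [Finset.sum_const, Finset.card_product, Finset.card_product, card_cube, Finset.card_univ,
      Fintype.card_fin, nsmul_eq_mul, hκ]
    push_cast
    field_simp
  have hne : (cube (0 : V d) m ×ˢ (Finset.univ : Finset (Fin d)) ×ˢ cube (0 : V d) m).Nonempty :=
    ⟨(0, ⟨0, hd⟩, 0), by simp [mem_cube]⟩
  obtain ⟨⟨x, j, z⟩, -, h3⟩ := Finset.exists_le_of_sum_le hne (h2.trans_le h1)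
  simp only at h3
  by_cases hz : |z j| = m
  swap
  · simp [pr, hz] at h3
    linarith
  have h4 : κ ≤ pr n (fun S => Reach (S ∩ cube (0 : V d) m) 0 z) h := by
    refine (h3.trans (pr_mono n (fun S hS => hS.2) h)).trans
      (pr_reach_map hd n (latSym_add (-x)) (fun _ _ => adj_add _) ?_ (by simp) (by simp) h)
    intro u hu
    rw [Finset.mem_coe, mem_cube] at hu ⊢
    intro l
    simpa [sub_eq_add_neg, add_comm] using hu l
  obtain ⟨z', hz', h5⟩ : ∃ z' : V d, z' j = m ∧
      κ ≤ pr n (fun S => Reach (S ∩ cube (0 : V d) m) 0 z') h := by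
    rcases abs_choice (z j) with hc | hc
    · exact ⟨z, by rw [← hc, hz], h4⟩
    · refine ⟨flipV j z, by simp only [flipV, if_true]; rw [← hc, hz], h4.trans
        (pr_reach_map hd n (latSym_flip j) (fun _ _ => adj_flip j) ?_ ?_ rfl h)⟩
      · intro u hu
        rw [Finset.mem_coe, mem_cube] at hu ⊢
        intro l
        have := hu l
        simp only [Pi.zero_apply, zero_sub, abs_neg, flipV] at this ⊢
        split_ifs <;> simpa using this
      · ext l; simp [flipV]
  have hcube : ∀ u ∈ ((cube (0 : V d) m : Finset (V d)) : Set (V d)),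
      u ∘ Equiv.swap i j ∈ ((cube (0 : V d) m : Finset (V d)) : Set (V d)) := by
    intro u hu
    rw [Finset.mem_coe, mem_cube] at hu ⊢
    intro l
    have := hu (Equiv.swap i j l)
    simpa only [Pi.zero_apply, Function.comp_apply] using this
  have hzero : (0 : V d) ∘ Equiv.swap i j = 0 := funext fun _ => rfl
  refine ⟨z' ∘ Equiv.swap i j, by simpa using hz', h5.trans ?_⟩
  exact pr_reach_map hd n (latSym_perm (Equiv.swap i j)) (fun _ _ => adj_perm _) hcube hzero rfl h

lemma axis_lower_bound (hd : 0 < d) {n m k : ℕ} {h p : ℝ} (hp : 0 < p) (hm : m = (k + 1) / 2)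
    (hc : p ≤ pr n (fun S => ConnIn S (box d (m : ℝ)) (bdry d (2 * (m : ℝ)))) h) (i : Fin d) :
    (p / ((2 * m + 1) ^ d * d * (2 * m + 1) ^ d)) ^ 2 ≤
      pr n (fun S => Reach (S ∩ cube (0 : V d) (3 * m)) 0 (Pi.single i (k : ℤ))) h := by
  obtain ⟨z, hz, h1⟩ := exists_face_point hd hp hc i
  set σ : V d → V d := fun x => flipV i x + Pi.single i (k : ℤ) with hσ
  have hσs : LatSym σ := (latSym_add (Pi.single i (k : ℤ))).comp (latSym_flip i)
  have h0 : σ 0 = Pi.single i (k : ℤ) := by ext l; simp [hσ, flipV]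
  have h2 : pr n (fun S => Reach (S ∩ cube (0 : V d) m) 0 z) h ≤
      pr n (fun S => Reach (S ∩ cube (0 : V d) (3 * m)) (Pi.single i (k : ℤ)) (σ z)) h := by
    refine pr_reach_map hd n hσs (fun _ _ ha => adj_add _ (adj_flip i ha)) ?_ h0 rfl h
    intro u hu
    rw [Finset.mem_coe, mem_cube] at hu ⊢
    intro l
    have := hu l
    simp only [Pi.zero_apply, zero_sub, abs_neg, hσ, Pi.add_apply, flipV] at this ⊢
    rw [abs_le] at this ⊢
    by_cases hl : l = i
    · subst hl; simp; omega
    · simp [hl]; omega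
  have hκ : 0 ≤ p / ((2 * m + 1) ^ d * d * (2 * m + 1) ^ d) := by positivity
  calc _ ≤ pr n (fun S => Reach (S ∩ cube (0 : V d) m) 0 z) h *
        pr n (fun S => Reach (S ∩ cube (0 : V d) (3 * m)) (Pi.single i (k : ℤ)) (σ z)) h := by
        rw [pow_two]
        exact mul_le_mul h1 (h1.trans h2) hκ (pr_nonneg _ _ _)
    _ ≤ _ := by
        refine pr_harris (incEv_reach_inter _ _ _) (incEv_reach_inter _ _ _)
          (localTo_reach (cube (0 : V d) (3 * m)) _ _) fun S hS hS' => ?_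
        have hS2 := hS.mono (S' := S ∩ cube (0 : V d) (3 * m)) (inter_subset_inter_right S
          (Finset.coe_subset.2 (cube_mono (by omega))))
        have hS3 := hS'.symm
        by_cases he : σ z = z
        · rw [he] at hS3
          exact hS2.trans hS3
        · refine (hS2.tail ?_ hS3.left).trans hS3
          rw [adj_iff_abs, Finset.sum_eq_single i]
          · by_contra hne
            refine he (funext fun l => ?_)
            by_cases hl : l = i
            · subst hl
              simp only [hσ, flipV, Pi.add_apply, if_true, Pi.single_eq_same] at hne ⊢
              rw [Int.abs_eq_natAbs] at hne
              omega
            · simp [hσ, flipV, hl]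
          · intro l _ hl
            simp [hσ, flipV, hl]
          · simp

lemma axis_pair (hd : 0 < d) {n K D : ℕ} {h κ : ℝ} {i : Fin d} (hK : 1 ≤ K)
    (hκ : ∀ k, 1 ≤ k → k ≤ K →
      κ ≤ pr n (fun S => Reach (S ∩ cube (0 : V d) D) 0 (Pi.single i (k : ℤ))) h)
    (x : V d) (t : ℤ) (ht : |t - x i| ≤ K) :
    κ ≤ pr n (fun S => Reach (S ∩ cube x (D + K)) x (Function.update x i t)) h := by
  have key : ∀ (x : V d) (k : ℕ), 1 ≤ k → k ≤ K →
      κ ≤ pr n (fun S => Reach (S ∩ cube x D) x (Function.update x i (x i + k))) h := by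
    intro x k h1 h2
    refine (hκ k h1 h2).trans (pr_reach_map hd n (latSym_add x) (fun _ _ => adj_add _) ?_
      (by simp) ?_ h)
    · intro u hu
      rw [Finset.mem_coe, mem_cube] at hu ⊢
      intro l
      simpa using hu l
    · ext l
      by_cases hl : l = i
      · subst hl; simp [add_comm]
      · simp [hl]
  have hsub : ((cube x D : Finset (V d)) : Set (V d)) ⊆ cube x (D + K) :=
    Finset.coe_subset.2 (cube_mono (Nat.le_add_right _ _))
  rcases lt_trichotomy (x i) t with hlt | heq | hgt
  · have := key x (t - x i).toNat (by omega) (by rw [abs_le] at ht; omega)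
    rw [Int.toNat_of_nonneg (by omega), add_sub_cancel] at this
    exact this.trans (pr_mono n (fun S hS => hS.mono (inter_subset_inter_right S hsub)) h)
  · subst heq
    rw [Function.update_eq_self]
    exact (key x 1 le_rfl hK).trans (pr_mono n (fun S hS =>
      Reach.refl (inter_subset_inter_right S hsub hS.left)) h)
  · have := key (Function.update x i t) (x i - t).toNat (by omega)
      (by rw [abs_le] at ht; omega)
    rw [Int.toNat_of_nonneg (by omega), Function.update_self, add_sub_cancel,
      Function.update_idem, Function.update_eq_self] at this
    refine this.trans (pr_mono n (fun S hS => hS.symm.mono (inter_subset_inter_right S ?_)) h)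
    rw [add_comm]
    refine Finset.coe_subset.2 (cube_subset_cube ?_)
    rw [mem_cube]
    intro l
    by_cases hl : l = i
    · subst hl; simpa [abs_sub_comm] using ht
    · simp [hl]

/-- A lower bound on the two-point function inside a box, from the crossing probabilities. -/
theorem two_point (hd : 0 < d) {n M : ℕ} {h p : ℝ} (hp : 0 < p) (hM : 1 ≤ M)
    (hc : ∀ m, 1 ≤ m → m ≤ M →
      p ≤ pr n (fun S => ConnIn S (box d (m : ℝ)) (bdry d (2 * (m : ℝ)))) h)
    (c y₁ y₂ : V d) (h₁ : y₁ ∈ cube c M) (h₂ : y₂ ∈ cube c M) :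
    ((p / ((2 * M + 1) ^ d * d * (2 * M + 1) ^ d)) ^ 2) ^ (d + 1) ≤
      pr n (fun S => Reach (S ∩ cube c (6 * M)) y₁ y₂) h := by
  set κ := (p / ((2 * (M : ℝ) + 1) ^ d * d * (2 * M + 1) ^ d)) ^ 2 with hκ
  have hd' : (0 : ℝ) < d := by exact_mod_cast hd
  have hκ0 : 0 ≤ κ := by positivity
  have hax : ∀ (i : Fin d) (k : ℕ), 1 ≤ k → k ≤ 2 * M →
      κ ≤ pr n (fun S => Reach (S ∩ cube (0 : V d) (3 * M)) 0 (Pi.single i (k : ℤ))) h := by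
    intro i k h1 h2
    have hmM : (k + 1) / 2 ≤ M := by omega
    refine le_trans ?_ ((axis_lower_bound hd hp rfl (hc ((k + 1) / 2) (by omega) hmM) i).trans
      (pr_mono n (fun S hS => hS.mono (inter_subset_inter_right S
        (Finset.coe_subset.2 (cube_mono (by omega))))) h))
    have : (((k + 1) / 2 : ℕ) : ℝ) ≤ M := by exact_mod_cast hmM
    rw [hκ]
    gcongr
  have hpair : ∀ (i : Fin d) (x : V d) (t : ℤ), x ∈ cube c M → |t - x i| ≤ 2 * M →
      κ ≤ pr n (fun S => Reach (S ∩ cube c (6 * M)) x (Function.update x i t)) h := by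
    intro i x t hx ht
    refine (axis_pair hd (K := 2 * M) (by omega) (hax i) x t (by push_cast; exact ht)).trans
      (pr_mono n (fun S hS => hS.mono (inter_subset_inter_right S ?_)) h)
    refine Finset.coe_subset.2 ((cube_subset_cube hx).trans (cube_mono (by omega)))
  set q : ℕ → V d := fun j l => if (l : ℕ) < j then y₂ l else y₁ l with hq
  have hqc : ∀ j, q j ∈ cube c M := fun j => by
    rw [mem_cube] at *
    intro l
    simp only [hq]
    split_ifs
    exacts [h₂ l, h₁ l]
  have key : ∀ j, j ≤ d → κ ^ (j + 1) ≤ pr n (fun S => Reach (S ∩ cube c (6 * M)) y₁ (q j)) h := by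
    intro j
    induction j with
    | zero =>
      intro _
      have e : q 0 = Function.update y₁ ⟨0, hd⟩ (y₁ ⟨0, hd⟩) := by
        rw [Function.update_eq_self]; ext l; simp [hq]
      rw [e, zero_add, pow_one]
      exact hpair _ _ _ h₁ (by simp)
    | succ j ih =>
      intro hj
      have e : q (j + 1) = Function.update (q j) ⟨j, hj⟩ (y₂ ⟨j, hj⟩) := by
        ext l
        by_cases hl : l = ⟨j, hj⟩
        · subst hl; simp [hq]
        · rw [Function.update_of_ne hl]
          have : (l : ℕ) ≠ j := fun h => hl (Fin.ext h)
          simp only [hq]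
          by_cases hlt : (l : ℕ) < j
          · rw [if_pos hlt, if_pos (by omega)]
          · rw [if_neg hlt, if_neg (by omega)]
      have h3 := hpair ⟨j, hj⟩ (q j) (y₂ ⟨j, hj⟩) (hqc j) (by
        have a := mem_cube.1 (hqc j) ⟨j, hj⟩
        have b := mem_cube.1 h₂ ⟨j, hj⟩
        rw [abs_le] at a b ⊢
        omega)
      rw [← e] at h3
      calc κ ^ (j + 1 + 1) = κ ^ (j + 1) * κ := pow_succ _ _
        _ ≤ _ := mul_le_mul (ih (by omega)) h3 hκ0 (pr_nonneg _ _ _)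
        _ ≤ _ := pr_harris (incEv_reach_inter _ _ _) (incEv_reach_inter _ _ _)
            (localTo_reach _ _ _) fun S hS hS' => hS.trans hS'
  have e : q d = y₂ := by ext l; simp [hq]
  have := key d le_rfl
  rwa [e] at this

end Bridging

section Pasting

variable {d : ℕ}

lemma growth_mono {a b : ℝ} (h : a ≤ b) (n : ℕ) : growth a n ≤ growth b n :=
  Real.exp_le_exp.2 (mul_le_mul_of_nonneg_right h (by positivity))

lemma growth_pos (a : ℝ) (n : ℕ) : 0 < growth a n := Real.exp_pos _

lemma poly_le_growth (K : ℝ) (k : ℕ) : ∃ a : ℝ, 1 ≤ a ∧ ∀ n : ℕ, K * (2 ^ n) ^ k ≤ growth a n := by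
  refine ⟨1 + |K| + k, by have := abs_nonneg K; have : (0 : ℝ) ≤ k := Nat.cast_nonneg k; linarith,
    fun n => ?_⟩
  have h1 : (2 : ℝ) ^ n ≤ Real.exp n := by
    rw [← Real.exp_one_pow]
    exact pow_le_pow_left₀ (by norm_num) (by have := Real.add_one_le_exp 1; linarith) n
  have h2 : K ≤ Real.exp |K| := by
    have := Real.add_one_le_exp |K|
    linarith [le_abs_self K]
  have hn : (0 : ℝ) ≤ n := Nat.cast_nonneg n
  have hc : (n : ℝ) + 1 ≤ ((n : ℝ) + 1) ^ 3 := by nlinarith [pow_nonneg hn 3, pow_nonneg hn 2]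
  calc K * (2 ^ n) ^ k ≤ Real.exp |K| * (Real.exp n) ^ k := by gcongr
    _ = Real.exp (|K| + k * n) := by rw [← Real.exp_nat_mul, ← Real.exp_add]
    _ ≤ growth (1 + |K| + k) n := by
        refine Real.exp_le_exp.2 ?_
        have hK := abs_nonneg K
        have hk : (0 : ℝ) ≤ k := Nat.cast_nonneg k
        calc |K| + k * (n : ℝ) ≤ (1 + |K| + k) * ((n : ℝ) + 1) := by nlinarith [mul_nonneg hK hn]
          _ ≤ _ := mul_le_mul_of_nonneg_left hc (by positivity)

lemma eventually_err (K a c θ : ℝ) (k : ℕ) (hK : 0 < K) (hc : 0 < c) (hθ : 0 < θ) :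
    ∀ᶠ n : ℕ in atTop, K * growth a n ^ k * Real.exp (-(c * Real.sqrt (2 ^ n))) ≤ θ := by
  have h1 := (tendsto_pow_atTop_nhds_zero_of_lt_one (r := (1 / 2 : ℝ)) (by norm_num)
    (by norm_num)).eventually_le_const hθ
  filter_upwards [h1, eventually_small K c a k hK hc] with n h2 h3
  have h4 : Real.exp ((n : ℝ) / 10) ≤ Real.sqrt (2 ^ n) := by
    refine le_trans (Real.exp_le_exp.2 ?_) (exp_le_sqrt_two_pow n)
    have hn : (0 : ℝ) ≤ n := Nat.cast_nonneg n
    linarith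
  calc K * growth a n ^ k * Real.exp (-(c * Real.sqrt (2 ^ n))) ≤
        K * growth a n ^ k * Real.exp (-(c * Real.exp (n / 10))) := by
        have := growth_pos a n
        gcongr
    _ ≤ (1 / 2) ^ n * Real.exp (-Real.exp ((n + 4) / 20)) := h3
    _ ≤ (1 / 2) ^ n * 1 := by
        refine mul_le_mul_of_nonneg_left ?_ (by positivity)
        rw [Real.exp_le_one_iff]
        linarith [Real.exp_pos (((n : ℝ) + 4) / 20)]
    _ ≤ θ := by rwa [mul_one]

/-- Insertion of a block for connection events. -/
lemma absorb_connIn (hd : 0 < d) {n : ℕ} {h p : ℝ} (hp : 0 < p)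
    (hc : ∀ m : ℕ, 1 ≤ m → m ≤ 3 * 2 ^ n →
      p ≤ pr n (fun S => ConnIn S (box d (m : ℝ)) (bdry d (2 * (m : ℝ)))) h)
    (A B : Set (V d)) (v : V d) :
    Absorb n (fun S => ConnIn S A B) v (6 * (3 * 2 ^ n)) ((6 * 2 ^ n + 1) ^ (2 * d))
      (((p / ((2 * (3 * 2 ^ n : ℕ) + 1) ^ d * d * (2 * (3 * 2 ^ n : ℕ) + 1) ^ d)) ^ 2) ^ (d + 1))
      h := by
  refine ⟨lam n v ×ˢ lam n v, fun j S => ConnIn (S ∪ {j.1}) A {j.1} ∧ ConnIn (S ∪ {j.2}) {j.2} B,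
    fun j S => Reach (S ∩ cube (ctr n v) (6 * (3 * 2 ^ n))) j.1 j.2, ?_, ?_, ?_⟩
  · rw [Finset.card_product, two_mul, pow_add]
    exact Nat.mul_le_mul (card_lam n v) (card_lam n v)
  · rintro ⟨y₁, y₂⟩ hj
    rw [Finset.mem_product] at hj
    refine ⟨((incEv_connIn A {y₁}).union {y₁}).and ((incEv_connIn {y₂} B).union {y₂}),
      incEv_reach_inter _ _ _, localTo_reach _ _ _, ?_, ?_⟩
    · have h3 : 1 ≤ 3 * 2 ^ n := by have := Nat.one_le_two_pow (n := n); omega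
      exact two_point hd hp h3 hc (ctr n v) y₁ y₂ (lam_subset n v hj.1) (lam_subset n v hj.2)
    · rintro S ⟨h1, h2⟩ h3
      have e1 : S ∪ {y₁} = S := by
        rw [union_eq_self_of_subset_right]; simpa using h3.left.1
      have e2 : S ∪ {y₂} = S := by
        rw [union_eq_self_of_subset_right]; simpa using h3.right.1
      simp only [e1, e2] at h1 h2
      obtain ⟨x, hx, z, rfl, h4⟩ := connIn_iff.1 h1
      obtain ⟨z', rfl, y, hy, h5⟩ := connIn_iff.1 h2
      exact connIn_iff.2 ⟨x, hx, y, hy, (h4.trans (h3.mono inter_subset_left)).trans h5⟩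
  · intro S hS
    obtain ⟨x, hx, y, hy, h⟩ := connIn_iff.1 hS
    rcases h.first_visit with h1 | ⟨z, hz, h1⟩
    · exact Or.inl (connIn_iff.2 ⟨x, hx, y, hy, h1⟩)
    rcases h.symm.first_visit with h2 | ⟨z', hz', h2⟩
    · exact Or.inl (connIn_iff.2 ⟨x, hx, y, hy, h2.symm⟩)
    exact Or.inr ⟨(z, z'), Finset.mem_product.2 ⟨hz, hz'⟩, connIn_iff.2 ⟨x, hx, z, rfl, h1⟩,
      connIn_iff.2 ⟨z', rfl, y, hy, h2.symm⟩⟩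

lemma boxAt_sub {c x : V d} {k : ℕ} (h : x ∈ boxAt c (k : ℝ)) : x - c ∈ box d (k : ℝ) := by
  intro i
  simpa using h i

lemma bdryAt_sub {c x : V d} {k : ℕ} (h : x ∈ bdryAt c (k : ℝ)) : x - c ∈ bdry d (k : ℝ) := by
  obtain ⟨i, hi⟩ := bdryAt_exists_abs h
  exact mem_bdryAt_of_abs (mem_boxAt_iff.1 (boxAt_sub h.1)) (i := i) (by simpa using hi)

/-- Insertion of a block for disconnection events. -/
lemma absorb_dual (hd : 0 < d) {n ρ : ℕ} (hρ : 2 ^ (n + 2) ≤ ρ) {h κ : ℝ}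
    (hκ : κ ≤ pr n (fun S => ¬ ConnIn Sᶜ (box d ((2 ^ (n + 2) : ℕ) : ℝ)) (bdry d (ρ : ℝ))) h)
    {r R : ℕ} (hrR : 2 * r ≤ R) {v : V d} (hv : ¬ (r ≤ 2 * ρ ∧ ∀ i, |ctr n v i| ≤ 3 * ρ)) :
    Absorb n (fun S => ¬ ConnIn Sᶜ (box d (r : ℝ)) (bdry d (R : ℝ))) v ρ 1 κ h := by
  refine ⟨{(v, v)}, fun _ S => ¬ ConnIn (S ∪ lam n v)ᶜ (box d (r : ℝ)) (bdry d (R : ℝ)),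
    fun _ S => ¬ ConnIn Sᶜ (boxAt (ctr n v) ((2 ^ (n + 2) : ℕ) : ℝ)) (bdryAt (ctr n v) (ρ : ℝ)),
    by simp, ?_, fun S hS => Or.inr ⟨(v, v), by simp, hS⟩⟩
  intro j _
  have hbox : boxAt (ctr n v) ((2 ^ (n + 2) : ℕ) : ℝ) ⊆ boxAt (ctr n v) (ρ : ℝ) :=
    boxAt_mono (by exact_mod_cast hρ)
  refine ⟨(incEv_connIn _ _).dual.union _, (incEv_connIn _ _).dual,
    (localTo_connIn hbox).dual (incEv_connIn _ _).mono, hκ.trans ?_, ?_⟩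
  · change _ ≤ pr n (fun S => ¬ ConnIn Sᶜ (boxAt (ctr n v) ((2 ^ (n + 2) : ℕ) : ℝ))
      (bdryAt (ctr n v) (ρ : ℝ))) h
    refine pr_map hd n (latSym_add (ctr n v))
      (T' := fun S => ¬ ConnIn Sᶜ (boxAt (ctr n v) ((2 ^ (n + 2) : ℕ) : ℝ))
        (bdryAt (ctr n v) (ρ : ℝ))) (incEv_connIn _ _).dual (fun S hS hc => hS ?_) h
    obtain ⟨x, hx, y, hy, hr⟩ := connIn_iff.1 hc
    refine connIn_iff.2 ⟨x - ctr n v, boxAt_sub hx, y - ctr n v, bdryAt_sub hy, ?_⟩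
    simp only [sub_eq_add_neg]
    refine Reach.map (S := Sᶜ) (S' := {x | x + ctr n v ∈ S}ᶜ) (σ := fun x => x + -ctr n v)
      (fun _ _ => adj_add _) (fun u hu hc => hu ?_) hr
    simpa using hc
  · intro S hg hF hc
    refine hv ?_
    obtain ⟨x, hx, y, hy, hr⟩ := connIn_iff.1 hc
    have hr' : Reach ((Sᶜ ∩ (lam n v : Set (V d))ᶜ) ∪ (Sᶜ ∩ (lam n v : Set (V d)))) x y := by
      rwa [union_comm, inter_union_compl]
    rcases hr'.first_visit with h1 | ⟨z, hz, h1⟩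
    · refine absurd (connIn_iff.2 ⟨x, hx, y, hy, h1⟩) ?_
      rwa [← compl_union]
    have h2 : Reach Sᶜ x z := h1.mono (union_subset inter_subset_left (by simpa using hz.1))
    have hzb : z ∈ boxAt (ctr n v) ((2 ^ (n + 2) : ℕ) : ℝ) :=
      mem_boxAt_iff.2 (cube_mono (by rw [pow_add]; omega) (lam_subset n v hz.2))
    have h3 : ∀ u, Reach Sᶜ z u → u ∈ cube (ctr n v) ρ := by
      intro u hu
      by_contra hcon
      obtain ⟨u', hu', h4⟩ := hu.hit_bdry (hbox hzb)
        (Or.inr fun h => hcon (mem_boxAt_iff.1 h))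
      exact hF (connIn_iff.2 ⟨z, hzb, u', hu', h4.mono inter_subset_left⟩)
    have hxc := mem_cube.1 (h3 x h2.symm)
    have hyc := mem_cube.1 (h3 y (h2.symm.trans hr))
    have hx0 := mem_cube.1 (mem_boxAt_iff.1 hx)
    obtain ⟨i, hi⟩ := bdryAt_exists_abs hy
    simp only [Pi.zero_apply, sub_zero, zero_sub, abs_neg] at hx0 hi
    have hrρ : r ≤ 2 * ρ := by
      have a := hxc i
      have b := hyc i
      have c := hx0 i
      rw [abs_le] at a b c
      rcases abs_cases (y i) with h | h <;> omega
    refine ⟨hrρ, fun l => ?_⟩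
    have a := hxc l
    have c := hx0 l
    rw [abs_le] at a c ⊢
    omega

end Pasting

section Decoupling

lemma Splits.neg {d : ℕ} {Ω : Type*} [MeasurableSpace Ω] {P : Measure Ω}
    {φ : V d → Ω → ℝ} (h : Splits P φ) : Splits P fun x ω => -φ x ω := by
  intro n
  obtain ⟨φL, h1, h2⟩ := h n
  refine ⟨fun x ω => -φL x ω, h1.neg, ?_⟩
  convert h2.neg using 3
  ring

variable {d : ℕ} {Ω : Type*} [MeasurableSpace Ω] {P : Measure Ω} [IsProbabilityMeasure P]

/-- Crossing probabilities bounded below at level `h` are inherited by the truncated fields. -/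
lemma crossing_lower_bound (hd : 3 ≤ d) {φ : V d → Ω → ℝ} (hs : Splits P φ) {h : ℝ}
    (hh : (⨅ R : ℕ, P {ω | ConnIn (lvl φ h ω) (box d ((R : ℝ) + 1))
      (bdry d (2 * ((R : ℝ) + 1)))}) ≠ 0) {η : ℝ} (hη : 0 < η) :
    ∃ p : ℝ, 0 < p ∧ ∃ n₁ : ℕ, ∀ n, n₁ ≤ n → ∀ m : ℕ, 1 ≤ m → m ≤ 3 * 2 ^ n →
      p ≤ pr n (fun S => ConnIn S (box d (m : ℝ)) (bdry d (2 * (m : ℝ)))) (h - η) := by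
  obtain ⟨c, hc, ht⟩ := transfer (P := P) hd
  set q : ENNReal := ⨅ R : ℕ, P {ω | ConnIn (lvl φ h ω) (box d ((R : ℝ) + 1))
      (bdry d (2 * ((R : ℝ) + 1)))} with hq
  have hq1 : q ≠ ⊤ := ne_top_of_le_ne_top (measure_ne_top P _) (iInf_le _ 0)
  have hq0 : 0 < q.toReal := ENNReal.toReal_pos hh hq1
  have hlow : ∀ m : ℕ, 1 ≤ m → q.toReal ≤
      P.real {ω | ConnIn (lvl φ h ω) (box d (m : ℝ)) (bdry d (2 * (m : ℝ)))} := by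
    intro m hm
    obtain ⟨k, rfl⟩ : ∃ k, m = k + 1 := ⟨m - 1, by omega⟩
    push_cast
    exact ENNReal.toReal_mono (measure_ne_top _ _) (iInf_le _ k)
  obtain ⟨n₁, hn₁⟩ := eventually_atTop.1 (eventually_err (13 ^ d) 1 (c * η ^ 2) (q.toReal / 2) d
    (by positivity) (by positivity) (by positivity))
  refine ⟨q.toReal / 2, by positivity, n₁, fun n hn m hm hmn => ?_⟩
  have hloc :
      LocalTo (fun S => ConnIn S (box d (m : ℝ)) (bdry d (2 * (m : ℝ)))) (cube 0 (2 * m)) := by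
    have := localTo_connIn (c := (0 : V d)) (A := box d (m : ℝ)) (k := 2 * m)
      (boxAt_mono (by push_cast; linarith [(Nat.cast_nonneg m : (0 : ℝ) ≤ m)]))
    simpa [bdry] using this
  have h1 := (ht hs (incEv_connIn _ _) hloc n (h - η) hη.le).1
  simp only [sub_add_cancel] at h1
  have h2 := hlow m hm
  have h3 : ((cube (0 : V d) (2 * m)).card : ℝ) ≤ 13 ^ d * growth 1 n ^ d := by
    rw [card_cube, ← mul_pow]
    push_cast
    refine pow_le_pow_left₀ (by positivity) ?_ d
    have e1 : (m : ℝ) ≤ 3 * 2 ^ n := by exact_mod_cast hmn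
    have e2 := two_pow_le_growth (le_refl (1 : ℝ)) n
    have e3 := one_le_growth (zero_le_one (α := ℝ)) n
    linarith
  have h4 : ((cube (0 : V d) (2 * m)).card : ℝ) * Real.exp (-(c * η ^ 2 * Real.sqrt (2 ^ n))) ≤
      q.toReal / 2 :=
    (mul_le_mul_of_nonneg_right h3 (Real.exp_pos _).le).trans (hn₁ n hn)
  linarith

/-- The radius of the annuli used for disconnection at scale `n`. -/
def dualRad (n : ℕ) : ℕ := ⌈Real.exp (((n : ℝ) + 2) ^ 3)⌉₊

lemma le_dualRad (n : ℕ) : Real.exp (((n : ℝ) + 2) ^ 3) ≤ dualRad n := Nat.le_ceil _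

lemma dualRad_le (n : ℕ) : (dualRad n : ℝ) ≤ 2 * Real.exp (((n : ℝ) + 2) ^ 3) := by
  have h1 := (Nat.ceil_lt_add_one (Real.exp_pos (((n : ℝ) + 2) ^ 3)).le).le
  have h2 : 1 ≤ Real.exp (((n : ℝ) + 2) ^ 3) := Real.one_le_exp (by positivity)
  unfold dualRad
  linarith

lemma dualRad_le_growth (n : ℕ) : (dualRad n : ℝ) ≤ 2 * growth 8 n := by
  refine (dualRad_le n).trans (mul_le_mul_of_nonneg_left (Real.exp_le_exp.2 ?_) two_pos.le)
  have hn : (0 : ℝ) ≤ n := Nat.cast_nonneg n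
  calc ((n : ℝ) + 2) ^ 3 ≤ (2 * ((n : ℝ) + 1)) ^ 3 := by gcongr; linarith
    _ = 8 * ((n : ℝ) + 1) ^ 3 := by ring

lemma two_pow_le_exp (n : ℕ) : (2 : ℝ) ^ n ≤ Real.exp n := by
  rw [← Real.exp_one_pow]
  exact pow_le_pow_left₀ (by norm_num) (by have := Real.add_one_le_exp 1; linarith) n

lemma two_pow_le_ufn (n : ℕ) : ((2 ^ (n + 2) : ℕ) : ℝ) ≤ ufn (dualRad n) := by
  push_cast
  refine (two_pow_le_exp (n + 2)).trans (Real.exp_le_exp.2 ?_)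
  have h1 : ((n : ℝ) + 2) ^ 3 ≤ Real.log (dualRad n) := by
    rw [← Real.log_exp (((n : ℝ) + 2) ^ 3)]
    exact Real.log_le_log (Real.exp_pos _) (le_dualRad n)
  have h2 : (((n : ℝ) + 2) ^ 3) ^ ((1 : ℝ) / 3) = (n : ℝ) + 2 := by
    rw [← Real.rpow_natCast, ← Real.rpow_mul (by positivity)]
    norm_num
  calc ((n + 2 : ℕ) : ℝ) = (((n : ℝ) + 2) ^ 3) ^ ((1 : ℝ) / 3) := by rw [h2]; push_cast; ring
    _ ≤ _ := Real.rpow_le_rpow (by positivity) h1 (by norm_num)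

lemma two_pow_le_dualRad (n : ℕ) : 2 ^ (n + 2) ≤ dualRad n := by
  have h1 : ((2 ^ (n + 2) : ℕ) : ℝ) ≤ dualRad n := by
    push_cast
    refine (two_pow_le_exp (n + 2)).trans (le_trans (Real.exp_le_exp.2 ?_) (le_dualRad n))
    have hn : (0 : ℝ) ≤ n := Nat.cast_nonneg n
    push_cast
    nlinarith [pow_nonneg hn 3, pow_nonneg hn 2]
  exact_mod_cast h1

lemma one_le_dualRad (n : ℕ) : 1 ≤ dualRad n := Nat.one_le_two_pow.trans (two_pow_le_dualRad n)

/-- Disconnection probabilities bounded below at level `h` are inherited by the truncations of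
the opposite field. -/
lemma disconnection_lower_bound (hd : 3 ≤ d) {φ : V d → Ω → ℝ} (hs : Splits P φ) {h : ℝ}
    (hh : h ∉ tildeSet d P φ) {η : ℝ} (hη : 0 < η) :
    ∃ p : ℝ, 0 < p ∧ ∃ n₁ : ℕ, ∀ n, n₁ ≤ n →
      p / (dualRad n : ℝ) ^ d ≤ pr n (fun S => ¬ ConnIn Sᶜ (box d ((2 ^ (n + 2) : ℕ) : ℝ))
        (bdry d (dualRad n : ℝ))) (-h - η) := by
  obtain ⟨c, hc, ht⟩ := transfer (P := P) hd
  set q : ENNReal := ⨅ R : ℕ, ENNReal.ofReal (((R : ℝ) + 1) ^ d) *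
        P {ω | ¬ ConnIn (lvl φ h ω) (box d (ufn ((R : ℝ) + 1))) (bdry d ((R : ℝ) + 1))} with hq
  have hh' : q ≠ 0 := hh
  have hq1 : q ≠ ⊤ := ne_top_of_le_ne_top
    (ENNReal.mul_ne_top ENNReal.ofReal_ne_top (measure_ne_top P _)) (iInf_le _ 0)
  have hq0 : 0 < q.toReal := ENNReal.toReal_pos hh' hq1
  have hlow : ∀ m : ℕ, 1 ≤ m → q.toReal ≤ (m : ℝ) ^ d *
      P.real {ω | ¬ ConnIn (lvl φ h ω) (box d (ufn (m : ℝ))) (bdry d (m : ℝ))} := by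
    intro m hm
    obtain ⟨k, rfl⟩ : ∃ k, m = k + 1 := ⟨m - 1, by omega⟩
    push_cast
    have := ENNReal.toReal_mono (ENNReal.mul_ne_top ENNReal.ofReal_ne_top (measure_ne_top P _))
      (iInf_le _ k : q ≤ _)
    rwa [ENNReal.toReal_mul, ENNReal.toReal_ofReal (by positivity)] at this
  obtain ⟨n₁, hn₁⟩ := eventually_atTop.1 (eventually_err (3 ^ d * 2 ^ (2 * d)) 8 (c * η ^ 2)
    (q.toReal / 2) (2 * d) (by positivity) (by positivity) (by positivity))
  refine ⟨q.toReal / 2, by positivity, n₁, fun n hn => ?_⟩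
  set ρ := dualRad n with hρ
  have hρ1 : (1 : ℝ) ≤ ρ := by exact_mod_cast one_le_dualRad n
  have hbox : box d ((2 ^ (n + 2) : ℕ) : ℝ) ⊆ boxAt 0 ((ρ : ℕ) : ℝ) :=
    boxAt_mono (by exact_mod_cast two_pow_le_dualRad n)
  have hloc := (localTo_connIn hbox).dual (incEv_connIn _ _).mono
  have h1 := (ht hs.neg (incEv_connIn _ _).dual hloc n (-h - η) hη.le).1
  simp only [sub_add_cancel] at h1
  have h2 := hlow ρ (one_le_dualRad n)
  have h3 : P.real {ω | ¬ ConnIn (lvl φ h ω) (box d (ufn (ρ : ℝ))) (bdry d (ρ : ℝ))} ≤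
      P.real {ω | ¬ ConnIn (lvl (fun x ω => -φ x ω) (-h) ω)ᶜ (box d ((2 ^ (n + 2) : ℕ) : ℝ))
        (bdryAt 0 (ρ : ℝ))} := by
    refine measureReal_mono (fun ω hω hc => hω (connIn_mono ?_ (boxAt_mono (two_pow_le_ufn n))
      le_rfl hc)) (measure_ne_top _ _)
    intro x hx
    simp only [lvl, mem_compl_iff, mem_ofPred_eq, neg_le_neg_iff, not_le] at hx ⊢
    exact hx.le
  have h4 : ((cube (0 : V d) ρ).card : ℝ) * (ρ : ℝ) ^ d ≤
      3 ^ d * 2 ^ (2 * d) * growth 8 n ^ (2 * d) := by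
    have e := dualRad_le_growth n
    rw [card_cube]
    push_cast
    calc (2 * (ρ : ℝ) + 1) ^ d * (ρ : ℝ) ^ d ≤ (3 * (ρ : ℝ)) ^ d * (ρ : ℝ) ^ d := by
          gcongr; linarith
      _ = 3 ^ d * (ρ : ℝ) ^ (2 * d) := by rw [mul_pow, mul_assoc, ← pow_add, two_mul]
      _ ≤ 3 ^ d * (2 * growth 8 n) ^ (2 * d) := by gcongr
      _ = _ := by rw [mul_pow, mul_assoc]
  have h5 := (mul_le_mul_of_nonneg_right h4
    (Real.exp_pos (-(c * η ^ 2 * Real.sqrt (2 ^ n)))).le).trans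
    (hn₁ n hn)
  have hρd : 0 < (ρ : ℝ) ^ d := by positivity
  rw [div_le_iff₀ hρd]
  have h6 := mul_le_mul_of_nonneg_right (h3.trans h1) hρd.le
  change _ ≤ pr n (fun S => ¬ ConnIn Sᶜ (box d ((2 ^ (n + 2) : ℕ) : ℝ))
        (bdryAt 0 (ρ : ℝ))) (-h - η) * _
  linarith

/-- Connection events of the truncated fields at two scales. -/
theorem connIn_scales (hd : 3 ≤ d) {φ : V d → Ω → ℝ} (hs : Splits P φ) {h' : ℝ}
    (hh : (⨅ R : ℕ, P {ω | ConnIn (lvl φ h' ω) (box d ((R : ℝ) + 1))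
      (bdry d (2 * ((R : ℝ) + 1)))}) ≠ 0) {s : ℝ} (hs0 : 0 < s) :
    ∃ n₀ : ℕ, ∀ n₁, n₀ ≤ n₁ → ∀ h, h + 2 * s ≤ h' → ∀ r R : ℕ, 1 ≤ r → 2 * r ≤ R → ∀ N, n₁ ≤ N →
      pr N (fun S => ConnIn S (box d (r : ℝ)) (bdry d (R : ℝ))) (h + s) ≤
        pr n₁ (fun S => ConnIn S (box d (r : ℝ)) (bdry d (R : ℝ))) h +
          2 * Real.exp (-Real.exp (Real.log r ^ ((1 : ℝ) / 3) / 20)) := by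
  obtain ⟨p, hp, m₁, hc⟩ := crossing_lower_bound hd hs hh hs0
  have hd0 : 0 < d := by omega
  obtain ⟨a₁, ha₁, hg₁⟩ := poly_le_growth (7 ^ (2 * d)) (2 * d)
  obtain ⟨a₂, ha₂, hg₂⟩ := poly_le_growth 18 1
  obtain ⟨a₃, ha₃, hg₃⟩ := poly_le_growth ((7 ^ (2 * d) * d / p) ^ (2 * (d + 1)))
    (2 * d * (2 * (d + 1)))
  set a := max a₁ (max a₂ a₃) with ha
  obtain ⟨n₀, hn₀⟩ := iterate_scales hd (a := a) (ha₁.trans (le_max_left _ _)) hs0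
  refine ⟨max n₀ m₁, fun n₁ hn₁ h hle r R hr hrR => ?_⟩
  refine hn₀ n₁ ((le_max_left _ _).trans hn₁) (incEv_connIn _ _)
    (localTo_connIn (c := (0 : V d)) (A := box d (r : ℝ)) (k := R)
      (boxAt_mono (by exact_mod_cast (by omega : r ≤ R)))) h r (by exact_mod_cast hr)
    fun n hn v => Or.inr ⟨_, _, _, ?_, ?_, ?_, (absorb_connIn hd0 hp (hc n
      ((le_max_right _ _).trans (hn₁.trans hn))) _ _ v).anti le_rfl le_rfl le_rfl (by linarith)⟩
  · refine le_trans ?_ ((hg₂ n).trans (growth_mono ((le_max_left _ _).trans (le_max_right _ _)) n))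
    push_cast
    rw [pow_one]
    linarith
  · refine le_trans ?_ ((hg₁ n).trans (growth_mono (le_max_left _ _) n))
    push_cast
    rw [← mul_pow]
    refine pow_le_pow_left₀ (by positivity) ?_ _
    linarith [one_le_pow₀ (M₀ := ℝ) one_le_two (n := n)]
  · have hX : (0 : ℝ) <
        (2 * ((3 * 2 ^ n : ℕ) : ℝ) + 1) ^ d * d * (2 * ((3 * 2 ^ n : ℕ) : ℝ) + 1) ^ d := by
      have : (0 : ℝ) < d := by exact_mod_cast hd0
      positivity
    rw [← pow_mul, ← inv_inv ((p / _) ^ _)]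
    refine inv_anti₀ (by positivity) ?_
    rw [← inv_pow, inv_div]
    refine le_trans ?_ ((hg₃ n).trans (growth_mono ((le_max_right _ _).trans (le_max_right _ _)) n))
    rw [pow_mul _ (2 * d), ← mul_pow]
    refine pow_le_pow_left₀ (by positivity) ?_ _
    rw [div_mul_eq_mul_div]
    refine div_le_div_of_nonneg_right ?_ hp.le
    have e : 2 * ((3 * 2 ^ n : ℕ) : ℝ) + 1 ≤ 7 * 2 ^ n := by
      push_cast
      linarith [one_le_pow₀ (M₀ := ℝ) one_le_two (n := n)]
    calc (2 * ((3 * 2 ^ n : ℕ) : ℝ) + 1) ^ d * d * (2 * ((3 * 2 ^ n : ℕ) : ℝ) + 1) ^ d ≤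
          (7 * 2 ^ n) ^ d * d * (7 * 2 ^ n) ^ d := by gcongr
      _ = _ := by rw [mul_pow, two_mul, pow_add, pow_add]; ring

/-- Disconnection events of the truncated fields at two scales. -/
theorem dual_scales (hd : 3 ≤ d) {φ : V d → Ω → ℝ} (hs : Splits P φ) {h' : ℝ}
    (hh : h' ∉ tildeSet d P φ) {s : ℝ} (hs0 : 0 < s) :
    ∃ n₀ : ℕ, ∀ n₁, n₀ ≤ n₁ → ∀ h, h + 2 * s ≤ -h' → ∀ r R : ℕ, 1 ≤ r → 2 * r ≤ R → ∀ N, n₁ ≤ N →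
      pr N (fun S => ¬ ConnIn Sᶜ (box d (r : ℝ)) (bdry d (R : ℝ))) (h + s) ≤
        pr n₁ (fun S => ¬ ConnIn Sᶜ (box d (r : ℝ)) (bdry d (R : ℝ))) h +
          2 * Real.exp (-Real.exp (Real.log r ^ ((1 : ℝ) / 3) / 20)) := by
  obtain ⟨p, hp, m₁, hc⟩ := disconnection_lower_bound hd hs hh hs0
  have hd0 : 0 < d := by omega
  obtain ⟨a₁, ha₁, hg₁⟩ := poly_le_growth (2 ^ d / p) 0
  set a : ℝ := a₁ + 8 * d + 10 with ha
  have hdr : (0 : ℝ) ≤ d := Nat.cast_nonneg d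
  have hadd : ∀ x y n, growth (x + y) n = growth x n * growth y n := fun x y n => by
    rw [growth, growth, growth, ← Real.exp_add]; ring_nf
  have h6 : ∀ n, 6 * growth 8 n ≤ growth a n := by
    intro n
    have e1 : (6 : ℝ) ≤ growth 5 n := by
      have e2 : (1 : ℝ) ≤ ((n : ℝ) + 1) ^ 3 := one_le_pow₀ (by
        linarith [(Nat.cast_nonneg n : (0 : ℝ) ≤ n)])
      have := Real.add_one_le_exp (5 * ((n : ℝ) + 1) ^ 3)
      unfold growth
      linarith
    calc 6 * growth 8 n ≤ growth 5 n * growth 8 n :=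
          mul_le_mul_of_nonneg_right e1 (growth_pos _ _).le
      _ = growth 13 n := by rw [← hadd]; norm_num
      _ ≤ growth a n := growth_mono (by
          rw [ha]
          have : (3 : ℝ) ≤ d := by exact_mod_cast hd
          linarith) n
  obtain ⟨n₀, hn₀⟩ := iterate_scales hd (a := a) (by rw [ha]; linarith) hs0
  refine ⟨max n₀ m₁, fun n₁ hn₁ h hle r R hr hrR => ?_⟩
  refine hn₀ n₁ ((le_max_left _ _).trans hn₁) (incEv_connIn _ _).dual
    ((localTo_connIn (c := (0 : V d)) (A := box d (r : ℝ)) (k := R)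
      (boxAt_mono (by exact_mod_cast (by omega : r ≤ R)))).dual (incEv_connIn _ _).mono) h r
      (by exact_mod_cast hr) fun n hn v => ?_
  by_cases hv : r ≤ 2 * dualRad n ∧ ∀ i, |ctr n v i| ≤ 3 * dualRad n
  · left
    refine ⟨?_, fun i => ?_⟩
    · have e1 : (r : ℝ) ≤ 2 * dualRad n := by exact_mod_cast hv.1
      have e2 := dualRad_le n
      have e3 : (4 : ℝ) ≤ Real.exp 3 := by linarith [Real.add_one_le_exp 3]
      calc (r : ℝ) ≤ 4 * Real.exp (((n : ℝ) + 2) ^ 3) := by linarith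
        _ ≤ Real.exp 3 * Real.exp (((n : ℝ) + 2) ^ 3) :=
            mul_le_mul_of_nonneg_right e3 (Real.exp_pos _).le
        _ = Real.exp (3 + ((n : ℝ) + 2) ^ 3) := (Real.exp_add _ _).symm
        _ ≤ Real.exp (((n : ℝ) + 4) ^ 3) := by
            refine Real.exp_le_exp.2 ?_
            have hn : (0 : ℝ) ≤ n := Nat.cast_nonneg n
            nlinarith [pow_nonneg hn 3, pow_nonneg hn 2]
    · have e1 : |v i| ≤ |ctr n v i| := by
        rw [ctr, abs_mul]
        refine le_mul_of_one_le_left (abs_nonneg _) ?_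
        rw [abs_of_pos (by positivity)]
        exact one_le_pow₀ (by norm_num)
      have e2 : ((|v i| : ℤ) : ℝ) ≤ 3 * dualRad n := by exact_mod_cast e1.trans (hv.2 i)
      have e3 := dualRad_le_growth n
      have e4 := h6 n
      push_cast at e2
      linarith
  · right
    refine ⟨_, _, _, ?_, ?_, ?_, (absorb_dual hd0 (two_pow_le_dualRad n) (hc n
      ((le_max_right _ _).trans (hn₁.trans hn))) hrR hv).anti le_rfl le_rfl le_rfl (by linarith)⟩
    · linarith [dualRad_le_growth n, h6 n, growth_pos 8 n]
    · simpa using one_le_growth (by linarith : 0 ≤ a) n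
    · rw [← inv_inv (p / _)]
      have hρ : (0 : ℝ) < dualRad n := by exact_mod_cast one_le_dualRad n
      refine inv_anti₀ (by positivity) ?_
      rw [inv_div]
      have e1 := hg₁ n
      rw [pow_zero, mul_one] at e1
      calc (dualRad n : ℝ) ^ d / p ≤ (2 * growth 8 n) ^ d / p := by
            gcongr; exact dualRad_le_growth n
        _ = 2 ^ d / p * growth (8 * d) n := by
            rw [mul_pow, growth, growth, ← Real.exp_nat_mul]
            ring_nf
        _ ≤ growth a₁ n * growth (8 * d) n :=
            mul_le_mul_of_nonneg_right e1 (growth_pos _ _).le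
        _ = growth (a₁ + 8 * d) n := (hadd _ _ _).symm
        _ ≤ growth a n := growth_mono (by rw [ha]; linarith) n

end Decoupling

section Noise

variable {d : ℕ}

section NoiseStep

/-- The level set with the sites of `X` closed by the noise, compensated by a small bump around
each site of `X`. -/
def noiseS (n : ℕ) (τ h q : ℝ) (X : Finset (V d)) (w : Ix d → ℝ) : Set (V d) :=
  {x | h ≤ psi n w x + τ * ((X.filter fun y => x ∈ cube y (2 ^ (n + 1))).card : ℝ) ∧
    (x ∈ X → q < w (Sum.inr x))}

variable {n : ℕ} {τ h q κ : ℝ} {X : Finset (V d)}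

lemma card_filter_cube_le (X : Finset (V d)) (x : V d) (k : ℕ) :
    (X.filter fun y => x ∈ cube y k).card ≤ (2 * k + 1) ^ d := by
  rw [← card_cube x k]
  exact Finset.card_le_card fun y hy => mem_cube_comm.1 (Finset.mem_filter.1 hy).2

lemma measurableSet_noise (x : V d) (X : Finset (V d)) (q : ℝ) :
    MeasurableSet {w : Ix d → ℝ | x ∈ X → q < w (Sum.inr x)} := by
  by_cases hx : x ∈ X
  · simpa [hx] using measurableSet_lt measurable_const (measurable_pi_apply (Sum.inr x))
  · simp [hx]

lemma rset_noiseS : RSet (noiseS (d := d) n τ h q X) := fun x =>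
  (measurableSet_le measurable_const ((measurable_psi n x).add_const _)).inter
    (measurableSet_noise x X q)

lemma noise_unif (x : V d) (hq : 0 ≤ q) (hq1 : q ≤ 1) :
    (mu0 d).real {w | q < w (Sum.inr x)} = 1 - q := by
  have h1 : (mu0 d).map (fun w => w (Sum.inr x)) = volume.restrict (Icc (0 : ℝ) 1) :=
    isIIDUnif_coord.2.1 x
  have h2 := map_measureReal_apply (μ := mu0 d) (measurable_pi_apply (Sum.inr x))
    (measurableSet_Ioi (a := q))
  rw [h1, measureReal_restrict_apply measurableSet_Ioi] at h2
  have h3 : Ioi q ∩ Icc (0 : ℝ) 1 = Ioc q 1 := by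
    ext y; simp only [mem_inter_iff, mem_Ioi, mem_Icc, mem_Ioc]
    constructor
    · rintro ⟨a, b, c⟩; exact ⟨a, c⟩
    · rintro ⟨a, c⟩; exact ⟨a, by linarith, c⟩
  rw [h3, Real.volume_real_Ioc_of_le hq1] at h2
  exact h2.symm

/-- Closing one more site by the noise is compensated by a bump. -/
lemma noise_step (hd : 0 < d) {T : Set (V d) → Prop} (hT : IncEv T) (hτ : 0 < τ) (hτ1 : τ ≤ 1)
    (hq : 0 ≤ q) (hq1 : q ≤ 1) {x₀ : V d} (hx₀ : x₀ ∉ X) (hκ : 0 < κ)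
    (hκ1 : κ ≤ 1 - pr n (fun S : Set (V d) => (0 : V d) ∈ S)
      (h - τ * ((2 * 2 ^ (n + 1) + 1) ^ d : ℕ)))
    (hsmall : q * ((2 ^ n * ((2 * (0 + 2 ^ n) + 1) ^ d * (d + 1)) : ℕ) * (gaussC / τ) / κ) ≤ 1) :
    (mu0 d).real {w | T (noiseS n τ h q X w)} ≤
      (mu0 d).real {w | T (noiseS n τ h q (insert x₀ X) w)} := by
  classical
  set S1 : (Ix d → ℝ) → Set (V d) := fun w =>
    {x | h ≤ psi n w x + τ * ((insert x₀ X).filter fun y => x ∈ cube y (2 ^ (n + 1))).card ∧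
      (x ∈ X → q < w (Sum.inr x))} with hS1
  set S2 : (Ix d → ℝ) → Set (V d) := fun w => S1 w \ {x₀} with hS2
  have r1 : RSet S1 := fun x =>
    (measurableSet_le measurable_const ((measurable_psi n x).add_const _)).inter
      (measurableSet_noise x X q)
  have r2 : RSet S2 := fun x => (r1 x).diff (MeasurableSet.const _)
  have m1 : RMono S1 := fun w w' hw x hx =>
    ⟨hx.1.trans (by linarith [psi_mono n x hw]), fun hh => (hx.2 hh).trans_le (hw _)⟩
  have m2 : RMono S2 := fun w w' hw x hx => ⟨m1 hw hx.1, hx.2⟩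
  have u1 := hT.chi_unit r1
  have u2 := hT.chi_unit r2
  have ui := hT.chi_unit (rset_noiseS (d := d) (n := n) (τ := τ) (h := h) (q := q)
    (X := insert x₀ X))
  set b : (Ix d → ℝ) → ℝ := {w : Ix d → ℝ | q < w (Sum.inr x₀)}.indicator fun _ => (1 : ℝ) with hb
  have mb : MeasurableSet {w : Ix d → ℝ | q < w (Sum.inr x₀)} :=
    measurableSet_lt measurable_const (measurable_pi_apply _)
  have ub : IsUnitFn b := IsUnitFn.indicator mb
  have Ib : ∫ w, b w ∂(mu0 d) = 1 - q := by
    rw [hb, ← noise_unif x₀ hq hq1]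
    exact integral_indicator_one mb
  -- the two configurations do not see the noise at `x₀`
  have dep1 : ∀ w w' : Ix d → ℝ,
      (∀ i ∈ (({Sum.inr x₀} : Finset (Ix d)) : Set (Ix d))ᶜ, w i = w' i) →
      S1 w = S1 w' := by
    intro w w' hw
    ext x
    have e1 : psi n w x = psi n w' x := lin_congr (fun s _ => hw _ (by simp)) x
    have e2 : (x ∈ X → q < w (Sum.inr x)) ↔ (x ∈ X → q < w' (Sum.inr x)) := by
      refine forall_congr' fun hx => ?_
      rw [hw (Sum.inr x) (by
        simp only [Finset.coe_singleton, mem_compl_iff, mem_singleton_iff, Sum.inr.injEq]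
        rintro rfl; exact hx₀ hx)]
    simp only [hS1, mem_ofPred_eq, e1, e2]
  have d1 : DepOn (chi T S1) (({Sum.inr x₀} : Finset (Ix d)) : Set (Ix d))ᶜ := fun w w' hw => by
    simp only [chi, indicator, mem_ofPred_eq, dep1 w w' hw]
  have d2 : DepOn (chi T S2) (({Sum.inr x₀} : Finset (Ix d)) : Set (Ix d))ᶜ := fun w w' hw => by
    simp only [chi, indicator, mem_ofPred_eq, hS2, dep1 w w' hw]
  have db : DepOn b (({Sum.inr x₀} : Finset (Ix d)) : Set (Ix d)) := fun w w' hw => by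
    simp only [hb, indicator, mem_ofPred_eq, hw (Sum.inr x₀) (by simp)]
  have hpt : ∀ w, chi T (noiseS n τ h q (insert x₀ X)) w =
      chi T S2 w + (chi T S1 w * b w - chi T S2 w * b w) := by
    intro w
    by_cases hw : q < w (Sum.inr x₀)
    · have e : noiseS n τ h q (insert x₀ X) w = S1 w := by
        ext x
        simp only [noiseS, hS1, mem_ofPred_eq, Finset.mem_insert]
        refine and_congr_right fun _ => ⟨fun h hx => h (Or.inr hx), ?_⟩
        rintro h (rfl | hx)
        · exact hw
        · exact h hx
      have e2 : b w = 1 := by simp [hb, hw]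
      simp only [chi, indicator, mem_ofPred_eq, e, e2]
      ring
    · have e : noiseS n τ h q (insert x₀ X) w = S2 w := by
        ext x
        simp only [noiseS, hS2, hS1, mem_ofPred_eq, Finset.mem_insert, Set.mem_sdiff,
          mem_singleton_iff]
        constructor
        · rintro ⟨h1, h2⟩
          refine ⟨⟨h1, fun hx => h2 (Or.inr hx)⟩, ?_⟩
          rintro rfl
          exact hw (h2 (Or.inl rfl))
        · rintro ⟨⟨h1, h2⟩, h3⟩
          exact ⟨h1, fun hx => h2 (hx.resolve_left h3)⟩
      have e2 : b w = 0 := by simp [hb, hw]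
      simp only [chi, indicator, mem_ofPred_eq, e, e2]
      ring
  have i1 := (u1.mul ub).integrable (mu0 d)
  have i2 := (u2.mul ub).integrable (mu0 d)
  have h1 : ∫ w, chi T (noiseS n τ h q (insert x₀ X)) w ∂(mu0 d) =
      ∫ w, (chi T S2 w + (chi T S1 w * b w - chi T S2 w * b w)) ∂(mu0 d) := by simp only [hpt]
  have i3 : Integrable (fun w => chi T S1 w * b w - chi T S2 w * b w) (mu0 d) := i1.sub i2
  rw [integral_add (u2.integrable _) i3, integral_sub i1 i2,
    show ∫ w, chi T S1 w * b w ∂(mu0 d) = (∫ w, chi T S1 w ∂(mu0 d)) * ∫ w, b w ∂(mu0 d) from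
      integral_mul_of_disjoint u1 ub _ d1 db,
    show ∫ w, chi T S2 w * b w ∂(mu0 d) = (∫ w, chi T S2 w ∂(mu0 d)) * ∫ w, b w ∂(mu0 d) from
      integral_mul_of_disjoint u2 ub _ d2 db, Ib,
    hT.integral_chi rset_noiseS, hT.integral_chi r1, hT.integral_chi r2] at h1
  -- the pivotality estimate
  set β : ℝ := τ * ((2 * 2 ^ (n + 1) + 1) ^ d : ℕ) with hβ
  have iF : IncEv fun S : Set (V d) => x₀ ∈ S :=
    ⟨fun _ _ hS hx => hS hx, measurableSet_setOfPred.2 (measurable_set_mem x₀)⟩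
  have lF : LocalTo (fun S : Set (V d) => x₀ ∈ S) (cube x₀ 0) :=
    fun S hx => ⟨hx, by simp [mem_cube]⟩
  set G := chi (fun S : Set (V d) => x₀ ∈ S) fun w => {x | h - β ≤ psi n w x} with hG
  have hcl := closing_bound (ν := nu d) u1 u2 (iF.chi_unit (rset_psi n (h - β))) (hT.chi_mono m2)
    (iF.chi_mono (rmono_psi n (h - β))) _ (chi_psi_dep iF lF (h - β)) (fun w => by
      by_cases hx : x₀ ∈ S1 w
      · have : chi (fun S : Set (V d) => x₀ ∈ S) (fun w => {x | h - β ≤ psi n w x}) w = 1 := by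
          refine chi_pos ?_
          have e1 := hx.1
          have e2 : τ * (((insert x₀ X).filter fun y => x₀ ∈ cube y (2 ^ (n + 1))).card : ℝ) ≤ β :=
            mul_le_mul_of_nonneg_left (by exact_mod_cast card_filter_cube_le _ _ _) hτ.le
          simp only [mem_ofPred_eq]
          linarith
        rw [this]; simp
      · have : S2 w = S1 w := by
          simp only [hS2]
          exact sdiff_singleton_eq_self hx
        simp only [chi, indicator, mem_ofPred_eq, this, sub_self, zero_mul, le_refl])
  have hsum := sum_condVar_le_sub hT (S' := noiseS n τ h q X) r1 m1 hτ hτ1 (locSrc n x₀ 0) (by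
    intro i hi w x hx
    have hi2 : i.2.1 ∈ cube x₀ (2 ^ n) := by
      have := (mem_srcs.1 hi).2
      rwa [zero_add] at this
    refine ⟨?_, fun hxX => ?_⟩
    · have e1 := le_psi_update n w i hτ.le x
      have e2 : ((X.filter fun y => x ∈ cube y (2 ^ (n + 1))).card : ℝ) +
          (if x ∈ cube i.2.1 (2 ^ n) then 1 else 0) ≤
          ((insert x₀ X).filter fun y => x ∈ cube y (2 ^ (n + 1))).card := by
        rw [Finset.filter_insert]
        by_cases hx2 : x ∈ cube i.2.1 (2 ^ n)
        · have hx3 : x ∈ cube x₀ (2 ^ (n + 1)) := by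
            have := cube_subset_cube hi2 hx2
            rwa [← two_mul, ← pow_succ'] at this
          rw [if_pos hx2, if_pos hx3, Finset.card_insert_of_notMem
            (fun hh => hx₀ (Finset.mem_filter.1 hh).1)]
          push_cast; exact le_rfl
        · rw [if_neg hx2, add_zero]
          split_ifs
          · exact_mod_cast Finset.card_le_card (Finset.subset_insert _ _)
          · exact le_rfl
      have e3 := mul_le_mul_of_nonneg_left e2 hτ.le
      have e4 := hx.1
      rw [mul_add, mul_ite, mul_one, mul_zero] at e3
      linarith
    · rw [Function.update_of_ne (by simp)]
      exact hx.2 hxX)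
  rw [show ∫ w, chi T S1 w ∂(Measure.infinitePi (nu d)) = _ from hT.integral_chi r1 (mu0 d),
    show ∫ w, chi T S2 w ∂(Measure.infinitePi (nu d)) = _ from hT.integral_chi r2 (mu0 d),
    show ∫ w, chi (fun S : Set (V d) => x₀ ∈ S) (fun w => {x | h - β ≤ psi n w x}) w
      ∂(Measure.infinitePi (nu d)) = _ from iF.integral_chi (rset_psi n (h - β)) (mu0 d)] at hcl
  have hG0 : (mu0 d).real {w | x₀ ∈ {x | h - β ≤ psi n w x}} =
      pr n (fun S : Set (V d) => (0 : V d) ∈ S) (h - β) := by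
    rw [← pr_sym hd n (latSym_add x₀) (T := fun S : Set (V d) => (0 : V d) ∈ S)
      ⟨fun _ _ hS hx => hS hx, measurableSet_setOfPred.2 (measurable_set_mem 0)⟩ (h - β)]
    simp
  rw [hG0] at hcl
  rw [card_locSrc] at hsum
  set I1 := (mu0 d).real {w | T (S1 w)} with hI1
  set I2 := (mu0 d).real {w | T (S2 w)} with hI2
  set I0 := (mu0 d).real {w | T (noiseS n τ h q X w)} with hI0
  have h12 : I2 ≤ I1 := measureReal_mono (fun w hw => hT.mono sdiff_subset hw) (measure_ne_top _ _)
  have h01 : I0 ≤ I1 := by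
    refine measureReal_mono (fun w hw => hT.mono (fun x hx => ⟨hx.1.trans ?_, hx.2⟩) hw)
      (measure_ne_top _ _)
    have : ((X.filter fun y => x ∈ cube y (2 ^ (n + 1))).card : ℝ) ≤
        ((insert x₀ X).filter fun y => x ∈ cube y (2 ^ (n + 1))).card := by
      exact_mod_cast Finset.card_le_card (Finset.filter_subset_filter _ (Finset.subset_insert _ _))
    have := mul_le_mul_of_nonneg_left this hτ.le
    linarith
  have hk : κ * (I1 - I2) ≤
      (2 ^ n * ((2 * (0 + 2 ^ n) + 1) ^ d * (d + 1)) : ℕ) * (gaussC / τ) * (I1 - I0) :=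
    ((mul_le_mul_of_nonneg_right hκ1 (by linarith)).trans hcl).trans hsum
  have hk2 : q * (I1 - I2) ≤ I1 - I0 := by
    have e1 : I1 - I2 ≤
        (2 ^ n * ((2 * (0 + 2 ^ n) + 1) ^ d * (d + 1)) : ℕ) * (gaussC / τ) / κ * (I1 - I0) := by
      rw [div_mul_eq_mul_div, le_div_iff₀ hκ]
      linarith
    calc q * (I1 - I2) ≤
        q * ((2 ^ n * ((2 * (0 + 2 ^ n) + 1) ^ d * (d + 1)) : ℕ) * (gaussC / τ) / κ *
          (I1 - I0)) := mul_le_mul_of_nonneg_left e1 hq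
      _ ≤ 1 * (I1 - I0) := by
          rw [← mul_assoc]
          exact mul_le_mul_of_nonneg_right hsmall (by linarith)
      _ = _ := one_mul _
  linarith

/-- A given site is closed with positive probability. -/
lemma pr_site_lt_one (hd : 0 < d) (n : ℕ) (a : ℝ) :
    pr n (fun S : Set (V d) => (0 : V d) ∈ S) a < 1 := by
  set v := Real.toNNReal (covTrunc d (2 ^ (n + 1) - 1) 0 0) with hv
  have hv0 : v ≠ 0 := by
    have h1 : 1 / 2 ≤ covTrunc d (2 ^ (n + 1) - 1) 0 0 := by
      unfold covTrunc
      have := Finset.single_le_sum (f := fun ℓ => lazyP d ℓ 0 0)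
        (fun i _ => lazyP_nonneg i 0 0)
        (Finset.mem_range.2 (Nat.succ_pos (2 ^ (n + 1) - 1)) :
          0 ∈ Finset.range (2 ^ (n + 1) - 1 + 1))
      have e : lazyP d 0 0 0 = 1 := by simp [lazyP]
      simp only [e] at this
      linarith
    rw [hv, Ne, Real.toNNReal_eq_zero]
    linarith
  have e := (psi_isCGF hd n).map_single (0 : V d)
  have e2 : pr n (fun S : Set (V d) => (0 : V d) ∈ S) a = (gaussianReal 0 v).real (Ici a) := by
    rw [← e, map_measureReal_apply (measurable_psi n 0) measurableSet_Ici]; rfl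
  have h3 : (gaussianReal 0 v) (Iio a) ≠ 0 := by
    intro h0
    have := gaussianReal_absolutelyContinuous' 0 hv0 h0
    simp at this
  have h4 := probReal_compl_eq_one_sub (μ := gaussianReal 0 v) (measurableSet_Iio (a := a))
  rw [compl_Iio] at h4
  have h5 : 0 < (gaussianReal 0 v).real (Iio a) := ENNReal.toReal_pos h3 (measure_ne_top _ _)
  rw [e2, h4]
  linarith

/-- At a fixed scale a small amount of noise costs an arbitrarily small change of the level,
uniformly over the event. -/
theorem noise_closing (hd : 0 < d) (n : ℕ) {s : ℝ} (hs : 0 < s) (H : ℝ) :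
    ∃ q₀ : ℝ, 0 < q₀ ∧ ∀ q, 0 ≤ q → q ≤ q₀ → ∀ h, H ≤ h → ∀ {T : Set (V d) → Prop}, IncEv T →
      ∀ {W : Finset (V d)}, LocalTo T W →
      pr n T (h + s) ≤ (mu0 d).real {w | T {x | h ≤ psi n w x ∧ q < w (Sum.inr x)}} := by
  classical
  set B : ℝ := (((2 * 2 ^ (n + 1) + 1) ^ d : ℕ) : ℝ) with hB
  have hB0 : 0 < B := by rw [hB]; positivity
  set τ := min 1 (s / B) with hτ
  have hτ0 : 0 < τ := by positivity
  have hτB : τ * B ≤ s := by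
    calc τ * B ≤ s / B * B := mul_le_mul_of_nonneg_right (min_le_right _ _) hB0.le
      _ = s := by field_simp
  set κ := 1 - pr n (fun S : Set (V d) => (0 : V d) ∈ S) (H) with hκ
  have hκ0 : 0 < κ := sub_pos.2 (pr_site_lt_one hd n _)
  set K : ℝ := ((2 ^ n * ((2 * (0 + 2 ^ n) + 1) ^ d * (d + 1)) : ℕ) : ℝ) * (gaussC / τ) / κ with hK
  have hK0 : 0 < K := by have := gaussC_pos; rw [hK]; positivity
  refine ⟨min 1 K⁻¹, by positivity, fun q hq hq0 h hh T hT W hW => ?_⟩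
  have hq1 : q ≤ 1 := hq0.trans (min_le_left _ _)
  have iF : IncEv fun S : Set (V d) => (0 : V d) ∈ S :=
    ⟨fun _ _ hS hx => hS hx, measurableSet_setOfPred.2 (measurable_set_mem 0)⟩
  have key : ∀ X : Finset (V d), (mu0 d).real {w | T (noiseS n τ (h + s) q ∅ w)} ≤
      (mu0 d).real {w | T (noiseS n τ (h + s) q X w)} := by
    intro X
    induction X using Finset.induction_on with
    | empty => exact le_rfl
    | insert x₀ X hx ih =>
      refine ih.trans (noise_step hd hT hτ0 (min_le_left _ _) hq hq1 hx hκ0 ?_ ?_)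
      · rw [hκ]
        have := pr_anti n iF (show H ≤ h + s - τ * B by linarith)
        linarith
      · calc q * K ≤ K⁻¹ * K := mul_le_mul_of_nonneg_right (hq0.trans (min_le_right _ _)) hK0.le
          _ = 1 := inv_mul_cancel₀ hK0.ne'
  refine le_trans (le_of_eq ?_) ((key W).trans (measureReal_mono (fun w hw => ?_)
    (measure_ne_top _ _)))
  · simp [pr, noiseS]
  · refine hT.local_mono hW (fun x hx hxS => ⟨?_, hxS.2 hx⟩) hw
    have e1 := hxS.1
    have e2 : τ * ((W.filter fun y => x ∈ cube y (2 ^ (n + 1))).card : ℝ) ≤ τ * B :=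
      mul_le_mul_of_nonneg_left (by rw [hB]; exact_mod_cast card_filter_cube_le _ _ _) hτ0.le
    linarith

end NoiseStep

end Noise

section CouplingLaw

lemma IsIIDUnif.one_sub {d : ℕ} {Ω : Type*} [MeasurableSpace Ω] {P : Measure Ω}
    {U : V d → Ω → ℝ} (hU : IsIIDUnif P U) :
    IsIIDUnif P fun x ω => 1 - U x ω := by
  have hm : Measurable fun t : ℝ => 1 - t := measurable_const.sub measurable_id
  refine ⟨fun x => hm.comp (hU.1 x), fun x => ?_, ?_⟩
  · have h1 : Measure.map (fun ω => 1 - U x ω) P = Measure.map (fun t : ℝ => 1 - t) (P.map (U x)) :=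
      (Measure.map_map hm (hU.1 x)).symm
    rw [h1, hU.2.1 x]
    have h2 : MeasurePreserving (fun t : ℝ => 1 - t) volume volume :=
      Measure.measurePreserving_sub_left volume 1
    have h3 := h2.restrict_preimage (measurableSet_Icc (a := (0 : ℝ)) (b := 1))
    have h4 : (fun t : ℝ => 1 - t) ⁻¹' Icc 0 1 = Icc 0 1 := by
      ext t; simp only [mem_preimage, mem_Icc]; constructor <;> rintro ⟨a, b⟩ <;>
        constructor <;> linarith
    rw [h4] at h3
    exact h3.map_eq
  · exact hU.2.2.comp (fun _ t => 1 - t) fun _ => hm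

variable {d : ℕ} {Ω : Type*} [MeasurableSpace Ω] {P : Measure Ω} [IsProbabilityMeasure P]

/-- A bound valid for all truncated fields passes to the limiting field. -/
lemma full_le_of_scales (hd : 3 ≤ d) {φ : V d → Ω → ℝ} (hs : Splits P φ) {T : Set (V d) → Prop}
    (hT : IncEv T) {W : Finset (V d)} (hW : LocalTo T W) {n₁ : ℕ} {a M η : ℝ} (hη : 0 < η)
    (h : ∀ N, n₁ ≤ N → pr N T a ≤ M) : P.real {ω | T (lvl φ (a + η) ω)} ≤ M := by
  obtain ⟨c, hc, ht⟩ := transfer (P := P) hd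
  refine le_of_forall_pos_le_add fun θ hθ => ?_
  obtain ⟨n₂, hn₂⟩ := eventually_atTop.1 (eventually_err (W.card + 1) 1 (c * η ^ 2) θ 0
    (by positivity) (by positivity) hθ)
  have h1 := (ht hs hT hW (max n₁ n₂) a hη.le).1
  have h2 := h (max n₁ n₂) (le_max_left _ _)
  have h3 := hn₂ (max n₁ n₂) (le_max_right _ _)
  rw [pow_zero, mul_one] at h3
  have h4 := Real.exp_pos (-(c * η ^ 2 * Real.sqrt (2 ^ max n₁ n₂)))
  nlinarith

/-- Transport of noised level sets from the canonical space. -/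
lemma noised_law (hd : 0 < d) {n : ℕ} {φ U : V d → Ω → ℝ}
    (hφ : IsCGF P φ (covTrunc d (2 ^ (n + 1) - 1))) (hU : IsIIDUnif P U)
    (hind : IndepFun (proc U) (proc φ) P) {T : Set (V d) → Prop} (hT : IncEv T) (a q : ℝ) :
    (mu0 d).real {w | T {x | a ≤ psi n w x ∧ q < w (Sum.inr x)}} =
      P.real {ω | T {x | a ≤ φ x ω ∧ q < U x ω}} := by
  have hm : MeasurableSet {p : (V d → ℝ) × (V d → ℝ) | T {x | a ≤ p.2 x ∧ q < p.1 x}} :=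
    hT.measurableSet fun x =>
      (measurableSet_le measurable_const ((measurable_pi_apply x).comp measurable_snd)).inter
        (measurableSet_lt measurable_const ((measurable_pi_apply x).comp measurable_fst))
  have h1 := map_measureReal_apply (μ := P)
    ((measurable_proc hU.1).prodMk (measurable_proc hφ.1)) hm
  have h2 := map_measureReal_apply (μ := mu0 d) (f := fun w => ((fun x => w (Sum.inr x)), psi n w))
    ((measurable_pi_iff.2 fun x => measurable_pi_apply _).prodMk (measurable_psi_pi n)) hm
  rw [← joint_law hd hφ hU hind, h1] at h2
  exact h2.symm

lemma measurableSet_tdLvl {U φ : V d → Ω → ℝ} (hU : ∀ x, Measurable (U x))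
    (hφ : ∀ x, Measurable (φ x)) {T : Set (V d) → Prop} (hT : IncEv T) (δ h : ℝ) :
    MeasurableSet {ω | T (TdLvl U φ δ h ω)} :=
  hT.measurableSet fun x => (measurableSet_le measurable_const (hU x)).union
    ((measurableSet_lt measurable_const (hU x)).inter
      ((measurableSet_lt (hU x) measurable_const).inter
        (measurableSet_le measurable_const (hφ x))))

/-- The comparison between two levels which are not critical. -/
theorem comparison_of_noncritical (hd : 3 ≤ d) {φ : V d → Ω → ℝ} {φL : ℕ → V d → Ω → ℝ}
    {U : V d → Ω → ℝ} (mφ : ∀ x, Measurable (φ x)) (hcoup : IsTruncCoupling d P φ φL)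
    (hU : IsIIDUnif P U)
    (hind : IndepFun (proc U) (fun ω => (proc φ ω, fun p : ℕ × V d => φL p.1 p.2 ω)) P)
    {ε : ℝ} (hε : 0 < ε) {h₁ h₂ : ℝ}
    (hh₁ : (⨅ R : ℕ, P {ω | ConnIn (lvl φ h₁ ω) (box d ((R : ℝ) + 1))
      (bdry d (2 * ((R : ℝ) + 1)))}) ≠ 0) (hh₂ : h₂ ∉ tildeSet d P φ) :
    ∃ δ ∈ Set.Ioo (0 : ℝ) 1, ∃ L : ℕ, 1 ≤ L ∧
      ∀ h : ℝ, h₂ + ε ≤ h → h + ε ≤ h₁ → ∀ r R : ℕ, 1 ≤ r → 2 * r ≤ R →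
        P.real {ω | ConnIn (lvl φ (h + ε) ω) (box d (r : ℝ)) (bdry d (R : ℝ))} ≤
            P.real {ω | ConnIn (TdLvl U (φL L) δ h ω) (box d (r : ℝ)) (bdry d (R : ℝ))} +
              2 * Real.exp (-Real.exp (Real.log r ^ ((1 : ℝ) / 3) / 20)) ∧
          P.real {ω | ConnIn (TdLvl U (φL L) δ h ω) (box d (r : ℝ)) (bdry d (R : ℝ))} ≤
            P.real {ω | ConnIn (lvl φ (h - ε) ω) (box d (r : ℝ)) (bdry d (R : ℝ))} +
              2 * Real.exp (-Real.exp (Real.log r ^ ((1 : ℝ) / 3) / 20)) := by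
  have hd0 : 0 < d := by omega
  have hs : Splits P φ := fun n => ⟨_, (hcoup _).1, (hcoup _).2.1⟩
  set s := ε / 4 with hs_def
  have hs0 : 0 < s := by positivity
  obtain ⟨m₁, hm₁⟩ := connIn_scales hd hs hh₁ hs0
  obtain ⟨m₂, hm₂⟩ := dual_scales hd hs hh₂ hs0
  set n := max m₁ m₂ with hn
  obtain ⟨q₁, hq₁, hc₁⟩ := noise_closing hd0 n hs0 h₂
  obtain ⟨q₂, hq₂, hc₂⟩ := noise_closing hd0 n hs0 (-h₁)
  set q := min (1 / 4) (min q₁ q₂) with hq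
  have hq0 : 0 < q := by positivity
  have hq4 : q ≤ 1 / 4 := min_le_left _ _
  have hL := (hcoup (2 ^ (n + 1) - 1)).1
  have hi : IndepFun (proc U) (proc (φL (2 ^ (n + 1) - 1))) P :=
    hind.comp (φ := id) (ψ := fun p : (V d → ℝ) × (ℕ × V d → ℝ) =>
      fun x => p.2 (2 ^ (n + 1) - 1, x)) measurable_id
      (measurable_pi_iff.2 fun x => (measurable_pi_apply _).comp measurable_snd)
  refine ⟨2 * q, ⟨by linarith, by linarith⟩, 2 ^ (n + 1) - 1, ?_, fun h hle hge r R hr hrR => ?_⟩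
  · have : 2 ≤ 2 ^ (n + 1) := by rw [pow_succ]; have := Nat.one_le_two_pow (n := n); omega
    omega
  have hsub : box d (r : ℝ) ⊆ boxAt 0 (R : ℝ) := boxAt_mono (by exact_mod_cast (by omega : r ≤ R))
  have hloc : LocalTo (fun S => ConnIn S (box d (r : ℝ)) (bdry d (R : ℝ))) (cube 0 R) :=
    localTo_connIn hsub
  have hI := incEv_connIn (box d (r : ℝ)) (bdry d (R : ℝ))
  set err := 2 * Real.exp (-Real.exp (Real.log r ^ ((1 : ℝ) / 3) / 20)) with herr
  constructor
  · have e1 := full_le_of_scales hd hs hI hloc hs0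
      (hm₁ n (le_max_left _ _) (h + s + s) (by linarith) r R hr hrR)
    have e2 := hc₁ q hq0.le ((min_le_right _ _).trans (min_le_left _ _)) (h + s)
        (by linarith) hI hloc
    rw [noised_law hd0 hL hU hi hI] at e2
    have e3 : P.real {ω | ConnIn {x | h + s ≤ φL (2 ^ (n + 1) - 1) x ω ∧ q < U x ω}
        (box d (r : ℝ)) (bdry d (R : ℝ))} ≤ P.real {ω | ConnIn (TdLvl U (φL (2 ^ (n + 1) - 1))
          (2 * q) h ω) (box d (r : ℝ)) (bdry d (R : ℝ))} := by
      refine measureReal_mono (fun ω hω => hI.mono (fun x hx => ?_) hω) (measure_ne_top _ _)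
      simp only [TdLvl, mem_ofPred_eq] at hx ⊢
      by_cases hx1 : 1 - 2 * q / 2 ≤ U x ω
      · exact Or.inl hx1
      · exact Or.inr ⟨by linarith [hx.2], not_le.1 hx1, by linarith [hx.1]⟩
    rw [show h + s + s + s + s = h + ε by rw [hs_def]; ring] at e1
    linarith
  · have hD := hI.dual
    have hlocD := hloc.dual hI.mono
    have e1 := full_le_of_scales hd hs.neg hD hlocD hs0
      (hm₂ n (le_max_right _ _) (-h + s + s) (by linarith) r R hr hrR)
    have e2 := hc₂ q hq0.le ((min_le_right _ _).trans (min_le_right _ _)) (-h + s) (by linarith)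
      hD hlocD
    have hi' : IndepFun (proc fun x ω => 1 - U x ω)
        (proc fun x ω => -φL (2 ^ (n + 1) - 1) x ω) P :=
      hi.comp (φ := fun f : V d → ℝ => fun x => 1 - f x) (ψ := fun f : V d → ℝ => fun x => -f x)
        (measurable_pi_iff.2 fun x => measurable_const.sub (measurable_pi_apply x))
        (measurable_pi_iff.2 fun x => (measurable_pi_apply x).neg)
    rw [noised_law hd0 hL.neg hU.one_sub hi' hD] at e2
    rw [show -h + s + s + s + s = -(h - ε) by rw [hs_def]; ring] at e1
    have mA : MeasurableSet {ω | ConnIn (lvl φ (h - ε) ω) (box d (r : ℝ)) (bdry d (R : ℝ))} :=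
      hI.measurableSet fun x => measurableSet_le measurable_const (mφ x)
    have mB := measurableSet_tdLvl hU.1 hL.1 hI (2 * q) h
    have e3 : P.real {ω | ConnIn (lvl φ (h - ε) ω) (box d (r : ℝ)) (bdry d (R : ℝ))}ᶜ ≤
        P.real {ω | ¬ ConnIn (lvl (fun x ω => -φ x ω) (-(h - ε)) ω)ᶜ (box d (r : ℝ))
          (bdry d (R : ℝ))} := by
      refine measureReal_mono (fun ω hω hc => hω (hI.mono (fun x hx => ?_) hc)) (measure_ne_top _ _)
      simp only [lvl, mem_compl_iff, mem_ofPred_eq, neg_le_neg_iff, not_le] at hx ⊢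
      exact hx.le
    have e4 : P.real {ω | ¬ ConnIn {x | -h + s ≤ -φL (2 ^ (n + 1) - 1) x ω ∧ q < 1 - U x ω}ᶜ
        (box d (r : ℝ)) (bdry d (R : ℝ))} ≤ P.real {ω | ConnIn (TdLvl U (φL (2 ^ (n + 1) - 1))
          (2 * q) h ω) (box d (r : ℝ)) (bdry d (R : ℝ))}ᶜ := by
      refine measureReal_mono (fun ω hω hc => hω (hI.mono (fun x hx hx' => ?_) hc))
        (measure_ne_top _ _)
      simp only [TdLvl, mem_ofPred_eq] at hx hx'
      rcases hx with hx | hx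
      · linarith [hx'.2]
      · linarith [hx'.1, hx.2.2]
    rw [probReal_compl_eq_one_sub mA] at e3
    rw [probReal_compl_eq_one_sub mB] at e4
    linarith

end CouplingLaw

section Positivity

variable {d : ℕ} {Ω : Type*} [MeasurableSpace Ω] {P : Measure Ω} [IsProbabilityMeasure P]

lemma gaussianReal_Ici_mono {v w : NNReal} (hv : v ≠ 0) (hvw : v ≤ w) {a : ℝ} (ha : 0 ≤ a) :
    (gaussianReal 0 v).real (Ici a) ≤ (gaussianReal 0 w).real (Ici a) := by
  have hv0 : (0 : ℝ) < v := NNReal.coe_pos.2 (pos_iff_ne_zero.2 hv)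
  have hvw' : (v : ℝ) ≤ w := hvw
  set c := Real.sqrt (w / v) with hc
  have hc1 : 1 ≤ c := Real.one_le_sqrt.2 ((one_le_div hv0).2 hvw')
  have e : gaussianReal 0 w = (gaussianReal 0 v).map (c * ·) := by
    rw [gaussianReal_map_const_mul, mul_zero]
    congr 1
    ext
    push_cast
    rw [hc, Real.sq_sqrt (by positivity)]
    field_simp
  rw [e, map_measureReal_apply (measurable_const_mul c) measurableSet_Ici]
  refine measureReal_mono fun x hx => ?_
  change a ≤ c * x
  have hx' : a ≤ x := hx
  nlinarith

lemma pr_site_ge (hd : 0 < d) (n : ℕ) {a : ℝ} (ha : 0 ≤ a) (x : V d) :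
    (gaussianReal 0 (1 / 2)).real (Ici a) ≤ pr n (fun S : Set (V d) => x ∈ S) a := by
  have h1 : 1 / 2 ≤ covTrunc d (2 ^ (n + 1) - 1) x x := by
    unfold covTrunc
    have := Finset.single_le_sum (f := fun ℓ => lazyP d ℓ x x)
      (fun i _ => lazyP_nonneg i x x)
      (Finset.mem_range.2 (Nat.succ_pos (2 ^ (n + 1) - 1)) : 0 ∈ Finset.range (2 ^ (n + 1) - 1 + 1))
    have e : lazyP d 0 x x = 1 := by simp [lazyP]
    simp only [e] at this
    linarith
  have e := (psi_isCGF hd n).map_single x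
  have e2 : pr n (fun S : Set (V d) => x ∈ S) a =
      (gaussianReal 0 (Real.toNNReal (covTrunc d (2 ^ (n + 1) - 1) x x))).real (Ici a) := by
    rw [← e, map_measureReal_apply (measurable_psi n x) measurableSet_Ici]; rfl
  rw [e2]
  refine gaussianReal_Ici_mono (by norm_num) ?_ ha
  rw [← NNReal.coe_le_coe, Real.coe_toNNReal _ (by linarith)]
  simpa using h1

lemma incEv_subset (W : Finset (V d)) : IncEv fun S : Set (V d) => (W : Set (V d)) ⊆ S :=
  IncEv.of_finite (fun _ _ hS h => h.trans hS) fun _ h => ⟨W, h, le_rfl⟩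

lemma pr_subset_ge (hd : 0 < d) (n : ℕ) {a : ℝ} (ha : 0 ≤ a) (W : Finset (V d)) :
    (gaussianReal 0 (1 / 2)).real (Ici a) ^ W.card ≤
      pr n (fun S : Set (V d) => (W : Set (V d)) ⊆ S) a := by
  classical
  induction W using Finset.induction_on with
  | empty => simp [pr]
  | insert x W hx ih =>
    rw [Finset.card_insert_of_notMem hx, pow_succ]
    have h2 : IncEv fun S : Set (V d) => x ∈ S := by simpa using incEv_subset {x}
    refine (mul_le_mul ih (pr_site_ge hd n ha x) measureReal_nonneg (pr_nonneg _ _ _)).trans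
      (pr_harris (incEv_subset W) h2 (y := x) (D := 0) (fun S hS => ⟨hS, ?_⟩) fun S h3 h4 => ?_)
    · simp [mem_cube]
    · rw [Finset.coe_insert]
      exact insert_subset h4 h3

/-- Finite sets are contained in the level set with positive probability. -/
lemma prob_subset_pos (hd : 3 ≤ d) {φ : V d → Ω → ℝ} (hs : Splits P φ) (W : Finset (V d)) (h : ℝ) :
    0 < P.real {ω | (W : Set (V d)) ⊆ lvl φ h ω} := by
  obtain ⟨c, hc, ht⟩ := transfer (P := P) hd
  set a := max (h + 1) 0 with ha
  set p := (gaussianReal 0 (1 / 2)).real (Ici a) ^ W.card with hp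
  have hp0 : 0 < p := by
    refine pow_pos (ENNReal.toReal_pos (fun h0 => ?_) (measure_ne_top _ _)) _
    have := gaussianReal_absolutelyContinuous' 0 (v := 1 / 2) (by norm_num) h0
    simp at this
  obtain ⟨n, hn⟩ := (eventually_err (W.card + 1) 1 (c * 1 ^ 2) (p / 2) 0
    (by positivity) (by positivity) (by positivity)).exists
  have h1 := (ht hs (incEv_subset W) (W := W) (fun S h => subset_inter h le_rfl) n h
    zero_le_one).2
  have h2 := (pr_subset_ge (by omega) n (le_max_right (h + 1) 0) W).trans
    (pr_anti n (incEv_subset W) (le_max_left (h + 1) 0))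
  rw [pow_zero, mul_one] at hn
  have h4 := Real.exp_pos (-(c * 1 ^ 2 * Real.sqrt (2 ^ n)))
  have h5 : p ≤ pr n (fun S : Set (V d) => (W : Set (V d)) ⊆ S) (h + 1) := h2
  have h7 : pr n (fun S : Set (V d) => (W : Set (V d)) ⊆ S) (h + 1) ≤
      P.real {ω | (W : Set (V d)) ⊆ lvl φ h ω} +
        W.card * Real.exp (-(c * 1 ^ 2 * Real.sqrt (2 ^ n))) := h1
  rw [add_one_mul] at hn
  clear_value p
  generalize Real.exp (-(c * 1 ^ 2 * Real.sqrt (2 ^ n))) = X at *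
  linarith

lemma prob_disjoint_pos (hd : 3 ≤ d) {φ : V d → Ω → ℝ} (hs : Splits P φ) (W : Finset (V d))
    (h : ℝ) : 0 < P {ω | ∀ x ∈ W, x ∉ lvl φ h ω} := by
  have h1 := prob_subset_pos hd hs.neg W (1 - h)
  have h2 := (ENNReal.toReal_pos_iff.1 h1).1
  refine h2.trans_le (measure_mono fun ω hω x hx h3 => ?_)
  have h4 : 1 - h ≤ -φ x ω := hω (Finset.mem_coe.2 hx)
  have h5 : h ≤ φ x ω := h3
  linarith

/-- The annulus crossing event at scale `m` around `c`. -/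
def Cross (c : V d) (m : ℕ) (S : Set (V d)) : Prop :=
  ConnIn S (boxAt c (m : ℝ)) (bdryAt c ((2 * m : ℕ) : ℝ))

lemma incEv_cross (c : V d) (m : ℕ) : IncEv (Cross c m) := incEv_connIn _ _

lemma localTo_cross (c : V d) (m : ℕ) : LocalTo (Cross c m) (cube c (2 * m)) :=
  localTo_connIn (boxAt_mono (by exact_mod_cast (by omega : m ≤ 2 * m)))

lemma pr_cross (hd : 0 < d) (n m : ℕ) (c : V d) (h : ℝ) :
    pr n (Cross c m) h ≤ pr n (Cross (0 : V d) m) h := by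
  refine pr_map hd n (latSym_add (-c)) (incEv_cross c m) (fun S hS => ?_) h
  obtain ⟨x, hx, y, hy, hr⟩ := connIn_iff.1 hS
  refine connIn_iff.2 ⟨x + -c, ?_, y + -c, ?_, Reach.map (S := {x | x + -c ∈ S}) (S' := S)
    (σ := fun x => x + -c) (fun _ _ => adj_add (-c)) (fun _ h => h) hr⟩
  · rw [← sub_eq_add_neg]; exact boxAt_sub hx
  · rw [← sub_eq_add_neg]; exact bdryAt_sub hy

lemma cross_of_reach {S : Set (V d)} {c x y : V d} {m : ℕ} (h : Reach S x y) (hx : x ∈ cube c m)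
    (hy : y ∉ cube c (2 * m)) : Cross c m S := by
  have h1 : x ∈ boxAt c ((2 * m : ℕ) : ℝ) :=
    boxAt_mono (by exact_mod_cast (by omega : m ≤ 2 * m)) (mem_boxAt_iff.2 hx)
  obtain ⟨z, hz, h'⟩ := h.hit_bdry h1 (Or.inr fun h2 => hy (mem_boxAt_iff.1 h2))
  exact connIn_iff.2 ⟨x, mem_boxAt_iff.2 hx, z, hz, h'.mono inter_subset_left⟩

/-- A point near which the grid of mesh `m` has a vertex. -/
lemma exists_grid {m : ℕ} (hm : 1 ≤ m) {k : ℕ} {x : V d} (hx : x ∈ cube 0 (k * m)) :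
    ∃ z ∈ cube (0 : V d) k, x ∈ cube (fun i => (m : ℤ) * z i) m := by
  have hm0 : (0 : ℤ) < m := by exact_mod_cast hm
  refine ⟨fun i => x i / m, mem_cube.2 fun i => ?_, mem_cube.2 fun i => ?_⟩
  · have h1 := mem_cube.1 hx i
    simp only [Pi.zero_apply, zero_sub, abs_neg] at h1 ⊢
    rw [abs_le] at h1 ⊢
    push_cast at h1
    constructor
    · rw [Int.le_ediv_iff_mul_le hm0]; linarith
    · exact Int.ediv_le_of_le_mul hm0 (by linarith)
  · have h2 := Int.emod_add_mul_ediv (x i) m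
    have h3 := Int.emod_nonneg (x i) hm0.ne'
    have h4 := Int.emod_lt_of_pos (x i) hm0
    rw [abs_le]
    constructor <;> simp only <;> linarith

/-- A crossing at scale `8 m` forces two crossings at scale `m` far apart. -/
lemma cross_cascade {m : ℕ} (hm : 1 ≤ m) {S : Set (V d)} (h : Cross 0 (8 * m) S) :
    ∃ z ∈ cube (0 : V d) 16, ∃ z' ∈ cube (0 : V d) 16,
      (∃ i, 6 * (m : ℤ) ≤ |(m : ℤ) * z i - m * z' i|) ∧
      Cross (fun i => (m : ℤ) * z i) m S ∧ Cross (fun i => (m : ℤ) * z' i) m S := by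
  obtain ⟨x, hx, y, hy, hr⟩ := connIn_iff.1 h
  obtain ⟨i, hi⟩ := bdryAt_exists_abs hy
  have hx := mem_boxAt_iff.1 hx
  have hy := mem_boxAt_iff.1 hy.1
  have hm0 : (0 : ℤ) < m := by exact_mod_cast hm
  obtain ⟨z, hz, hxz⟩ := exists_grid hm (k := 16) (cube_mono (by omega) hx)
  obtain ⟨z', hz', hyz⟩ := exists_grid hm (k := 16) (x := y)
    (by rwa [show 16 * m = 2 * (8 * m) by ring])
  have a1 := mem_cube.1 hxz i
  have a2 := mem_cube.1 hyz i
  have a3 := mem_cube.1 hx i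
  simp only [Pi.zero_apply, sub_zero, zero_sub, abs_neg] at hi a3
  push_cast at hi a3
  have key : 6 * (m : ℤ) ≤ |(m : ℤ) * z i - m * z' i| ∧ 7 * (m : ℤ) ≤ |(m : ℤ) * z i - y i| ∧
      7 * (m : ℤ) ≤ |(m : ℤ) * z' i - x i| := by
    set u := (m : ℤ) * z i
    set u' := (m : ℤ) * z' i
    have b1 : |y i| ≤ |y i - u'| + |u' - u| + |u - x i| + |x i| := by
      have := abs_add_le (y i - u') u'
      have := abs_add_le (u' - u) u
      have := abs_add_le (u - x i) (x i)
      simp only [sub_add_cancel] at *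
      linarith
    have b2 : |y i| ≤ |y i - u| + |u - x i| + |x i| := by
      have := abs_add_le (y i - u) u
      have := abs_add_le (u - x i) (x i)
      simp only [sub_add_cancel] at *
      linarith
    have b3 : |y i| ≤ |y i - u'| + |u' - x i| + |x i| := by
      have := abs_add_le (y i - u') u'
      have := abs_add_le (u' - x i) (x i)
      simp only [sub_add_cancel] at *
      linarith
    rw [abs_sub_comm (y i) u', abs_sub_comm u' u] at b1
    rw [abs_sub_comm (y i) u] at b2
    rw [abs_sub_comm (y i) u'] at b3
    refine ⟨?_, ?_, ?_⟩ <;> linarith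
  refine ⟨z, hz, z', hz', ⟨i, key.1⟩, cross_of_reach hr hxz fun h1 => ?_,
    cross_of_reach hr.symm hyz fun h1 => ?_⟩
  · have h2 : |(m : ℤ) * z i - y i| ≤ ((2 * m : ℕ) : ℤ) := mem_cube.1 h1 i
    push_cast at h2
    linarith [key.2.1]
  · have h2 : |(m : ℤ) * z' i - x i| ≤ ((2 * m : ℕ) : ℤ) := mem_cube.1 h1 i
    push_cast at h2
    linarith [key.2.2]

/-- Independence of local events of the truncated field at distant places. -/
lemma pr_and_of_far {n D : ℕ} {T T' : Set (V d) → Prop} (hT : IncEv T) (hT' : IncEv T')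
    {y y' : V d} (hl : LocalTo T (cube y D)) (hl' : LocalTo T' (cube y' D)) {i : Fin d}
    (hi : 2 * ((D : ℤ) + 2 ^ n) < |y i - y' i|) (h : ℝ) :
    pr n (fun S => T S ∧ T' S) h = pr n T h * pr n T' h := by
  classical
  have hS := rset_psi (d := d) n h
  have key := integral_mul_of_disjoint (ν := nu d) (hT.chi_unit hS) (hT'.chi_unit hS)
    ((locSrc n y' D).map ⟨Sum.inl, Sum.inl_injective⟩) ?_ (chi_psi_dep hT' hl' h)
  · rw [show (fun w => chi T (fun w => {x | h ≤ psi n w x}) w *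
      chi T' (fun w => {x | h ≤ psi n w x}) w) = chi (fun S => T S ∧ T' S)
      (fun w => {x | h ≤ psi n w x}) from funext fun w => chi_mul T T' _ w] at key
    have e1 := hT.integral_chi hS (mu0 d)
    have e2 := hT'.integral_chi hS (mu0 d)
    have e3 := (hT.and hT').integral_chi hS (mu0 d)
    change ∫ w, chi (fun S => T S ∧ T' S) (fun w => {x | h ≤ psi n w x}) w ∂(mu0 d) =
      (∫ w, chi T (fun w => {x | h ≤ psi n w x}) w ∂(mu0 d)) *
      ∫ w, chi T' (fun w => {x | h ≤ psi n w x}) w ∂(mu0 d) at key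
    rw [e1, e2, e3] at key
    exact key
  · intro w w' hw
    refine chi_psi_dep hT hl h w w' fun s hs => hw s fun h1 => ?_
    obtain ⟨u, hu, rfl⟩ := Finset.mem_map.1 (Finset.mem_coe.1 hs)
    obtain ⟨u', hu', he⟩ := Finset.mem_map.1 (Finset.mem_coe.1 h1)
    obtain rfl : u' = u := Sum.inl_injective he
    have b1 := mem_cube.1 (mem_srcs.1 hu).2 i
    have b2 := mem_cube.1 (mem_srcs.1 hu').2 i
    have b3 := abs_sub_le (y i) (u'.2.1 i) (y' i)
    rw [abs_sub_comm (u'.2.1 i)] at b3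
    push_cast at b1 b2
    linarith
/-- The renormalization inequality for crossing probabilities of truncated fields. -/
lemma pr_cascade (hd : 0 < d) {n m : ℕ} (hnm : 2 ^ n < m) (h : ℝ) :
    pr n (Cross (0 : V d) (8 * m)) h ≤ (33 ^ d) ^ 2 * pr n (Cross (0 : V d) m) h ^ 2 := by
  classical
  have hm : 1 ≤ m := Nat.one_le_two_pow.trans hnm.le
  set I := ((cube (0 : V d) 16) ×ˢ (cube (0 : V d) 16)).filter
    fun p => ∃ i, 6 * (m : ℤ) ≤ |(m : ℤ) * p.1 i - m * p.2 i| with hI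
  have h1 : pr n (Cross (0 : V d) (8 * m)) h ≤ ∑ p ∈ I, pr n (fun S =>
      Cross (fun i => (m : ℤ) * p.1 i) m S ∧ Cross (fun i => (m : ℤ) * p.2 i) m S) h := by
    refine pr_le_sum n I _ (fun S hS => ?_) h
    obtain ⟨z, hz, z', hz', hf, h1, h2⟩ := cross_cascade hm hS
    exact ⟨(z, z'), Finset.mem_filter.2 ⟨Finset.mem_product.2 ⟨hz, hz'⟩, hf⟩, h1, h2⟩
  have h2 : ∀ p ∈ I, pr n (fun S =>
      Cross (fun i => (m : ℤ) * p.1 i) m S ∧ Cross (fun i => (m : ℤ) * p.2 i) m S) h ≤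
      pr n (Cross (0 : V d) m) h ^ 2 := by
    intro p hp
    obtain ⟨i, hi⟩ := (Finset.mem_filter.1 hp).2
    rw [pr_and_of_far (incEv_cross _ m) (incEv_cross _ m) (localTo_cross _ m) (localTo_cross _ m)
      (i := i) ?_ h, sq]
    · exact mul_le_mul (pr_cross hd n m _ h) (pr_cross hd n m _ h) (pr_nonneg _ _ _)
        (pr_nonneg _ _ _)
    · have : (2 : ℤ) ^ n < m := by exact_mod_cast hnm
      push_cast
      linarith
  have h3 : (I.card : ℝ) ≤ (33 ^ d) ^ 2 := by
    have : I.card ≤ (33 ^ d) ^ 2 := by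
      refine (Finset.card_filter_le _ _).trans (le_of_eq ?_)
      rw [Finset.card_product, card_cube]
      ring
    exact_mod_cast this
  refine h1.trans ((Finset.sum_le_card_nsmul I _ _ h2).trans ?_)
  rw [nsmul_eq_mul]
  exact mul_le_mul_of_nonneg_right h3 (sq_nonneg _)

end Positivity

section Cascade

variable {d : ℕ} {Ω : Type*} [MeasurableSpace Ω] {P : Measure Ω} [IsProbabilityMeasure P]

/-- The renormalization inequality for crossing probabilities of the full field. -/
lemma cross_step (hd : 3 ≤ d) : ∃ c : ℝ, 0 < c ∧ ∀ {φ : V d → Ω → ℝ}, Splits P φ →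
    ∀ {n m : ℕ}, 2 ^ n < m → ∀ (h : ℝ) {η : ℝ}, 0 ≤ η →
    P.real {ω | Cross 0 (8 * m) (lvl φ (h + 2 * η) ω)} ≤ (33 ^ d) ^ 2 *
      (P.real {ω | Cross 0 m (lvl φ h ω)} +
        (33 * m) ^ d * Real.exp (-(c * η ^ 2 * Real.sqrt (2 ^ n)))) ^ 2 +
        (33 * m) ^ d * Real.exp (-(c * η ^ 2 * Real.sqrt (2 ^ n))) := by
  obtain ⟨c, hc, ht⟩ := transfer (P := P) hd
  refine ⟨c, hc, fun {φ} hs n m hnm h η hη => ?_⟩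
  have hm : 1 ≤ m := Nat.one_le_two_pow.trans hnm.le
  have h1 := (ht hs (incEv_cross 0 (8 * m)) (localTo_cross 0 (8 * m)) n (h + η) hη).1
  have h2 := (ht hs (incEv_cross 0 m) (localTo_cross 0 m) n h hη).2
  have h3 := pr_cascade (by omega : 0 < d) hnm (h + η)
  have c1 : ((cube (0 : V d) (2 * (8 * m))).card : ℝ) ≤ (33 * m) ^ d := by
    rw [card_cube]
    exact_mod_cast Nat.pow_le_pow_left (by omega) d
  have c2 : ((cube (0 : V d) (2 * m)).card : ℝ) ≤ (33 * m) ^ d := by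
    rw [card_cube]
    exact_mod_cast Nat.pow_le_pow_left (by omega) d
  rw [show h + η + η = h + 2 * η by ring] at h1
  have hE := Real.exp_pos (-(c * η ^ 2 * Real.sqrt (2 ^ n)))
  generalize Real.exp (-(c * η ^ 2 * Real.sqrt (2 ^ n))) = E at *
  have h4 := h2.trans (add_le_add_right (mul_le_mul_of_nonneg_right c2 hE.le) _)
  refine h1.trans (add_le_add (h3.trans ?_) (mul_le_mul_of_nonneg_right c1 hE.le))
  exact mul_le_mul_of_nonneg_left (pow_le_pow_left₀ (pr_nonneg _ _ _) h4 2) (by positivity)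

lemma eventually_seed_err (d : ℕ) {c θ : ℝ} (hc : 0 < c) (hθ : 0 < θ) :
    ∀ᶠ n : ℕ in atTop, (66 * 2 ^ n : ℝ) ^ d * Real.exp (-(c * Real.exp (n / 10))) ≤ θ := by
  obtain ⟨a, -, ha⟩ := poly_le_growth 66 1
  have h1 := (tendsto_pow_atTop_nhds_zero_of_lt_one (r := (1 / 2 : ℝ)) (by norm_num)
    (by norm_num)).eventually_le_const hθ
  filter_upwards [h1, eventually_small 1 c a d one_pos hc] with n h2 h3
  have h4 : (66 * 2 ^ n : ℝ) ^ d ≤ growth a n ^ d :=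
    pow_le_pow_left₀ (by positivity) (by simpa using ha n) d
  have h5 : Real.exp (-Real.exp (((n : ℝ) + 4) / 20)) ≤ 1 :=
    Real.exp_le_one_iff.2 (neg_nonpos.2 (Real.exp_pos _).le)
  have h6 : (0 : ℝ) < (1 / 2) ^ n := by positivity
  rw [one_mul] at h3
  calc _ ≤ growth a n ^ d * Real.exp (-(c * Real.exp (n / 10))) :=
        mul_le_mul_of_nonneg_right h4 (Real.exp_pos _).le
    _ ≤ (1 / 2) ^ n * Real.exp (-Real.exp (((n : ℝ) + 4) / 20)) := h3
    _ ≤ (1 / 2) ^ n := mul_le_of_le_one_right h6.le h5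
    _ ≤ θ := h2

/-- Crossing probabilities which are small at one large scale stay small at larger scales. -/
lemma cross_small (hd : 3 ≤ d) : ∃ β : ℝ, 0 < β ∧ β ≤ 1 / 2 ∧ ∃ n₁ : ℕ, ∀ {φ : V d → Ω → ℝ},
    Splits P φ → ∀ (h : ℝ) (n m : ℕ), n₁ ≤ n → 2 ^ n < m → m ≤ 2 ^ (n + 1) →
    P.real {ω | Cross 0 m (lvl φ h ω)} ≤ β →
    ∀ k : ℕ, P.real {ω | Cross 0 (8 ^ k * m) (lvl φ (h + 1) ω)} ≤ β := by
  obtain ⟨c, hc, hstep⟩ := cross_step (P := P) hd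
  set N : ℝ := (33 ^ d) ^ 2 with hN
  have hN1 : 1 ≤ N := one_le_pow₀ (one_le_pow₀ (by norm_num))
  set β : ℝ := 1 / (8 * N) with hβ
  have hβ0 : 0 < β := by positivity
  have hβN : N * β = 1 / 8 := by rw [hβ]; field_simp
  set q : ℝ := Real.exp (-(3 / 20)) with hq
  have hq0 : 0 < q := Real.exp_pos _
  have hq1 : q < 1 := (Real.exp_lt_exp.2 (by norm_num : -(3 / 20 : ℝ) < 0)).trans_eq Real.exp_zero
  set s : ℝ := (1 - q) / 2 with hs
  have hs0 : 0 < s := by rw [hs]; linarith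
  obtain ⟨n₁, hn₁⟩ := eventually_atTop.1 (eventually_seed_err d (c := c * s ^ 2) (θ := β / 2)
    (by positivity) (by positivity))
  refine ⟨β, hβ0, ?_, n₁, fun {φ} hsp h n m hn hnm hmn h0 => ?_⟩
  · rw [hβ, div_le_div_iff₀ (by positivity) two_pos]
    linarith
  have key : ∀ k : ℕ, P.real {ω | Cross 0 (8 ^ k * m) (lvl φ (h + 1 - q ^ k) ω)} ≤ β := by
    intro k
    induction k with
    | zero => simpa using h0
    | succ k ih =>
      have e8 : (8 : ℕ) ^ k = 2 ^ (3 * k) := by rw [pow_mul]; norm_num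
      have a1 : 2 ^ (n + 3 * k) < 8 ^ k * m := by
        rw [e8, pow_add, mul_comm]
        exact Nat.mul_lt_mul_of_pos_left hnm (by positivity)
      have a2 : ((8 ^ k * m : ℕ) : ℝ) ≤ 2 * 2 ^ (n + 3 * k) := by
        have : 8 ^ k * m ≤ 2 * 2 ^ (n + 3 * k) := by
          rw [e8, pow_add, ← mul_assoc, ← pow_succ', mul_comm]
          exact Nat.mul_le_mul_right _ hmn
        exact_mod_cast this
      have h1 := hstep hsp a1 (h + 1 - q ^ k) (η := q ^ k * s) (by positivity)
      rw [show h + 1 - q ^ k + 2 * (q ^ k * s) = h + 1 - q ^ (k + 1) by rw [hs]; ring,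
        show 8 * (8 ^ k * m) = 8 ^ (k + 1) * m by ring] at h1
      have h2 : (33 * ((8 ^ k * m : ℕ) : ℝ)) ^ d *
          Real.exp (-(c * (q ^ k * s) ^ 2 * Real.sqrt (2 ^ (n + 3 * k)))) ≤ β / 2 := by
        refine le_trans (mul_le_mul (pow_le_pow_left₀ (by positivity) ?_ d) (Real.exp_le_exp.2 ?_)
          (Real.exp_pos _).le (by positivity)) (hn₁ (n + 3 * k) (by omega))
        · linarith
        · rw [neg_le_neg_iff, mul_pow, mul_comm (_ ^ 2) (s ^ 2), ← mul_assoc c,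
            mul_assoc (c * s ^ 2)]
          refine mul_le_mul_of_nonneg_left ?_ (by positivity)
          have e1 : (q ^ k) ^ 2 = Real.exp (-(3 * k / 10)) := by
            rw [hq, ← Real.exp_nat_mul, ← Real.exp_nat_mul]
            congr 1
            push_cast
            ring
          rw [e1]
          refine le_trans ?_ (mul_le_mul_of_nonneg_left (exp_le_sqrt_two_pow (n + 3 * k))
            (Real.exp_pos _).le)
          rw [← Real.exp_add]
          refine Real.exp_le_exp.2 ?_
          have : (0 : ℝ) ≤ n := Nat.cast_nonneg n
          have : (0 : ℝ) ≤ k := Nat.cast_nonneg k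
          push_cast
          linarith
      have he : 0 ≤ (33 * ((8 ^ k * m : ℕ) : ℝ)) ^ d *
          Real.exp (-(c * (q ^ k * s) ^ 2 * Real.sqrt (2 ^ (n + 3 * k)))) := by positivity
      generalize (33 * ((8 ^ k * m : ℕ) : ℝ)) ^ d *
          Real.exp (-(c * (q ^ k * s) ^ 2 * Real.sqrt (2 ^ (n + 3 * k)))) = e at h1 h2 he
      have h0' : 0 ≤ P.real {ω | Cross 0 (8 ^ k * m) (lvl φ (h + 1 - q ^ k) ω)} :=
        measureReal_nonneg
      generalize P.real {ω | Cross 0 (8 ^ k * m) (lvl φ (h + 1 - q ^ k) ω)} = p at h1 ih h0'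
      refine h1.trans ?_
      have h5 : (p + e) ^ 2 ≤ (3 / 2 * β) ^ 2 := pow_le_pow_left₀ (by linarith) (by linarith) 2
      calc N * (p + e) ^ 2 + e ≤ N * (3 / 2 * β) ^ 2 + β / 2 :=
            add_le_add (mul_le_mul_of_nonneg_left h5 (by positivity)) h2
        _ = 9 / 4 * (N * β) * β + β / 2 := by ring
        _ ≤ β := by rw [hβN]; linarith
  intro k
  refine le_trans (measureReal_mono fun ω hω => ?_) (key k)
  refine (incEv_cross 0 (8 ^ k * m)).mono (fun x hx => ?_) hω
  have : (0 : ℝ) < q ^ k := by positivity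
  have hx' : h + 1 ≤ φ x ω := hx
  change _ ≤ φ x ω
  linarith

end Cascade

section CrossingEstimates

variable {d : ℕ} {Ω : Type*} [MeasurableSpace Ω] {P : Measure Ω} [IsProbabilityMeasure P]

/-- An inequality between truncated probabilities passes to the full field. -/
lemma full_le_full (hd : 3 ≤ d) {φ : V d → Ω → ℝ} (hs : Splits P φ) {T T' : Set (V d) → Prop}
    (hT : IncEv T) (hT' : IncEv T') {W W' : Finset (V d)} (hW : LocalTo T W) (hW' : LocalTo T' W')
    {K : ℝ} (hK : 0 < K) (h : ℝ) (hpr : ∀ n a, pr n T a ≤ K * pr n T' a) :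
    P.real {ω | T (lvl φ (h + 1) ω)} ≤ K * P.real {ω | T' (lvl φ h ω)} := by
  obtain ⟨c, hc, ht⟩ := transfer (P := P) hd
  refine le_of_forall_pos_le_add fun θ hθ => ?_
  obtain ⟨n₁, hn₁⟩ := eventually_atTop.1 (eventually_err (W'.card + 1) 1 (c * (1 / 2) ^ 2) (θ / K) 0
    (by positivity) (by positivity) (by positivity))
  rw [show h + 1 = h + 1 / 2 + 1 / 2 by ring]
  refine full_le_of_scales hd hs hT hW (by norm_num : (0 : ℝ) < 1 / 2) (n₁ := n₁) fun N hN => ?_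
  have h1 := (ht hs hT' hW' N h (by norm_num : (0 : ℝ) ≤ 1 / 2)).2
  have h3 := hn₁ N hN
  rw [pow_zero, mul_one, add_one_mul] at h3
  have h4 := Real.exp_pos (-(c * (1 / 2) ^ 2 * Real.sqrt (2 ^ N)))
  generalize Real.exp (-(c * (1 / 2) ^ 2 * Real.sqrt (2 ^ N))) = E at *
  calc pr N T (h + 1 / 2) ≤ K * pr N T' (h + 1 / 2) := hpr _ _
    _ ≤ K * (P.real {ω | T' (lvl φ h ω)} + θ / K) :=
        mul_le_mul_of_nonneg_left (by linarith) hK.le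
    _ = K * P.real {ω | T' (lvl φ h ω)} + θ := by field_simp

lemma pr_cross_le_of_small (hd : 0 < d) {m M : ℕ} (hmM : 2 * m < M) (n : ℕ) (a : ℝ) :
    pr n (Cross (0 : V d) M) a ≤ (2 * M + 1) ^ d * pr n (Cross (0 : V d) m) a := by
  have h1 : pr n (Cross (0 : V d) M) a ≤ ∑ x ∈ cube (0 : V d) M, pr n (Cross x m) a := by
    refine pr_le_sum n _ _ (fun S hS => ?_) a
    obtain ⟨x, hx, y, hy, hr⟩ := connIn_iff.1 hS
    obtain ⟨i, hi⟩ := bdryAt_exists_abs hy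
    have hx := mem_boxAt_iff.1 hx
    refine ⟨x, hx, cross_of_reach hr (by simp [mem_cube]) fun h => ?_⟩
    have b1 := mem_cube.1 h i
    have b2 := mem_cube.1 hx i
    have b3 := abs_add_le (y i - x i) (x i)
    rw [sub_add_cancel, abs_sub_comm] at b3
    simp only [Pi.zero_apply, sub_zero, zero_sub, abs_neg] at hi b2
    push_cast at hi b1
    have : (2 * m : ℤ) < M := by exact_mod_cast hmM
    linarith
  refine h1.trans ((Finset.sum_le_card_nsmul _ _ _ fun x _ => pr_cross hd n m x a).trans ?_)
  rw [nsmul_eq_mul, card_cube]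
  push_cast
  exact le_rfl

lemma ufn_le_of_large {R : ℝ} (hR : Real.exp 8 ≤ R) : ufn R ≤ R / 16 := by
  have hR0 : 0 < R := (Real.exp_pos 8).trans_le hR
  have ht : 8 ≤ Real.log R := (Real.le_log_iff_exp_le hR0).2 hR
  set u := Real.log R ^ ((1 : ℝ) / 3) with hu
  have hu3 : u ^ 3 = Real.log R := by
    rw [hu, ← Real.rpow_natCast, ← Real.rpow_mul (by linarith)]
    norm_num
  have hu0 : 0 ≤ u := Real.rpow_nonneg (by linarith) _
  have hu2 : 2 ≤ u := by
    by_contra hlt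
    push Not at hlt
    have : u ^ 3 < 2 ^ 3 := pow_lt_pow_left₀ hlt hu0 (by norm_num)
    linarith
  have h16 : (16 : ℝ) ≤ Real.exp 3 := by
    have h1 : Real.exp 3 = Real.exp 1 ^ 3 := by rw [← Real.exp_nat_mul]; norm_num
    have h2 : (2.7 : ℝ) ^ 3 ≤ Real.exp 1 ^ 3 :=
      pow_le_pow_left₀ (by norm_num) (by linarith [Real.exp_one_gt_d9]) 3
    rw [h1]
    norm_num at h2 ⊢
    linarith
  rw [le_div_iff₀ (by norm_num)]
  calc ufn R * 16 ≤ Real.exp u * Real.exp 3 := mul_le_mul_of_nonneg_left h16 (Real.exp_pos _).le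
    _ = Real.exp (u + 3) := (Real.exp_add _ _).symm
    _ ≤ Real.exp (Real.log R) := Real.exp_le_exp.2 (by
        rw [← hu3]
        have := mul_nonneg (sub_nonneg.2 hu2) (by positivity : 0 ≤ u ^ 2 + 2 * u + 3)
        linarith)
    _ = R := Real.exp_log hR0

/-- The set of levels at which crossing probabilities are not bounded below. -/
def starSet (d : ℕ) {Ω : Type*} [MeasurableSpace Ω] (P : Measure Ω) (φ : V d → Ω → ℝ) : Set ℝ :=
  {h : ℝ | (⨅ R : ℕ, P {ω | ConnIn (lvl φ h ω) (box d ((R : ℝ) + 1))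
    (bdry d (2 * ((R : ℝ) + 1)))}) = 0}

lemma exists_small_cross (hd : 3 ≤ d) {φ : V d → Ω → ℝ} (hs : Splits P φ) {h : ℝ}
    (hh : h ∈ starSet d P φ) :
    ∃ m : ℕ, 1 ≤ m ∧ ∀ k : ℕ, P.real {ω | Cross 0 (8 ^ k * m) (lvl φ (h + 2) ω)} ≤ 1 / 2 := by
  obtain ⟨β, hβ0, hβ, n₁, key⟩ := cross_small (P := P) hd
  set K : ℝ := (2 * (2 ^ (n₁ + 2) : ℕ) + 1) ^ d with hK
  have hK1 : 1 ≤ K := one_le_pow₀ (by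
    have : (0 : ℝ) ≤ ((2 ^ (n₁ + 2) : ℕ) : ℝ) := Nat.cast_nonneg _
    linarith)
  have h1 : (⨅ R : ℕ, P {ω | ConnIn (lvl φ h ω) (box d ((R : ℝ) + 1))
    (bdry d (2 * ((R : ℝ) + 1)))}) < ENNReal.ofReal (β / K) := by
    rw [show _ = _ from hh]
    exact ENNReal.ofReal_pos.2 (by positivity)
  obtain ⟨R, hR⟩ := iInf_lt_iff.1 h1
  set m := R + 1 with hm
  have hR' : P.real {ω | Cross 0 m (lvl φ h ω)} ≤ β / K := by
    refine ENNReal.toReal_le_of_le_ofReal (by positivity) (le_trans (le_of_eq ?_) hR.le)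
    congr 1
    ext ω
    simp only [mem_ofPred_eq, Cross, box, bdry, hm]
    push_cast
    rfl
  have hfin : ∀ m' n, 1 ≤ m' → n₁ ≤ n → 2 ^ n < m' → m' ≤ 2 ^ (n + 1) →
      P.real {ω | Cross 0 m' (lvl φ (h + 1) ω)} ≤ β →
      ∃ m : ℕ, 1 ≤ m ∧ ∀ k : ℕ,
        P.real {ω | Cross 0 (8 ^ k * m) (lvl φ (h + 2) ω)} ≤ 1 / 2 := by
    intro m' n hm' hn h1 h2 h3
    refine ⟨m', hm', fun k => ?_⟩
    have := key hs (h + 1) n m' hn h1 h2 h3 k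
    rw [show h + 1 + 1 = h + 2 by ring] at this
    exact this.trans hβ
  by_cases hmn : m ≤ 2 ^ n₁
  · refine hfin (2 ^ (n₁ + 2)) (n₁ + 1) Nat.one_le_two_pow (by omega)
      (Nat.pow_lt_pow_right (by norm_num) (by omega)) le_rfl ?_
    have hlt : 2 * m < 2 ^ (n₁ + 2) := by
      have : 0 < 2 ^ n₁ := by positivity
      rw [pow_add]
      omega
    refine (full_le_full hd hs (incEv_cross 0 _) (incEv_cross 0 m) (localTo_cross 0 _)
      (localTo_cross 0 m) (by linarith : 0 < K) h
      fun n a => pr_cross_le_of_small (by omega) hlt n a).trans ?_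
    calc K * _ ≤ K * (β / K) := mul_le_mul_of_nonneg_left hR' (by linarith)
      _ = β := by field_simp
  · push Not at hmn
    have hm1 : m - 1 ≠ 0 := by
      have := Nat.one_le_two_pow (n := n₁)
      omega
    refine hfin m (Nat.log 2 (m - 1)) (by omega) ?_ ?_ ?_ ?_
    · exact (Nat.le_log_iff_pow_le (by norm_num) hm1).2 (by omega)
    · have := Nat.pow_log_le_self 2 hm1
      omega
    · have := Nat.lt_pow_succ_log_self (b := 2) (by norm_num) (m - 1)
      omega
    · refine (measureReal_mono fun ω hω => ?_).trans (hR'.trans (div_le_self hβ0.le hK1))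
      refine (incEv_cross 0 m).mono (fun x hx => ?_) hω
      have hx' : h + 1 ≤ φ x ω := hx
      change h ≤ φ x ω
      linarith

/-- Two levels above a subcritical level, disconnection is not rare. -/
theorem add_two_notMem_tildeSet (hd : 3 ≤ d) {φ : V d → Ω → ℝ} (hs : Splits P φ) {h : ℝ}
    (hh : h ∈ starSet d P φ) : h + 2 ∉ tildeSet d P φ := by
  obtain ⟨m, hm, hc⟩ := exists_small_cross hd hs hh
  set f : ℕ → ENNReal := fun R => ENNReal.ofReal (((R : ℝ) + 1) ^ d) *
    P {ω | ¬ ConnIn (lvl φ (h + 2) ω) (box d (ufn ((R : ℝ) + 1))) (bdry d ((R : ℝ) + 1))} with hf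
  have hpos : ∀ R, f R ≠ 0 := by
    intro R
    refine mul_ne_zero (ENNReal.ofReal_pos.2 (by positivity)).ne' (ne_of_gt ?_)
    refine (prob_disjoint_pos hd hs (cube 0 (R + 1)) (h + 2)).trans_le (measure_mono fun ω hω => ?_)
    intro hcon
    obtain ⟨x, -, y, hy, hr⟩ := connIn_iff.1 hcon
    refine hω y (mem_boxAt_iff.1 ?_) hr.right
    have := hy.1
    push_cast
    exact this
  obtain ⟨X, hX⟩ := exists_nat_ge (max (Real.exp 8) (2 * m))
  have hlarge : ∀ R, X ≤ R → 1 / 2 ≤ f R := by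
    intro R hR
    have hXR : (X : ℝ) ≤ R := by exact_mod_cast hR
    have hR8 : Real.exp 8 ≤ (R : ℝ) + 1 := by linarith [le_max_left (Real.exp 8) (2 * (m : ℝ))]
    have hRm : 2 * m ≤ R + 1 := by
      have : 2 * (m : ℝ) ≤ (R : ℝ) + 1 := by linarith [le_max_right (Real.exp 8) (2 * (m : ℝ))]
      exact_mod_cast this
    set t := (R + 1) / (2 * m) with ht
    have ht0 : t ≠ 0 := (Nat.div_pos hRm (by omega)).ne'
    set k := Nat.log 8 t with hk
    have k1 : 2 * (8 ^ k * m) ≤ R + 1 := by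
      have a1 := Nat.pow_log_le_self 8 ht0
      have a2 := Nat.div_mul_le_self (R + 1) (2 * m)
      calc 2 * (8 ^ k * m) = 8 ^ k * (2 * m) := by ring
        _ ≤ t * (2 * m) := Nat.mul_le_mul_right _ a1
        _ ≤ R + 1 := a2
    have k2 : R + 1 ≤ 16 * (8 ^ k * m) := by
      have a1 := Nat.lt_pow_succ_log_self (b := 8) (by norm_num) t
      have a2 := (Nat.lt_div_mul_add (a := R + 1) (b := 2 * m) (by omega)).le
      calc R + 1 ≤ t * (2 * m) + 2 * m := a2
        _ = (t + 1) * (2 * m) := by ring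
        _ ≤ 8 ^ (k + 1) * (2 * m) := Nat.mul_le_mul_right _ a1
        _ = 16 * (8 ^ k * m) := by ring
    have hsub : {ω | ¬ Cross 0 (8 ^ k * m) (lvl φ (h + 2) ω)} ⊆ {ω | ¬ ConnIn (lvl φ (h + 2) ω)
        (box d (ufn ((R : ℝ) + 1))) (bdry d ((R : ℝ) + 1))} := by
      intro ω hω hcon
      obtain ⟨x, hx, y, hy, hr⟩ := connIn_iff.1 hcon
      have k2' : (R : ℝ) + 1 ≤ 16 * ((8 ^ k * m : ℕ) : ℝ) := by exact_mod_cast k2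
      have hx' : x ∈ boxAt 0 ((8 ^ k * m : ℕ) : ℝ) :=
        boxAt_mono ((ufn_le_of_large hR8).trans (by linarith)) hx
      have hx2 : x ∈ boxAt 0 ((2 * (8 ^ k * m) : ℕ) : ℝ) :=
        boxAt_mono (by exact_mod_cast (by omega : 8 ^ k * m ≤ 2 * (8 ^ k * m))) hx'
      have hy' : y ∈ bdryAt 0 ((R + 1 : ℕ) : ℝ) := by push_cast; exact hy
      obtain ⟨z, hz, hr'⟩ := hr.hit_bdry hx2 (by
        rcases k1.lt_or_eq with hlt | heq
        · right
          intro hyb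
          obtain ⟨i, hi⟩ := bdryAt_exists_abs hy'
          have := mem_cube.1 (mem_boxAt_iff.1 hyb) i
          rw [abs_sub_comm, hi] at this
          have := Int.ofNat_le.1 this
          omega
        · left
          rw [heq]
          exact hy')
      exact hω (connIn_iff.2 ⟨x, hx', z, hz, hr'.mono inter_subset_left⟩)
    have hP : 1 / 2 ≤ P {ω | ¬ Cross 0 (8 ^ k * m) (lvl φ (h + 2) ω)} := by
      have h1 : P.real univ ≤ P.real {ω | Cross 0 (8 ^ k * m) (lvl φ (h + 2) ω)} +
          P.real {ω | ¬ Cross 0 (8 ^ k * m) (lvl φ (h + 2) ω)} :=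
        (measureReal_mono fun ω _ => em _).trans (measureReal_union_le _ _)
      rw [probReal_univ] at h1
      have h2 : (1 / 2 : ℝ) ≤ P.real {ω | ¬ Cross 0 (8 ^ k * m) (lvl φ (h + 2) ω)} := by
        linarith [hc k]
      have h3 := ENNReal.ofReal_le_ofReal h2
      rw [ofReal_measureReal] at h3
      refine le_trans (le_of_eq ?_) h3
      rw [ENNReal.ofReal_div_of_pos two_pos]
      simp
    calc (1 / 2 : ENNReal) = 1 * (1 / 2) := (one_mul _).symm
      _ ≤ f R := mul_le_mul' (ENNReal.one_le_ofReal.2 (one_le_pow₀ (by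
          have : (0 : ℝ) ≤ R := Nat.cast_nonneg R
          linarith))) (hP.trans (measure_mono hsub))
  obtain ⟨R₀, -, hmin⟩ := Finset.exists_min_image (Finset.range (X + 1)) f ⟨0, by simp⟩
  have hinf : min (1 / 2) (f R₀) ≤ ⨅ R, f R := by
    refine le_iInf fun R => ?_
    by_cases hR : X ≤ R
    · exact (min_le_left _ _).trans (hlarge R hR)
    · exact (min_le_right _ _).trans (hmin R (Finset.mem_range.2 (by omega)))
  intro hmem
  have h0 : (⨅ R, f R) = 0 := hmem
  rw [h0, nonpos_iff_eq_zero, min_eq_iff] at hinf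
  rcases hinf with ⟨h1, -⟩ | ⟨h1, -⟩
  · simp at h1
  · exact hpos R₀ h1

end CrossingEstimates

section Comparison

lemma tildeSet_downward {d : ℕ} {Ω : Type*} [MeasurableSpace Ω] {P : Measure Ω}
    {φ : V d → Ω → ℝ} {h h' : ℝ} (hh : h ≤ h') (hm : h' ∈ tildeSet d P φ) :
    h ∈ tildeSet d P φ := by
  refine le_antisymm (le_trans (iInf_mono fun R => mul_le_mul_right (measure_mono fun ω hω => ?_) _)
    (le_of_eq hm)) (zero_le)
  exact fun hc => hω (connIn_mono (fun x hx => hh.trans hx) le_rfl le_rfl hc)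

variable {d : ℕ} {Ω : Type*} [MeasurableSpace Ω] {P : Measure Ω} [IsProbabilityMeasure P]

/-- Outside the degenerate cases there are noncritical levels on either side. -/
lemma exists_noncritical (hd : 3 ≤ d) {φ : V d → Ω → ℝ} (hs : Splits P φ) {ε : ℝ} (hε : 0 < ε)
    (hne : hTilde d P φ + 3 * ε < hStarStar d P φ - 3 * ε) :
    hStarStar d P φ - ε ∉ starSet d P φ ∧ hTilde d P φ + ε ∉ tildeSet d P φ := by
  have e1 : hStarStar d P φ = sInf (starSet d P φ) := rfl
  have e2 : hTilde d P φ = sSup (tildeSet d P φ) := rfl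
  have hA : BddBelow (starSet d P φ) := by
    by_contra hA
    have hT : tildeSet d P φ = ∅ := by
      refine eq_empty_of_forall_notMem fun h hh => ?_
      rw [not_bddBelow_iff] at hA
      obtain ⟨a, ha, hlt⟩ := hA (h - 2)
      exact add_two_notMem_tildeSet hd hs ha (tildeSet_downward (by linarith) hh)
    rw [e1, e2, hT, Real.sSup_empty, Real.sInf_of_not_bddBelow hA] at hne
    linarith
  have hT : BddAbove (tildeSet d P φ) := by
    by_contra hT
    have hA : starSet d P φ = ∅ := by
      refine eq_empty_of_forall_notMem fun h hh => ?_
      rw [not_bddAbove_iff] at hT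
      obtain ⟨a, ha, hlt⟩ := hT (h + 2)
      exact add_two_notMem_tildeSet hd hs hh (tildeSet_downward hlt.le ha)
    rw [e1, e2, hA, Real.sInf_empty, Real.sSup_of_not_bddAbove hT] at hne
    linarith
  constructor
  · intro h
    have := csInf_le hA h
    rw [← e1] at this
    linarith
  · intro h
    have := le_csSup hT h
    rw [← e2] at this
    linarith

lemma ofReal_le_add {Ω : Type*} [MeasurableSpace Ω] {P : Measure Ω} [IsFiniteMeasure P]
    {A B : Set Ω} {e e' : ℝ} (he : 0 ≤ e) (hee : e ≤ e') (h : P.real A ≤ P.real B + e) :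
    P A ≤ P B + ENNReal.ofReal e' := by
  have h1 := ENNReal.ofReal_le_ofReal h
  rw [ENNReal.ofReal_add measureReal_nonneg he, ofReal_measureReal, ofReal_measureReal] at h1
  exact h1.trans (by gcongr)

end Comparison

/-- Proposition 1.3: comparison between the Gaussian free field and the noised
finite-range approximations in the fictitious regime `(h̃ + 3ε, h_{**} - 3ε)`. -/
theorem comparison_truncated (d : ℕ) (hd : 3 ≤ d) {Ω : Type*} [MeasurableSpace Ω]
    (P : Measure Ω) [IsProbabilityMeasure P] (φ : V d → Ω → ℝ) (φL : ℕ → V d → Ω → ℝ)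
    (U : V d → Ω → ℝ) (hφ : IsGFF P φ) (hcoup : IsTruncCoupling d P φ φL)
    (hU : IsIIDUnif P U)
    (hind : IndepFun (proc U)
      (fun ω => (proc φ ω, fun p : ℕ × V d => φL p.1 p.2 ω)) P)
    (ε : ℝ) (hε : 0 < ε) :
    ∃ c C : ℝ, 0 < c ∧ 0 < C ∧ ∃ δ ∈ Set.Ioo (0 : ℝ) 1, ∃ L : ℕ, 1 ≤ L ∧
      ∀ h : ℝ, hTilde d P φ + 3 * ε < h → h < hStarStar d P φ - 3 * ε →
        ∀ r R : ℕ, 1 ≤ r → 2 * r ≤ R →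
          (P {ω | ConnIn (lvl φ (h + ε) ω) (box d (r : ℝ)) (bdry d (R : ℝ))} ≤
              P {ω | ConnIn (TdLvl U (φL L) δ h ω) (box d (r : ℝ)) (bdry d (R : ℝ))} +
                ENNReal.ofReal
                  (C * Real.exp (-Real.exp (c * Real.log (r : ℝ) ^ ((1 : ℝ) / 3)))) ∧
            P {ω | ConnIn (TdLvl U (φL L) δ h ω) (box d (r : ℝ)) (bdry d (R : ℝ))} ≤
              P {ω | ConnIn (lvl φ (h - ε) ω) (box d (r : ℝ)) (bdry d (R : ℝ))} +
                ENNReal.ofReal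
                  (C * Real.exp (-Real.exp (c * Real.log (r : ℝ) ^ ((1 : ℝ) / 3))))) := by
  by_cases hne : hTilde d P φ + 3 * ε < hStarStar d P φ - 3 * ε
  · have hs : Splits P φ := fun n => ⟨_, (hcoup _).1, (hcoup _).2.1⟩
    obtain ⟨hh₁, hh₂⟩ := exists_noncritical hd hs hε hne
    obtain ⟨δ, hδ, L, hL, key⟩ :=
      comparison_of_noncritical hd hφ.1 hcoup hU hind hε hh₁ hh₂
    refine ⟨1 / 20, 2, by norm_num, two_pos, δ, hδ, L, hL, fun h hlo hhi r R hr hrR => ?_⟩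
    obtain ⟨k1, k2⟩ := key h (by linarith) (by linarith) r R hr hrR
    have he : 0 ≤ 2 * Real.exp (-Real.exp (Real.log r ^ ((1 : ℝ) / 3) / 20)) := by positivity
    have hee : 2 * Real.exp (-Real.exp (Real.log r ^ ((1 : ℝ) / 3) / 20)) ≤
        2 * Real.exp (-Real.exp (1 / 20 * Real.log (r : ℝ) ^ ((1 : ℝ) / 3))) := by
      rw [div_mul_eq_mul_div, one_mul]
    exact ⟨ofReal_le_add he hee k1, ofReal_le_add he hee k2⟩
  · exact ⟨1, 1, one_pos, one_pos, 1 / 2, by norm_num, 1, le_rfl,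
      fun h hlo hhi => absurd (hlo.trans hhi) hne⟩

end
end GFFperc
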